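/- Let ℓ be a prime. The only solutions in integers x ≥ 1, y to the equation (x+1)³ + (x+2)³ + (x+3)³ + (x+4)³ + (x+5)³ = yˡ are (x, y, ℓ) = (24, ±315, 2), (95, ±2170, 2) and (117, ±2940, 2). -/

import Mathlib

/-! ### A congruence sieve for small exponents -/

namespace CubeSieve

/-- `f x`, with `x` brought to normal form before `f` is applied. -/
def force {α : Type} (x : ℕ) (f : ℕ → α) : α := Nat.rec (f 0) (fun m _ => f (Nat.succ m)) x

theorem force_eq {α : Type} (x : ℕ) (f : ℕ → α) : force x f = f x := by
  cases x <;> rfl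

/-- `b ^ e` modulo `q` by binary exponentiation, for `e < 2 ^ fuel`. -/
noncomputable def powMod (q fuel : ℕ) : ℕ → ℕ → ℕ :=
  Nat.rec (fun _ _ => 1) (fun _ ih b e =>
    bif Nat.beq e 0 then 1
    else force (Nat.mod (Nat.mul b b) q) fun b2 => force (Nat.div e 2) fun e2 =>
      bif Nat.beq (Nat.mod e 2) 0 then ih b2 e2 else Nat.mod (Nat.mul b (ih b2 e2)) q) fuel

theorem powMod_cast (q fuel : ℕ) : ∀ b e : ℕ, e < 2 ^ fuel →
    ((powMod q fuel b e : ℕ) : ZMod q) = (b : ZMod q) ^ e := by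
  induction fuel with
  | zero =>
    intro b e he
    obtain rfl : e = 0 := by simpa using he
    simp [powMod]
  | succ f ih =>
    intro b e he
    have hstep : powMod q (f + 1) b e = if e = 0 then 1 else
        if e % 2 = 0 then powMod q f (b * b % q) (e / 2)
        else b * powMod q f (b * b % q) (e / 2) % q := by
      change (bif Nat.beq e 0 then 1 else force (b * b % q) fun b2 => force (e / 2) fun e2 =>
        bif Nat.beq (e % 2) 0 then powMod q f b2 e2 else b * powMod q f b2 e2 % q) = _
      simp only [force_eq, Nat.beq_eq, cond_eq_ite]
    have hlt : e / 2 < 2 ^ f := by rw [pow_succ] at he; omega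
    have hsq : ((b * b % q : ℕ) : ZMod q) = (b : ZMod q) ^ 2 := by
      rw [ZMod.natCast_mod]; push_cast; ring
    rw [hstep]
    split_ifs with h0 h1
    · simp [h0]
    · rw [ih _ _ hlt, hsq, ← pow_mul]; congr 1; omega
    · rw [ZMod.natCast_mod, Nat.cast_mul, ih _ _ hlt, hsq, ← pow_mul, ← pow_succ']
      congr 1; omega

/-- Tests that `s * h ^ i` takes the value `1` for `i = fuel` and not before, and that
`(C * (s * h ^ i) + 6) ^ n` avoids `0` and `d` modulo `q` for `i < fuel`. -/
noncomputable def orbitCheck (q n h C d fuel : ℕ) : ℕ → Bool :=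
  Nat.rec (fun s => Nat.beq s 1) (fun f ih s =>
    force (Nat.mod (Nat.pow (Nat.add (Nat.mul C s) 6) n) q) fun w =>
    bif Nat.beq w 0 then false else bif Nat.beq w d then false else
     force (Nat.mod (Nat.mul s h) q) fun s' => bif Nat.beq s' 1 then Nat.beq f 0 else ih s') fuel

theorem natCast_inj_of_lt {q a b : ℕ} (ha : a < q) (hb : b < q)
    (h : (a : ZMod q) = (b : ZMod q)) : a = b := by
  rw [ZMod.natCast_eq_natCast_iff'] at h
  rwa [Nat.mod_eq_of_lt ha, Nat.mod_eq_of_lt hb] at h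

theorem orbitCheck_spec {q n h C d : ℕ} (hq : 1 < q) (hd : d < q) (fuel : ℕ) :
    ∀ s : ℕ, orbitCheck q n h C d fuel s = true →
      ((s : ZMod q) * (h : ZMod q) ^ fuel = 1) ∧
      (∀ i, 0 < i → i < fuel → (s : ZMod q) * (h : ZMod q) ^ i ≠ 1) ∧
      ∀ i < fuel, ((C : ZMod q) * (s * (h : ZMod q) ^ i) + 6) ^ n ≠ 0 ∧
        ((C : ZMod q) * (s * (h : ZMod q) ^ i) + 6) ^ n ≠ d := by
  induction fuel with
  | zero =>
    intro s hs
    obtain rfl : s = 1 := by simpa [orbitCheck, Nat.beq_eq] using hs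
    simp
  | succ f ih =>
    intro s hs
    have hstep : orbitCheck q n h C d (f + 1) s = if (C * s + 6) ^ n % q = 0 then false else
        if (C * s + 6) ^ n % q = d then false else
        if s * h % q = 1 then Nat.beq f 0 else orbitCheck q n h C d f (s * h % q) := by
      change (force ((C * s + 6) ^ n % q) fun w =>
        bif Nat.beq w 0 then false else bif Nat.beq w d then false else
        force (s * h % q) fun s' => bif Nat.beq s' 1 then Nat.beq f 0 else
          orbitCheck q n h C d f s') = _
      simp only [force_eq, Nat.beq_eq, cond_eq_ite]
    rw [hstep] at hs
    split_ifs at hs with h0 h1 h2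
    all_goals
      have e0 : ((C : ZMod q) * (s * (h : ZMod q) ^ 0) + 6) ^ n
          = (((C * s + 6) ^ n % q : ℕ) : ZMod q) := by
        rw [ZMod.natCast_mod]; push_cast; ring
      have hmod : (C * s + 6) ^ n % q < q := Nat.mod_lt _ (by omega)
      have f0 : ((C : ZMod q) * (s * (h : ZMod q) ^ 0) + 6) ^ n ≠ 0 := by
        rw [e0]; intro hc
        exact h0 (natCast_inj_of_lt hmod (by omega) (by simpa using hc))
      have f1 : ((C : ZMod q) * (s * (h : ZMod q) ^ 0) + 6) ^ n ≠ d := by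
        rw [e0]; intro hc
        exact h1 (natCast_inj_of_lt hmod hd hc)
      have e1 : ((s * h % q : ℕ) : ZMod q) = s * h := by
        rw [ZMod.natCast_mod]; push_cast; ring
    · obtain rfl : f = 0 := by simpa [Nat.beq_eq] using hs
      refine ⟨?_, ?_, ?_⟩
      · rw [zero_add, pow_one, ← e1, h2]; simp
      · intro i hi hi'; omega
      · intro i hi
        obtain rfl : i = 0 := by omega
        exact ⟨f0, f1⟩
    · obtain ⟨g1, g2, g3⟩ := ih _ hs
      rw [e1] at g1 g2 g3
      refine ⟨?_, ?_, ?_⟩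
      · rw [← g1]; ring
      · intro i hi hi'
        rcases Nat.lt_or_ge 1 i with hi2 | hi2
        · have := g2 (i - 1) (by omega) (by omega)
          rwa [mul_assoc, ← pow_succ', Nat.sub_add_cancel hi] at this
        · obtain rfl : i = 1 := by omega
          intro hc
          refine h2 (natCast_inj_of_lt (Nat.mod_lt _ (by omega)) hq ?_)
          rw [e1, ← pow_one (h : ZMod q), hc]; simp
      · intro i hi
        rcases Nat.eq_zero_or_pos i with rfl | hi0
        · exact ⟨f0, f1⟩
        · have := g3 (i - 1) (by omega)
          rwa [mul_assoc (s : ZMod q), ← pow_succ', Nat.sub_add_cancel hi0] at this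

/-- Tests that `C * u ^ (2 * ℓ) + 6 = D * v ^ ℓ` has no solution modulo `q = n * ℓ + 1`, given
that `h` has order `k = n / 2`. -/
noncomputable def caseCheck (q n h k C D : ℕ) : Bool :=
  force (Nat.mod (Nat.pow D n) q) fun d =>
    bif Nat.beq (Nat.mod (Nat.pow 6 n) q) d then false else orbitCheck q n h C d k 1

theorem caseCheck_spec {q n h k l C D : ℕ} (hq : q.Prime) (hq6 : 6 < q) (hn : n = 2 * k)
    (hk : 0 < k) (hql : q = n * l + 1) (hc : caseCheck q n h k C D = true) (u v : ZMod q) :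
    (C : ZMod q) * u ^ (2 * l) + 6 ≠ D * v ^ l := by
  have hstep : caseCheck q n h k C D = if 6 ^ n % q = D ^ n % q then false else
      orbitCheck q n h C (D ^ n % q) k 1 := by
    change (force (D ^ n % q) fun d => bif Nat.beq (6 ^ n % q) d then false else
      orbitCheck q n h C d k 1) = _
    simp only [force_eq, Nat.beq_eq, cond_eq_ite]
  rw [hstep] at hc
  split_ifs at hc with h6
  have : Fact q.Prime := ⟨hq⟩
  have hq1 : q - 1 = n * l := by omega
  obtain ⟨g1, g2, g3⟩ := orbitCheck_spec (by omega) (Nat.mod_lt _ (by omega)) k 1 hc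
  simp only [Nat.cast_one, one_mul] at g1 g2 g3
  have hprim : IsPrimitiveRoot (h : ZMod q) k := IsPrimitiveRoot.mk_of_lt _ hk g1 g2
  intro heq
  have key : ∀ w : ZMod q, w = C * u ^ (2 * l) + 6 → w ^ n = 0 ∨ w ^ n = ((D ^ n % q : ℕ) : ZMod q) := by
    intro w hw
    have : w ^ n = D ^ n * v ^ (q - 1) := by
      rw [hw, heq, mul_pow, ← pow_mul, hq1, mul_comm l n]
    rcases eq_or_ne v 0 with rfl | hv
    · left; rw [this, zero_pow (by omega), mul_zero]
    · right; rw [this, ZMod.pow_card_sub_one_eq_one hv, ZMod.natCast_mod]; simp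
  rcases eq_or_ne u 0 with rfl | hu
  · have hl : l ≠ 0 := by rintro rfl; omega
    rcases key 6 (by simp [hl]) with h0 | h0
    · have h60 := eq_zero_of_pow_eq_zero h0
      have : ((6 : ℕ) : ZMod q) = ((0 : ℕ) : ZMod q) := by simpa using h60
      have := natCast_inj_of_lt hq6 (by omega) this
      omega
    · refine h6 (natCast_inj_of_lt (Nat.mod_lt _ (by omega)) (Nat.mod_lt _ (by omega)) ?_)
      rw [← h0, ZMod.natCast_mod]; simp
  · have hs : (u ^ (2 * l)) ^ k = 1 := by
      rw [← pow_mul, show 2 * l * k = q - 1 by rw [hq1, hn]; ring]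
      exact ZMod.pow_card_sub_one_eq_one hu
    have : NeZero k := ⟨hk.ne'⟩
    obtain ⟨i, hi, hi'⟩ := hprim.eq_pow_of_pow_eq_one hs
    obtain ⟨a1, a2⟩ := g3 i hi
    rcases key _ rfl with h0 | h0
    · exact a1 (by rw [hi']; exact h0)
    · exact a2 (by rw [hi']; exact h0)

/-- Runs `caseCheck` on the seven systems of coefficients, trying several `h`. -/
noncomputable def genSearch (q n k l C2 C3 C5 D : ℕ) (fuel : ℕ) : ℕ → Bool :=
  Nat.rec (fun _ => false) (fun _ ih g =>
    force (powMod q 20 g (Nat.mul 2 l)) fun h => bif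
      bif caseCheck q n h k 1 D then
      bif caseCheck q n h k C5 1 then
      bif caseCheck q n h k C2 (Nat.mul 2 D) then
      bif force (Nat.mod (Nat.mul C2 C5) q) (fun C => caseCheck q n h k C 2) then
      bif caseCheck q n h k C3 (Nat.mul 3 D) then
      bif force (Nat.mod (Nat.mul C3 C5) q) (fun C => caseCheck q n h k C 3) then
      force (Nat.mod (Nat.mul C2 C3) q) (fun C => caseCheck q n h k C (Nat.mul 6 D))
      else false else false else false else false else false else false
    then true else force (Nat.succ g) ih) fuel

/-- Prepares the coefficients for `genSearch`. -/
noncomputable def allCases (q n l : ℕ) : Bool :=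
  force (Nat.sub l 1) fun e =>
  force (powMod q 20 4 e) fun C2 => force (powMod q 20 9 e) fun C3 =>
  force (powMod q 20 5 e) fun D => force (Nat.mod (Nat.mul D D) q) fun C5 =>
  force (Nat.div n 2) fun k => genSearch q n k l C2 C3 C5 D 12 2

/-- None of the seven equations has a solution in `ZMod q`. -/
def Insoluble (q l : ℕ) : Prop :=
  ∀ a b c : ℕ, a ≤ 1 → b ≤ 1 → c ≤ 1 → ¬ (a = 1 ∧ b = 1 ∧ c = 1) → ∀ u v : ZMod q,
    (4 ^ (a * (l - 1)) * 9 ^ (b * (l - 1)) * 25 ^ (c * (l - 1)) : ZMod q) * u ^ (2 * l) + 6 ≠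
      2 ^ a * 3 ^ b * 5 ^ ((1 - c) * (l - 1)) * v ^ l

theorem genSearch_spec {q n k l C2 C3 C5 D : ℕ} (hq : q.Prime) (hq6 : 6 < q) (hn : n = 2 * k)
    (hk : 0 < k) (hql : q = n * l + 1)
    (h2 : (C2 : ZMod q) = 4 ^ (l - 1)) (h3 : (C3 : ZMod q) = 9 ^ (l - 1))
    (h5 : (C5 : ZMod q) = 25 ^ (l - 1)) (hD : (D : ZMod q) = 5 ^ (l - 1)) (fuel : ℕ) :
    ∀ g, genSearch q n k l C2 C3 C5 D fuel g = true → Insoluble q l := by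
  induction fuel with
  | zero => intro g hg; simp [genSearch] at hg
  | succ f ih =>
    intro g hg
    have hstep : ∃ h, genSearch q n k l C2 C3 C5 D (f + 1) g =
        ((caseCheck q n h k 1 D && caseCheck q n h k C5 1 && caseCheck q n h k C2 (2 * D) &&
          caseCheck q n h k (C2 * C5 % q) 2 && caseCheck q n h k C3 (3 * D) &&
          caseCheck q n h k (C3 * C5 % q) 3 && caseCheck q n h k (C2 * C3 % q) (6 * D)) ||
        genSearch q n k l C2 C3 C5 D f (g + 1)) := by
      refine ⟨powMod q 20 g (2 * l), ?_⟩
      change (force (powMod q 20 g (2 * l)) fun h => bif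
        bif caseCheck q n h k 1 D then
        bif caseCheck q n h k C5 1 then
        bif caseCheck q n h k C2 (2 * D) then
        bif force (C2 * C5 % q) (fun C => caseCheck q n h k C 2) then
        bif caseCheck q n h k C3 (3 * D) then
        bif force (C3 * C5 % q) (fun C => caseCheck q n h k C 3) then
        force (C2 * C3 % q) (fun C => caseCheck q n h k C (6 * D))
        else false else false else false else false else false else false
        then true else force (g + 1) (genSearch q n k l C2 C3 C5 D f)) = _
      simp only [force_eq]
      generalize caseCheck q n _ k 1 D = x1
      generalize caseCheck q n _ k C5 1 = x2
      generalize caseCheck q n _ k C2 (2 * D) = x3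
      generalize caseCheck q n _ k (C2 * C5 % q) 2 = x4
      generalize caseCheck q n _ k C3 (3 * D) = x5
      generalize caseCheck q n _ k (C3 * C5 % q) 3 = x6
      generalize caseCheck q n _ k (C2 * C3 % q) (6 * D) = x7
      cases x1 <;> cases x2 <;> cases x3 <;> cases x4 <;> cases x5 <;> cases x6 <;> cases x7 <;> rfl
    obtain ⟨h, hh⟩ := hstep
    rw [hh, Bool.or_eq_true] at hg
    rcases hg with hg | hg
    · simp only [Bool.and_eq_true] at hg
      obtain ⟨⟨⟨⟨⟨⟨y1, y2⟩, y3⟩, y4⟩, y5⟩, y6⟩, y7⟩ := hg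
      intro a b c ha hb hc habc u v
      have spec := fun {C D : ℕ} (hy : caseCheck q n h k C D = true) =>
        caseCheck_spec hq hq6 hn hk hql hy u v
      interval_cases a <;> interval_cases b <;> interval_cases c
      · simpa [hD] using spec y1
      · simpa [h5] using spec y2
      · simpa [hD, h3] using spec y5
      · simpa [h5, h3, ZMod.natCast_mod] using spec y6
      · simpa [hD, h2] using spec y3
      · simpa [h5, h2, ZMod.natCast_mod] using spec y4
      · have := spec y7
        norm_num [hD, h2, h3, ZMod.natCast_mod] at this ⊢
        exact this
      · simp at habc
    · exact ih _ hg

theorem allCases_spec {q n l : ℕ} (hq : q.Prime) (hq6 : 6 < q) (hn : n % 2 = 0) (hn0 : 0 < n)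
    (hql : q = n * l + 1) (hl : l < 2 ^ 20) (h : allCases q n l = true) : Insoluble q l := by
  have hstep : allCases q n l = genSearch q n (n / 2) l (powMod q 20 4 (l - 1))
      (powMod q 20 9 (l - 1)) (powMod q 20 5 (l - 1) * powMod q 20 5 (l - 1) % q)
      (powMod q 20 5 (l - 1)) 12 2 := by
    simp only [allCases, force_eq]; rfl
  have hl' : l - 1 < 2 ^ 20 := by omega
  rw [hstep] at h
  refine genSearch_spec hq hq6 (by omega) (by omega) hql ?_ ?_ ?_ ?_ 12 2 h
  · rw [powMod_cast _ _ _ _ hl']; simp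
  · rw [powMod_cast _ _ _ _ hl']; simp
  · rw [ZMod.natCast_mod, Nat.cast_mul, powMod_cast _ _ _ _ hl', ← mul_pow]; norm_num
  · rw [powMod_cast _ _ _ _ hl']; simp

/-- Tests that no `d` with `d₀ ≤ d < d₀ + fuel` and `d * d ≤ q` divides `q`. -/
noncomputable def noDivisor (q fuel : ℕ) : ℕ → Bool :=
  Nat.rec (fun _ => true) (fun _ ih d =>
    bif Nat.ble (Nat.mul d d) q then
      bif Nat.beq (Nat.mod q d) 0 then false else force (Nat.succ d) ih
    else true) fuel

theorem noDivisor_iff (q fuel : ℕ) : ∀ d₀, noDivisor q fuel d₀ = true ↔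
    ∀ d, d₀ ≤ d → d < d₀ + fuel → d * d ≤ q → ¬ d ∣ q := by
  induction fuel with
  | zero => exact fun d₀ => ⟨fun _ d h1 h2 => by omega, fun _ => rfl⟩
  | succ f ih =>
    intro d₀
    have hstep : noDivisor q (f + 1) d₀ = if d₀ * d₀ ≤ q then
        if q % d₀ = 0 then false else noDivisor q f (d₀ + 1) else true := by
      change (bif Nat.ble (d₀ * d₀) q then
        bif Nat.beq (q % d₀) 0 then false else force (d₀ + 1) (noDivisor q f) else true) = _
      simp only [force_eq, Nat.beq_eq, cond_eq_ite, Nat.ble_eq]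
    rw [hstep]
    split_ifs with h0 h1
    · simp only [false_iff, not_forall]
      exact ⟨d₀, le_rfl, by omega, h0, fun h => h (Nat.dvd_of_mod_eq_zero h1)⟩
    · rw [ih]
      constructor
      · intro h d hd hd' hdd
        rcases hd.eq_or_lt with rfl | hlt
        · exact fun hdvd => h1 (Nat.mod_eq_zero_of_dvd hdvd)
        · exact h d hlt (by omega) hdd
      · exact fun h d hd hd' => h d (by omega) (by omega)
    · simp only [true_iff]
      intro d hd _ hdd
      exact absurd ((Nat.mul_le_mul hd hd).trans hdd) h0

theorem prime_of_noDivisor {q fuel : ℕ} (hq : 2 ≤ q) (hf : q < (fuel + 2) ^ 2)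
    (h : noDivisor q fuel 2 = true) : q.Prime := by
  by_contra hp
  have hsq := Nat.minFac_sq_le_self (by omega) hp
  have h2 := (Nat.minFac_prime (show q ≠ 1 by omega)).two_le
  rw [noDivisor_iff] at h
  refine h q.minFac h2 ?_ (by rwa [← sq]) (Nat.minFac_dvd q)
  have := lt_of_pow_lt_pow_left₀ 2 (by omega) (hsq.trans_lt hf)
  omega

/-- A Pocklington test for `q = n * l + 1` with base `2`. -/
noncomputable def pocklington (q n l : ℕ) : Bool :=
  force (Nat.mod (Nat.pow 2 n) q) fun a =>
    bif Nat.beq (powMod q 20 a l) 1 then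
      Nat.beq (Nat.gcd (Nat.add a (Nat.sub q 1)) q) 1 else false

theorem prime_of_pocklington {q n l : ℕ} (hl : l.Prime) (hl20 : l < 2 ^ 20) (hn0 : 0 < n)
    (hn : n < l + 2) (hq : q = n * l + 1) (h : pocklington q n l = true) : q.Prime := by
  have hstep : pocklington q n l = if powMod q 20 (2 ^ n % q) l = 1 then
      Nat.beq (Nat.gcd (2 ^ n % q + (q - 1)) q) 1 else false := by
    change (force (2 ^ n % q) fun a => bif Nat.beq (powMod q 20 a l) 1 then
      Nat.beq (Nat.gcd (a + (q - 1)) q) 1 else false) = _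
    simp only [force_eq, Nat.beq_eq, cond_eq_ite]
  rw [hstep] at h
  split_ifs at h with h1
  rw [Nat.beq_eq] at h
  have hnl := Nat.mul_pos hn0 hl.pos
  have hpow : (((2 ^ n % q : ℕ) : ZMod q)) ^ l = 1 := by
    rw [← powMod_cast q 20 _ _ hl20, h1]; simp
  set a := 2 ^ n % q
  by_contra hp
  have hpp := Nat.minFac_prime (show q ≠ 1 by omega)
  have hsq := Nat.minFac_sq_le_self (by omega) hp
  have hdvd := Nat.minFac_dvd q
  set p := q.minFac
  have : Fact p.Prime := ⟨hpp⟩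
  have hpow' : (a : ZMod p) ^ l = 1 := by
    have := congrArg (ZMod.castHom hdvd (ZMod p)) hpow
    rwa [map_pow, map_natCast, map_one] at this
  have hne : (a : ZMod p) ≠ 1 := by
    intro h1
    have hd : p ∣ a + (q - 1) := by
      rw [← ZMod.natCast_eq_zero_iff, Nat.cast_add, Nat.cast_sub (by omega), h1,
        (ZMod.natCast_eq_zero_iff q p).mpr hdvd]
      simp
    have := Nat.dvd_gcd hd hdvd
    rw [h] at this
    exact hpp.one_lt.ne' (Nat.dvd_one.mp this)
  have ha0 : (a : ZMod p) ≠ 0 := by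
    intro h0; rw [h0, zero_pow hl.ne_zero] at hpow'; exact zero_ne_one hpow'
  have hord : orderOf (a : ZMod p) = l := by
    have : Fact l.Prime := ⟨hl⟩
    exact orderOf_eq_prime hpow' hne
  have hlp : l ∣ p - 1 := hord ▸ orderOf_dvd_of_pow_eq_one (ZMod.pow_card_sub_one_eq_one ha0)
  have hp2 : 2 ≤ p := hpp.two_le
  have hle : l ≤ p - 1 := Nat.le_of_dvd (by omega) hlp
  have : (l + 1) ^ 2 ≤ n * l + 1 := by
    rw [← hq]; exact (Nat.pow_le_pow_left (by omega : l + 1 ≤ p) 2).trans hsq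
  nlinarith [hl.pos]

/-- Searches for a prime `q = n * l + 1` modulo which all seven equations are insoluble. -/
noncomputable def sieve (l fuel : ℕ) : ℕ → Bool :=
  Nat.rec (fun _ => false) (fun _ ih n =>
    force (Nat.succ (Nat.mul n l)) fun q =>
    bif (bif Nat.beq (Nat.gcd q 2305567963945518424753102147331756070) 1 then
      bif pocklington q n l then allCases q n l else false else false) then true
    else force (Nat.add n 2) ih) fuel

theorem sieve_spec {l : ℕ} (hl : l.Prime) (h5 : 5 ≤ l) (hl20 : l < 2 ^ 20) (fuel : ℕ) :
    ∀ n, 0 < n → n % 2 = 0 → n + 2 * fuel < l + 2 → sieve l fuel n = true →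
      ∃ q, Insoluble q l := by
  induction fuel with
  | zero => intro n _ _ _ h; simp [sieve] at h
  | succ f ih =>
    intro n hn0 hn2 hnl h
    have hstep : sieve l (f + 1) n = (((Nat.beq (Nat.gcd (n * l + 1)
        2305567963945518424753102147331756070) 1 && pocklington (n * l + 1) n l) &&
        allCases (n * l + 1) n l) || sieve l f (n + 2)) := by
      change (force (n * l + 1) fun q =>
        bif (bif Nat.beq (Nat.gcd q 2305567963945518424753102147331756070) 1 then
          bif pocklington q n l then allCases q n l else false else false) then true
        else force (n + 2) (sieve l f)) = _
      simp only [force_eq]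
      generalize Nat.beq _ _ = x1
      generalize pocklington _ _ _ = x2
      generalize allCases _ _ _ = x3
      cases x1 <;> cases x2 <;> cases x3 <;> rfl
    simp only [hstep, Bool.or_eq_true, Bool.and_eq_true] at h
    rcases h with ⟨⟨_, h1⟩, h2⟩ | h
    · have h10 : 2 * 5 ≤ n * l := Nat.mul_le_mul (by omega) h5
      exact ⟨n * l + 1, allCases_spec (prime_of_pocklington hl hl20 hn0 (by omega) rfl h1)
        (by omega) hn2 hn0 rfl hl20 h2⟩
    · exact ih (n + 2) (by omega) (by omega) (by omega) h

/-- Runs `sieve` on `l, l + 2, …` (`fuel` terms), skipping values with a small factor. -/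
noncomputable def sieveRange (fuel : ℕ) : ℕ → Bool :=
  Nat.rec (fun _ => true) (fun _ ih l =>
    bif (bif Nat.beq (Nat.gcd l 2305567963945518424753102147331756070) 1 then
      sieve l 60 2 else true) then force (Nat.add l 2) ih else false) fuel

theorem sieveRange_spec (fuel : ℕ) : ∀ l₀ l, 201 ≤ l₀ → l₀ % 2 = 1 → l.Prime → l₀ ≤ l →
    l < l₀ + 2 * fuel → l < 2 ^ 20 → sieveRange fuel l₀ = true → ∃ q, Insoluble q l := by
  induction fuel with
  | zero => intro l₀ l _ _ _ h1 h2; omega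
  | succ f ih =>
    intro l₀ l h201 hodd hl hle hlt hl20 h
    have hstep : sieveRange (f + 1) l₀ = (((!Nat.beq (Nat.gcd l₀
        2305567963945518424753102147331756070) 1) || sieve l₀ 60 2) && sieveRange f (l₀ + 2)) := by
      change (bif (bif Nat.beq (Nat.gcd l₀ 2305567963945518424753102147331756070) 1 then
        sieve l₀ 60 2 else true) then force (l₀ + 2) (sieveRange f) else false) = _
      simp only [force_eq]
      generalize Nat.beq _ _ = x1
      generalize sieve _ _ _ = x2
      cases x1 <;> cases x2 <;> rfl
    simp only [hstep, Bool.and_eq_true, Bool.or_eq_true, Bool.not_eq_true'] at h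
    obtain ⟨h1, h2⟩ := h
    rcases hle.eq_or_lt with rfl | hlt'
    · refine sieve_spec hl (by omega) hl20 60 2 (by omega) (by omega) (by omega) ?_
      refine h1.resolve_left fun hb => ?_
      have hne : ¬ Nat.gcd l₀ 2305567963945518424753102147331756070 = 1 := by
        rw [← Nat.beq_eq, hb]; simp
      have hdvd : l₀ ∣ 2305567963945518424753102147331756070 := by
        by_contra hnd
        exact hne ((Nat.Prime.coprime_iff_not_dvd hl).mpr hnd)
      have hfac : (2305567963945518424753102147331756070 : ℕ) ∣ Nat.factorial 97 := by
        decide +kernel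
      have := (hl.dvd_factorial).mp (hdvd.trans hfac)
      omega
    · have : l % 2 = 1 := by
        rcases hl.eq_two_or_odd with h | h <;> omega
      exact ih (l₀ + 2) l (by omega) (by omega) hl (by omega) (by omega) hl20 h2

/-- The equation with parameters `a`, `b`, `c` has no solution in some `ZMod q`. -/
def LocallyInsoluble (l a b c : ℕ) : Prop :=
  ∃ q : ℕ, ∀ u v : ZMod q,
    (4 ^ (a * (l - 1)) * 9 ^ (b * (l - 1)) * 25 ^ (c * (l - 1)) : ZMod q) * u ^ (2 * l) + 6 ≠
      2 ^ a * 3 ^ b * 5 ^ ((1 - c) * (l - 1)) * v ^ l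

/-- Runs `caseCheck` for a single system of coefficients, trying several `h`. -/
noncomputable def genSearchOne (q n l C D fuel : ℕ) : ℕ → Bool :=
  Nat.rec (fun _ => false) (fun _ ih g =>
    bif force (powMod q 20 g (Nat.mul 2 l)) (fun h => caseCheck q n h (Nat.div n 2) C D) then true
    else force (Nat.succ g) ih) fuel

theorem genSearchOne_spec {q n l C D : ℕ} (hq : q.Prime) (hq6 : 6 < q) (hn : n % 2 = 0)
    (hn0 : 0 < n) (hql : q = n * l + 1) (fuel : ℕ) :
    ∀ g, genSearchOne q n l C D fuel g = true →
      ∀ u v : ZMod q, (C : ZMod q) * u ^ (2 * l) + 6 ≠ D * v ^ l := by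
  induction fuel with
  | zero => intro g hg; simp [genSearchOne] at hg
  | succ f ih =>
    intro g hg
    have hstep : genSearchOne q n l C D (f + 1) g =
        (caseCheck q n (powMod q 20 g (2 * l)) (n / 2) C D || genSearchOne q n l C D f (g + 1)) := by
      change (bif force (powMod q 20 g (2 * l)) (fun h => caseCheck q n h (n / 2) C D) then true
        else force (g + 1) (genSearchOne q n l C D f)) = _
      simp only [force_eq]
      generalize caseCheck _ _ _ _ _ _ = x
      cases x <;> rfl
    rw [hstep, Bool.or_eq_true] at hg
    rcases hg with hg | hg
    · exact caseCheck_spec hq hq6 (by omega) (by omega) hql hg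
    · exact ih _ hg

/-- Searches for a prime `q = n * l + 1` modulo which the equation with parameters `a`, `b`, `c`
is insoluble, testing primality by trial division. -/
noncomputable def smallSieve (l a b c fuel : ℕ) : ℕ → Bool :=
  Nat.rec (fun _ => false) (fun _ ih n =>
    force (Nat.succ (Nat.mul n l)) fun q =>
    bif (bif noDivisor q 200 2 then
      force (Nat.mod (Nat.mul (Nat.mul (powMod q 20 4 (Nat.mul a (Nat.sub l 1)))
        (powMod q 20 9 (Nat.mul b (Nat.sub l 1)))) (powMod q 20 25 (Nat.mul c (Nat.sub l 1)))) q)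
      fun C => force (Nat.mod (Nat.mul (Nat.mul (Nat.pow 2 a) (Nat.pow 3 b))
        (powMod q 20 5 (Nat.mul (Nat.sub 1 c) (Nat.sub l 1)))) q)
      fun D => genSearchOne q n l C D 12 2 else false) then true
    else force (Nat.add n 2) ih) fuel

theorem smallSieve_spec {l a b c : ℕ} (h5 : 5 ≤ l) (hl : l < 201) (ha : a ≤ 1) (hb : b ≤ 1)
    (hc : c ≤ 1) (fuel : ℕ) :
    ∀ n, 0 < n → n % 2 = 0 → n + 2 * fuel ≤ 200 → smallSieve l a b c fuel n = true →
      LocallyInsoluble l a b c := by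
  induction fuel with
  | zero => intro n _ _ _ h; simp [smallSieve] at h
  | succ f ih =>
    intro n hn0 hn2 hnl h
    obtain ⟨C, hC⟩ : ∃ C, C = powMod (n * l + 1) 20 4 (a * (l - 1)) *
      powMod (n * l + 1) 20 9 (b * (l - 1)) * powMod (n * l + 1) 20 25 (c * (l - 1)) %
      (n * l + 1) := ⟨_, rfl⟩
    obtain ⟨D, hD⟩ : ∃ D, D = 2 ^ a * 3 ^ b * powMod (n * l + 1) 20 5 ((1 - c) * (l - 1)) %
      (n * l + 1) := ⟨_, rfl⟩
    have hstep : smallSieve l a b c (f + 1) n = ((noDivisor (n * l + 1) 200 2 &&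
        genSearchOne (n * l + 1) n l C D 12 2) || smallSieve l a b c f (n + 2)) := by
      rw [hC, hD]
      change (force (n * l + 1) fun q =>
        bif (bif noDivisor q 200 2 then
          force (powMod q 20 4 (a * (l - 1)) * powMod q 20 9 (b * (l - 1)) *
            powMod q 20 25 (c * (l - 1)) % q)
          fun C => force (2 ^ a * 3 ^ b * powMod q 20 5 ((1 - c) * (l - 1)) % q)
          fun D => genSearchOne q n l C D 12 2 else false) then true
        else force (n + 2) (smallSieve l a b c f)) = _
      simp only [force_eq]
      generalize noDivisor _ _ _ = x1
      generalize genSearchOne _ _ _ _ _ _ _ = x2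
      cases x1 <;> cases x2 <;> rfl
    simp only [hstep, Bool.or_eq_true, Bool.and_eq_true] at h
    rcases h with ⟨h1, h2⟩ | h
    · have h10 : 2 * 5 ≤ n * l := Nat.mul_le_mul (by omega) h5
      have hlt : n * l < 200 * 201 := Nat.mul_lt_mul_of_le_of_lt (by omega) hl (by omega)
      have hexp : ∀ e ≤ 1, e * (l - 1) < 2 ^ 20 := fun e he => by
        have := Nat.mul_le_mul_right (l - 1) he
        omega
      have hCq : (C : ZMod (n * l + 1)) =
          4 ^ (a * (l - 1)) * 9 ^ (b * (l - 1)) * 25 ^ (c * (l - 1)) := by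
        rw [hC, ZMod.natCast_mod, Nat.cast_mul, Nat.cast_mul, powMod_cast _ _ _ _ (hexp a ha),
          powMod_cast _ _ _ _ (hexp b hb), powMod_cast _ _ _ _ (hexp c hc)]
        push_cast
        rfl
      have hDq : (D : ZMod (n * l + 1)) = 2 ^ a * 3 ^ b * 5 ^ ((1 - c) * (l - 1)) := by
        rw [hD, ZMod.natCast_mod, Nat.cast_mul, powMod_cast _ _ _ _ (hexp (1 - c) (by omega))]
        push_cast
        rfl
      refine ⟨n * l + 1, fun u v => ?_⟩
      rw [← hCq, ← hDq]
      exact genSearchOne_spec (prime_of_noDivisor (by omega) (by omega) h1)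
        (by omega) hn2 hn0 rfl 12 2 h2 u v
    · exact ih (n + 2) (by omega) (by omega) (by omega) h

/-- Runs `smallSieve` on the primes among `l, l + 1, …` (`fuel` terms). -/
noncomputable def smallSieveRange (a b c fuel : ℕ) : ℕ → Bool :=
  Nat.rec (fun _ => true) (fun _ ih l =>
    bif (bif noDivisor l 200 2 then smallSieve l a b c 60 2 else true) then force (Nat.succ l) ih
    else false) fuel

theorem smallSieveRange_spec {a b c : ℕ} (ha : a ≤ 1) (hb : b ≤ 1) (hc : c ≤ 1) (fuel : ℕ) :
    ∀ l₀ l, 5 ≤ l₀ → l.Prime → l₀ ≤ l → l < l₀ + fuel →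
    l < 201 → smallSieveRange a b c fuel l₀ = true → LocallyInsoluble l a b c := by
  induction fuel with
  | zero => intro l₀ l _ _ h1 h2; omega
  | succ f ih =>
    intro l₀ l h5 hl hle hlt hl201 h
    have hstep : smallSieveRange a b c (f + 1) l₀ = (((!noDivisor l₀ 200 2) ||
        smallSieve l₀ a b c 60 2) && smallSieveRange a b c f (l₀ + 1)) := by
      change (bif (bif noDivisor l₀ 200 2 then smallSieve l₀ a b c 60 2 else true) then
        force (l₀ + 1) (smallSieveRange a b c f) else false) = _
      simp only [force_eq]
      generalize noDivisor _ _ _ = x1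
      generalize smallSieve _ _ _ _ _ _ = x2
      cases x1 <;> cases x2 <;> rfl
    simp only [hstep, Bool.and_eq_true, Bool.or_eq_true, Bool.not_eq_true'] at h
    obtain ⟨h1, h2⟩ := h
    rcases hle.eq_or_lt with rfl | hlt'
    · refine smallSieve_spec h5 hl201 ha hb hc 60 2 (by omega) (by omega) (by omega) ?_
      refine h1.resolve_left fun hb => ?_
      rw [← Bool.not_eq_true, noDivisor_iff] at hb
      refine hb fun d hd _ hdd hdvd => ?_
      rcases (Nat.dvd_prime hl).mp hdvd with rfl | rfl
      · omega
      · nlinarith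
    · exact ih (l₀ + 1) l (by omega) hl (by omega) (by omega) hl201 h2

theorem locallyInsoluble_of_lt_201 {l a b c : ℕ} (hl : l.Prime) (h5 : 5 ≤ l) (h : l < 201)
    (ha : a ≤ 1) (hb : b ≤ 1) (hc : c ≤ 1) (habc : ¬ (a = 1 ∧ b = 1 ∧ c = 1)) :
    LocallyInsoluble l a b c := by
  refine smallSieveRange_spec ha hb hc 196 5 l le_rfl hl h5 (by omega) h ?_
  interval_cases a <;> interval_cases b <;> interval_cases c
  on_goal 8 => simp at habc
  all_goals decide +kernel

theorem sieveRange_201 : sieveRange 1000 201 = true := by decide +kernel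

theorem sieveRange_2201 : sieveRange 1000 2201 = true := by decide +kernel

theorem sieveRange_4201 : sieveRange 1000 4201 = true := by decide +kernel

theorem sieveRange_6201 : sieveRange 1000 6201 = true := by decide +kernel

theorem sieveRange_8201 : sieveRange 1000 8201 = true := by decide +kernel

theorem sieveRange_10201 : sieveRange 1000 10201 = true := by decide +kernel

theorem sieveRange_12201 : sieveRange 1000 12201 = true := by decide +kernel

theorem sieveRange_14201 : sieveRange 1000 14201 = true := by decide +kernel

theorem sieveRange_16201 : sieveRange 1000 16201 = true := by decide +kernel

theorem sieveRange_18201 : sieveRange 1000 18201 = true := by decide +kernel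

theorem sieveRange_20201 : sieveRange 1000 20201 = true := by decide +kernel

theorem sieveRange_22201 : sieveRange 1000 22201 = true := by decide +kernel

theorem sieveRange_24201 : sieveRange 1000 24201 = true := by decide +kernel

theorem sieveRange_26201 : sieveRange 1000 26201 = true := by decide +kernel

theorem sieveRange_28201 : sieveRange 1000 28201 = true := by decide +kernel

theorem sieveRange_30201 : sieveRange 1000 30201 = true := by decide +kernel

theorem sieveRange_32201 : sieveRange 1000 32201 = true := by decide +kernel

theorem sieveRange_34201 : sieveRange 1000 34201 = true := by decide +kernel

theorem sieveRange_36201 : sieveRange 1000 36201 = true := by decide +kernel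

theorem sieveRange_38201 : sieveRange 1000 38201 = true := by decide +kernel

theorem sieveRange_40201 : sieveRange 1000 40201 = true := by decide +kernel

theorem sieveRange_42201 : sieveRange 1000 42201 = true := by decide +kernel

theorem sieveRange_44201 : sieveRange 1000 44201 = true := by decide +kernel

theorem sieveRange_46201 : sieveRange 1000 46201 = true := by decide +kernel

theorem sieveRange_48201 : sieveRange 1000 48201 = true := by decide +kernel

theorem sieveRange_50201 : sieveRange 1000 50201 = true := by decide +kernel

theorem sieveRange_52201 : sieveRange 1000 52201 = true := by decide +kernel

theorem sieveRange_54201 : sieveRange 1000 54201 = true := by decide +kernel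

theorem sieveRange_56201 : sieveRange 1000 56201 = true := by decide +kernel

theorem sieveRange_58201 : sieveRange 1000 58201 = true := by decide +kernel

theorem sieveRange_60201 : sieveRange 1000 60201 = true := by decide +kernel

theorem sieveRange_62201 : sieveRange 1000 62201 = true := by decide +kernel

theorem sieveRange_64201 : sieveRange 1000 64201 = true := by decide +kernel

theorem locallyInsoluble_of_lt {l a b c : ℕ} (hl : l.Prime) (h5 : 5 ≤ l) (h : l < 2 ^ 16)
    (ha : a ≤ 1) (hb : b ≤ 1) (hc : c ≤ 1) (habc : ¬ (a = 1 ∧ b = 1 ∧ c = 1)) :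
    LocallyInsoluble l a b c := by
  rcases lt_or_ge l 201 with h0 | h0
  · exact locallyInsoluble_of_lt_201 hl h5 h0 ha hb hc habc
  suffices h : ∃ q, Insoluble q l by
    obtain ⟨q, hq⟩ := h
    exact ⟨q, hq a b c ha hb hc habc⟩
  have spec := fun {l₀ : ℕ} (h : sieveRange 1000 l₀ = true) (h1 : 201 ≤ l₀) (h2 : l₀ % 2 = 1)
    (h3 : l₀ ≤ l) (h4 : l < l₀ + 2 * 1000) => sieveRange_spec 1000 l₀ l h1 h2 hl h3 h4 (by omega) h
  have hk : (l - 201) / 2000 < 33 := by omega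
  obtain ⟨k, hk'⟩ : ∃ k, (l - 201) / 2000 = k := ⟨_, rfl⟩
  have h1 : 201 + 2000 * k ≤ l := by omega
  have h2 : l < 201 + 2000 * k + 2000 := by omega
  rw [hk'] at hk
  clear hk'
  interval_cases k
  · exact spec sieveRange_201 (by omega) (by omega) (by omega) (by omega)
  · exact spec sieveRange_2201 (by omega) (by omega) (by omega) (by omega)
  · exact spec sieveRange_4201 (by omega) (by omega) (by omega) (by omega)
  · exact spec sieveRange_6201 (by omega) (by omega) (by omega) (by omega)
  · exact spec sieveRange_8201 (by omega) (by omega) (by omega) (by omega)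
  · exact spec sieveRange_10201 (by omega) (by omega) (by omega) (by omega)
  · exact spec sieveRange_12201 (by omega) (by omega) (by omega) (by omega)
  · exact spec sieveRange_14201 (by omega) (by omega) (by omega) (by omega)
  · exact spec sieveRange_16201 (by omega) (by omega) (by omega) (by omega)
  · exact spec sieveRange_18201 (by omega) (by omega) (by omega) (by omega)
  · exact spec sieveRange_20201 (by omega) (by omega) (by omega) (by omega)
  · exact spec sieveRange_22201 (by omega) (by omega) (by omega) (by omega)
  · exact spec sieveRange_24201 (by omega) (by omega) (by omega) (by omega)
  · exact spec sieveRange_26201 (by omega) (by omega) (by omega) (by omega)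
  · exact spec sieveRange_28201 (by omega) (by omega) (by omega) (by omega)
  · exact spec sieveRange_30201 (by omega) (by omega) (by omega) (by omega)
  · exact spec sieveRange_32201 (by omega) (by omega) (by omega) (by omega)
  · exact spec sieveRange_34201 (by omega) (by omega) (by omega) (by omega)
  · exact spec sieveRange_36201 (by omega) (by omega) (by omega) (by omega)
  · exact spec sieveRange_38201 (by omega) (by omega) (by omega) (by omega)
  · exact spec sieveRange_40201 (by omega) (by omega) (by omega) (by omega)
  · exact spec sieveRange_42201 (by omega) (by omega) (by omega) (by omega)
  · exact spec sieveRange_44201 (by omega) (by omega) (by omega) (by omega)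
  · exact spec sieveRange_46201 (by omega) (by omega) (by omega) (by omega)
  · exact spec sieveRange_48201 (by omega) (by omega) (by omega) (by omega)
  · exact spec sieveRange_50201 (by omega) (by omega) (by omega) (by omega)
  · exact spec sieveRange_52201 (by omega) (by omega) (by omega) (by omega)
  · exact spec sieveRange_54201 (by omega) (by omega) (by omega) (by omega)
  · exact spec sieveRange_56201 (by omega) (by omega) (by omega) (by omega)
  · exact spec sieveRange_58201 (by omega) (by omega) (by omega) (by omega)
  · exact spec sieveRange_60201 (by omega) (by omega) (by omega) (by omega)
  · exact spec sieveRange_62201 (by omega) (by omega) (by omega) (by omega)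
  · exact spec sieveRange_64201 (by omega) (by omega) (by omega) (by omega)

end CubeSieve

/-! ### Close powers with a large exponent -/

namespace TwoLogs

open Finset

/-- If `f` is injective where it is less than `N`, the sum of `min (f i) N` is at least that of
`0, 1, …, N - 1`. -/
theorem sum_weight_ge {ι : Type*} [DecidableEq ι] (s : Finset ι) (w : ι → ℕ) (N : ℕ)
    (hN : #s ≤ N) (hinj : ∀ i ∈ s, ∀ j ∈ s, i ≠ j → w i = w j → N ≤ w i) :
    #s * (#s - 1) / 2 ≤ ∑ i ∈ s, w i := by
  induction s using Finset.strongInduction with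
  | H s ih =>
    rcases s.eq_empty_or_nonempty with rfl | hs
    · simp
    obtain ⟨m, hm, hmax⟩ := s.exists_max_image w hs
    have hcard := card_erase_of_mem hm
    have hpos := card_pos.mpr hs
    have hlow : #s - 1 ≤ w m := by
      by_contra hlt
      push Not at hlt
      have hmap : ∀ i ∈ s, w i ∈ range (#s - 1) := fun i hi => by
        have := hmax i hi
        rw [mem_range]; omega
      obtain ⟨i, hi, j, hj, hij, he⟩ := exists_ne_map_eq_of_card_lt_of_maps_to
        (by rw [card_range]; omega) hmap
      have h1 := hinj i hi j hj hij he
      have h2 := hmax i hi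
      omega
    have hrec := ih (s.erase m) (erase_ssubset hm) (by omega)
      (fun i hi j hj => hinj i (mem_of_mem_erase hi) j (mem_of_mem_erase hj))
    rw [← add_sum_erase s w hm]
    rw [hcard] at hrec
    obtain ⟨c, hc⟩ : ∃ c, #s = c + 1 := ⟨#s - 1, by omega⟩
    rw [hc] at hrec hlow ⊢
    simp only [Nat.add_sub_cancel] at hrec hlow ⊢
    have h2 : (c + 1) * c / 2 = c * (c - 1) / 2 + c := by
      have := Finset.sum_range_succ (fun i => i) c
      rw [Finset.sum_range_id, Finset.sum_range_id, Nat.add_sub_cancel] at this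
      exact this
    omega

theorem abs_det_le_of_abs_le {ι : Type*} [Fintype ι] [DecidableEq ι] (A : Matrix ι ι ℝ)
    (B : ι → ℝ) (h : ∀ i j, |A i j| ≤ B i) :
    |A.det| ≤ (Fintype.card ι).factorial * ∏ i, B i := by
  rw [← Matrix.det_transpose, Matrix.det_apply]
  refine (abs_sum_le_sum_abs _ _).trans ?_
  have hterm : ∀ σ : Equiv.Perm ι, |Equiv.Perm.sign σ • ∏ i, A.transpose (σ i) i| ≤ ∏ i, B i := by
    intro σ
    rw [Units.smul_def, zsmul_eq_mul, abs_mul, abs_prod]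
    have : |((Equiv.Perm.sign σ : ℤ) : ℝ)| = 1 := by
      rcases Int.units_eq_one_or (Equiv.Perm.sign σ) with h | h <;> rw [h] <;> simp
    rw [this, one_mul]
    exact prod_le_prod (fun i _ => abs_nonneg _) fun i _ => h i _
  calc _ ≤ ∑ _σ : Equiv.Perm ι, ∏ i, B i := sum_le_sum fun σ _ => hterm σ
    _ = _ := by rw [sum_const, card_univ, Fintype.card_perm, nsmul_eq_mul]

/-- Analytic upper bound for an interpolation determinant whose entries are generalised
polynomials `∑ c x ^ d` up to a small error. -/
theorem abs_det_le {ι O : Type*} [Fintype ι] [DecidableEq ι] [Fintype O] [DecidableEq O]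
    (d : O → ℕ) (c : ι → O → ℝ) (x : ι → ℝ) (e : ι → ι → ℝ) {X ρ : ℝ} (hρ : 1 ≤ ρ)
    (F E : ι → ℝ) (hx : ∀ j, |x j| ≤ X) (he : ∀ i j, |e i j| ≤ E i)
    (hE : ∀ i, ρ ^ Fintype.card ι * E i ≤ F i) (hF : ∀ i, ∑ o, |c i o| * (ρ * X) ^ d o ≤ F i)
    (A : Matrix ι ι ℝ) (hA : ∀ i j, A i j = ∑ o, c i o * x j ^ d o + e i j) :
    |A.det| * ρ ^ (Fintype.card ι * (Fintype.card ι - 1) / 2) ≤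
      (Fintype.card ι).factorial * ∏ i, (2 * F i) := by
  have hρ0 : 0 < ρ := by linarith
  rcases isEmpty_or_nonempty ι with hι | hι
  · simp
  have hX : 0 ≤ X := (abs_nonneg _).trans (hx (Classical.arbitrary ι))
  have hE0 : ∀ i, 0 ≤ E i := fun i => (abs_nonneg _).trans (he i i)
  set N := Fintype.card ι with hN
  let row : ι → Option O → ι → ℝ := fun i o j => o.elim (e i j) fun o => c i o * x j ^ d o
  let wt : Option O → ℕ := fun o => o.elim N d
  let g : ι → Option O → ℝ := fun i o => o.elim (ρ ^ N * E i) fun o => |c i o| * (ρ * X) ^ d o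
  have hg0 : ∀ i o, 0 ≤ g i o := by
    rintro i (_ | o)
    · exact mul_nonneg (by positivity) (hE0 i)
    · exact mul_nonneg (abs_nonneg _) (by positivity)
  have hrow : ∀ i o j, |row i o j| ≤ g i o / ρ ^ wt o := by
    rintro i (_ | o) j
    · change |e i j| ≤ ρ ^ N * E i / ρ ^ N
      rw [mul_div_cancel_left₀ _ (by positivity)]
      exact he i j
    · change |c i o * x j ^ d o| ≤ |c i o| * (ρ * X) ^ d o / ρ ^ d o
      rw [mul_pow, mul_div_assoc, mul_div_cancel_left₀ _ (by positivity), abs_mul, abs_pow]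
      exact mul_le_mul_of_nonneg_left (pow_le_pow_left₀ (abs_nonneg _) (hx j) _) (abs_nonneg _)
  have hexp : A.det = ∑ f : ι → Option O, Matrix.det (Matrix.of fun i => row i (f i)) := by
    have hA' : A = Matrix.of fun i => ∑ o, row i o := by
      ext i j
      rw [hA]
      simp [row, Fintype.sum_option, add_comm]
    rw [hA']
    exact (Matrix.detRowAlternating (R := ℝ) (n := ι)).toMultilinearMap.map_sum row
  have hterm : ∀ f : ι → Option O, |Matrix.det (Matrix.of fun i => row i (f i))| *
      ρ ^ (N * (N - 1) / 2) ≤ N.factorial * ∏ i, g i (f i) := by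
    intro f
    by_cases hinj : ∃ i j, i ≠ j ∧ wt (f i) = wt (f j) ∧ wt (f i) < N
    · obtain ⟨i, j, hij, hw, hlt⟩ := hinj
      obtain ⟨oi, hoi⟩ : ∃ o, f i = some o := by
        rcases hfi : f i with _ | o
        · simp [wt, hfi] at hlt
        · exact ⟨o, rfl⟩
      obtain ⟨oj, hoj⟩ : ∃ o, f j = some o := by
        rcases hfj : f j with _ | o
        · simp [hw, wt, hfj] at hlt
        · exact ⟨o, rfl⟩
      have hd : d oi = d oj := by simpa [wt, hoi, hoj] using hw
      have hdet : Matrix.det (Matrix.of fun i => row i (f i)) = 0 := by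
        let B : Matrix ι ι ℝ := Matrix.of fun i => row i (f i)
        let v : ι → ℝ := fun k => x k ^ d oi
        have hBi : B = (B.updateRow i v).updateRow i (c i oi • v) := by
          ext a b
          by_cases ha : a = i
          · subst ha; simp [B, v, row, hoi]
          · simp [Matrix.updateRow_ne ha]
        have hBj : B.updateRow i v = ((B.updateRow i v).updateRow j v).updateRow j (c j oj • v) := by
          ext a b
          by_cases ha : a = j
          · subst ha; simp [B, v, row, hoj, hd, Matrix.updateRow_ne hij.symm]
          · simp [Matrix.updateRow_ne ha]
        have h1 : B.det = c i oi * (B.updateRow i v).det := by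
          conv_lhs => rw [hBi, Matrix.det_updateRow_smul, Matrix.updateRow_idem]
        have h2 : (B.updateRow i v).det = c j oj * ((B.updateRow i v).updateRow j v).det := by
          conv_lhs => rw [hBj, Matrix.det_updateRow_smul, Matrix.updateRow_idem]
        have h3 : ((B.updateRow i v).updateRow j v).det = 0 := by
          refine Matrix.det_zero_of_row_eq hij ?_
          rw [Matrix.updateRow_self, Matrix.updateRow_ne hij, Matrix.updateRow_self]
        change B.det = 0
        rw [h1, h2, h3, mul_zero, mul_zero]
      rw [hdet, abs_zero, zero_mul]
      exact mul_nonneg (by positivity) (prod_nonneg fun i _ => hg0 _ _)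
    · push Not at hinj
      have hwt := sum_weight_ge univ (fun i => wt (f i)) N le_rfl
        (fun i _ j _ hij hw => hinj i j hij hw)
      rw [card_univ, ← hN] at hwt
      have h1 := abs_det_le_of_abs_le (Matrix.of fun i => row i (f i))
        (fun i => g i (f i) / ρ ^ wt (f i)) (fun i j => hrow i (f i) j)
      rw [prod_div_distrib, prod_pow_eq_pow_sum, ← hN] at h1
      have hP : 0 ≤ ∏ i, g i (f i) := prod_nonneg fun i _ => hg0 _ _
      calc _ ≤ (N.factorial * ((∏ i, g i (f i)) / ρ ^ ∑ i, wt (f i))) * ρ ^ (N * (N - 1) / 2) :=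
            mul_le_mul_of_nonneg_right h1 (by positivity)
        _ ≤ (N.factorial * ((∏ i, g i (f i)) / ρ ^ ∑ i, wt (f i))) * ρ ^ ∑ i, wt (f i) :=
            mul_le_mul_of_nonneg_left (pow_le_pow_right₀ hρ hwt) (by positivity)
        _ = _ := by field_simp
  rw [hexp]
  calc _ ≤ (∑ f : ι → Option O, |Matrix.det (Matrix.of fun i => row i (f i))|) *
        ρ ^ (N * (N - 1) / 2) :=
        mul_le_mul_of_nonneg_right (abs_sum_le_sum_abs _ _) (by positivity)
    _ ≤ ∑ f : ι → Option O, N.factorial * ∏ i, g i (f i) := by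
        rw [sum_mul]; exact sum_le_sum fun f _ => hterm f
    _ = N.factorial * ∏ i, ∑ o, g i o := by rw [← mul_sum, prod_univ_sum]; simp
    _ ≤ _ := by
        refine mul_le_mul_of_nonneg_left (prod_le_prod (fun i _ => sum_nonneg fun o _ => hg0 i o)
          fun i _ => ?_) (by positivity)
        rw [Fintype.sum_option, two_mul]
        exact add_le_add (hE i) (hF i)

end TwoLogs

namespace TwoLogs

open Finset Polynomial

theorem exists_minor_ne_zero {ι κ : Type*} [Fintype ι] [DecidableEq ι] (g : ι → κ → ℝ)
    (h : ∀ a : ι → ℝ, (∀ k, ∑ i, a i * g i k = 0) → a = 0) :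
    ∃ c : ι → κ, Function.Injective c ∧ (Matrix.of fun i j => g i (c j)).det ≠ 0 := by
  let v : κ → ι → ℝ := fun k i => g i k
  have hspan : Submodule.span ℝ (Set.range v) = ⊤ := by
    by_contra hne
    obtain ⟨f, hf, hle⟩ := Submodule.exists_le_ker_of_lt_top _ (lt_top_iff_ne_top.mpr hne)
    have hfa : ∀ w : ι → ℝ, f w = ∑ i, f (Pi.single i 1) * w i := by
      intro w
      conv_lhs => rw [pi_eq_sum_univ' w, map_sum]
      refine sum_congr rfl fun i _ => ?_
      rw [map_smul, smul_eq_mul, mul_comm]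
    have ha := h (fun i => f (Pi.single i 1)) fun k => by
      rw [← hfa (v k)]
      exact hle (Submodule.subset_span ⟨k, rfl⟩)
    refine hf (LinearMap.ext fun w => ?_)
    rw [hfa w]
    exact sum_eq_zero fun i _ => by rw [congrFun ha i, Pi.zero_apply, zero_mul]
  obtain ⟨κ', c, hc, hsp, hli⟩ := exists_linearIndependent' ℝ v
  rw [hspan] at hsp
  have b := Module.Basis.mk hli hsp.ge
  have : Fintype κ' := FiniteDimensional.fintypeBasisIndex b
  have hcard : Fintype.card ι = Fintype.card κ' := by
    rw [← Module.finrank_eq_card_basis b, Module.finrank_fintype_fun_eq_card]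
  let e := Fintype.equivOfCardEq hcard
  refine ⟨c ∘ e, hc.comp e.injective, ?_⟩
  have hli' : LinearIndependent ℝ (fun j => v (c (e j))) := hli.comp e e.injective
  rw [← Matrix.det_transpose]
  have := (Matrix.linearIndependent_rows_iff_isUnit
    (A := (Matrix.of fun i j => g i ((c ∘ e) j)).transpose)).mp hli'
  rw [Matrix.isUnit_iff_isUnit_det] at this
  exact this.ne_zero

theorem natDegree_det_le {n : Type*} [Fintype n] [DecidableEq n] (E : Matrix n n ℝ[X])
    (d : n → ℕ) (h : ∀ i j, (E i j).natDegree ≤ d j) : E.det.natDegree ≤ ∑ j, d j := by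
  rw [Matrix.det_apply]
  refine natDegree_sum_le_of_forall_le _ _ fun σ _ => ?_
  rw [Units.smul_def]
  refine (natDegree_smul_le _ _).trans ((natDegree_prod_le _ _).trans ?_)
  exact sum_le_sum fun j _ => h _ _

theorem coeff_prod_sum_of_natDegree_le {n : Type*} (s : Finset n) (p : n → ℝ[X])
    (d : n → ℕ) (h : ∀ j ∈ s, (p j).natDegree ≤ d j) :
    (∏ j ∈ s, p j).coeff (∑ j ∈ s, d j) = ∏ j ∈ s, (p j).coeff (d j) := by
  classical
  induction s using Finset.induction_on with
  | empty => simp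
  | insert a s ha ih =>
    rw [prod_insert ha, sum_insert ha, prod_insert ha, coeff_mul_add_eq_of_natDegree_le
      (h a (mem_insert_self a s)), ih fun j hj => h j (mem_insert_of_mem hj)]
    exact (natDegree_prod_le _ _).trans (sum_le_sum fun j hj => h j (mem_insert_of_mem hj))

theorem coeff_det {n : Type*} [Fintype n] [DecidableEq n] (E : Matrix n n ℝ[X])
    (d : n → ℕ) (h : ∀ i j, (E i j).natDegree ≤ d j) :
    E.det.coeff (∑ j, d j) = (Matrix.of fun i j => (E i j).coeff (d j)).det := by
  rw [Matrix.det_apply, Matrix.det_apply, finsetSum_coeff]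
  refine sum_congr rfl fun σ _ => ?_
  rw [Units.smul_def, coeff_smul, Units.smul_def]
  congr 1
  exact coeff_prod_sum_of_natDegree_le _ _ _ fun j _ => h _ _

/-- A zero estimate: exponential polynomials with few frequencies have few zeros on a grid. -/
theorem eq_zero_of_expPoly_eq_zero {l K L R R₂ S : ℕ} {τ β : ℝ} (hτ : 1 < τ) (hβ : 0 < β)
    (hS : S ≤ l) (hR : R₂ + L ≤ R) (hcount : L * (K - 1) < R₂ * S) (P : Fin L → ℝ[X])
    (hdeg : ∀ t, (P t).natDegree ≤ K - 1)
    (hzero : ∀ r < R, ∀ s < S,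
      ∑ t, (P t).eval (l * r + s : ℝ) * (τ ^ (t * r : ℕ) * β ^ (t * s : ℕ)) = 0) :
    ∀ t, P t = 0 := by
  classical
  by_contra hne
  push Not at hne
  obtain ⟨t₀, ht₀⟩ := hne
  let T : Finset (Fin L) := univ.filter fun t => P t ≠ 0
  have ht₀T : t₀ ∈ T := by simp [T, ht₀]
  let m := #T
  have hm : 0 < m := card_pos.mpr ⟨t₀, ht₀T⟩
  have hmL : m ≤ L := (card_le_univ T).trans_eq (Fintype.card_fin L)
  let f : Fin m ↪o Fin L := T.orderEmbOfFin rfl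
  have hf : ∀ i, P (f i) ≠ 0 := fun i => by
    exact (mem_filter.mp (T.orderEmbOfFin_mem rfl i)).2
  have hsum : ∀ G : Fin L → ℝ, (∀ t, P t = 0 → G t = 0) → ∑ t, G t = ∑ i, G (f i) := by
    intro G hG
    have h1 : ∑ t, G t = ∑ t ∈ T, G t := by
      refine (sum_subset (subset_univ T) fun t _ ht => hG t ?_).symm
      simpa [T] using ht
    rw [h1, ← T.image_orderEmbOfFin_univ rfl, sum_image fun a _ b _ hab => f.injective hab]
  let E : Matrix (Fin m) (Fin m) ℝ[X] := Matrix.of fun i j =>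
    C ((τ ^ (f j : ℕ)) ^ (i : ℕ)) * taylor ((l * i : ℕ) : ℝ) (P (f j))
  have hE : ∀ i j, (E i j).natDegree ≤ (P (f j)).natDegree := fun i j =>
    (natDegree_C_mul_le _ _).trans (natDegree_taylor _ _).le
  have hτ0 : 0 < τ := by linarith
  have hQ : E.det ≠ 0 := by
    intro h0
    have hco := coeff_det E _ hE
    rw [h0, coeff_zero] at hco
    have hmat : (Matrix.of fun i j => (E i j).coeff (P (f j)).natDegree) = Matrix.of fun i j =>
        (P (f j)).leadingCoeff * (Matrix.vandermonde fun j => τ ^ (f j : ℕ)).transpose i j := by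
      ext i j
      simp only [E, Matrix.of_apply, coeff_C_mul, coeff_taylor_natDegree, Matrix.transpose_apply,
        Matrix.vandermonde_apply]
      ring
    rw [hmat, Matrix.det_mul_row, Matrix.det_transpose] at hco
    refine (mul_ne_zero (prod_ne_zero_iff.mpr fun j _ => ?_) ?_) hco.symm
    · exact leadingCoeff_ne_zero.mpr (hf j)
    · rw [Matrix.det_vandermonde_ne_zero_iff]
      intro i j hij
      exact f.injective (Fin.ext (pow_right_injective₀ hτ0 hτ.ne' hij))
  have hroot : ∀ r < R₂, ∀ s < S, E.det.eval (l * r + s : ℝ) = 0 := by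
    intro r hr s hs
    have : E.det.eval (l * r + s : ℝ) = (E.map (eval (l * r + s : ℝ))).det := by
      exact (evalRingHom (l * r + s : ℝ)).map_det E
    rw [this, ← Matrix.exists_mulVec_eq_zero_iff]
    refine ⟨fun j => τ ^ (f j * r : ℕ) * β ^ (f j * s : ℕ), ?_, ?_⟩
    · intro h0
      have := congrFun h0 ⟨0, hm⟩
      simp only [Pi.zero_apply] at this
      have : 0 < τ ^ (f ⟨0, hm⟩ * r : ℕ) * β ^ (f ⟨0, hm⟩ * s : ℕ) := by positivity
      linarith
    · ext i
      have hz := hzero (r + i) (by omega) s hs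
      rw [hsum _ fun t ht => by rw [ht, eval_zero, zero_mul]] at hz
      rw [Pi.zero_apply, ← hz, Matrix.mulVec, dotProduct]
      refine sum_congr rfl fun j _ => ?_
      simp only [E, Matrix.map_apply, Matrix.of_apply, eval_mul, eval_C, taylor_eval]
      have : (l * r + s + (l * i : ℕ) : ℝ) = l * (r + i : ℕ) + s := by push_cast; ring
      rw [this, mul_add, pow_add, pow_mul τ (f j : ℕ) i]
      ring
  have hinj : Set.InjOn (fun p : ℕ × ℕ => (l * p.1 + p.2 : ℝ)) (range R₂ ×ˢ range S : Finset _) := by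
    rintro ⟨r, s⟩ hp ⟨r', s'⟩ hp' heq
    simp only [coe_product, coe_range, Set.mem_prod, Set.mem_Iio] at hp hp'
    simp only at heq
    have heq' : l * r + s = l * r' + s' := by exact_mod_cast heq
    have h1 : (l * r + s) / l = r := by
      rw [Nat.mul_add_div (by omega), Nat.div_eq_of_lt (by omega), add_zero]
    have h2 : (l * r' + s') / l = r' := by
      rw [Nat.mul_add_div (by omega), Nat.div_eq_of_lt (by omega), add_zero]
    obtain rfl : r = r' := by rw [← h1, heq', h2]
    simp at heq'
    rw [heq']
  have hcard : #((range R₂ ×ˢ range S).image fun p : ℕ × ℕ => (l * p.1 + p.2 : ℝ)) = R₂ * S := by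
    rw [card_image_of_injOn hinj, card_product, card_range, card_range]
  have hle : R₂ * S ≤ E.det.natDegree := by
    rw [← hcard]
    refine le_trans (card_le_card ?_) ((Multiset.toFinset_card_le _).trans (card_roots' E.det))
    intro y hy
    simp only [mem_image, mem_product, mem_range] at hy
    obtain ⟨⟨r, s⟩, ⟨hr, hs⟩, rfl⟩ := hy
    rw [Multiset.mem_toFinset, mem_roots hQ]
    exact hroot r hr s hs
  have hdegQ : E.det.natDegree ≤ L * (K - 1) := by
    refine (natDegree_det_le E _ hE).trans ((sum_le_sum fun j _ => hdeg (f j)).trans ?_)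
    rw [sum_const, card_univ, Fintype.card_fin, smul_eq_mul]
    exact Nat.mul_le_mul_right _ hmL
  omega

theorem eq_zero_of_sum_choose_eq_zero {K : ℕ} (a : Fin K → ℝ)
    (h : ∀ n : ℕ, ∑ k, a k * (n.choose k : ℝ) = 0) : a = 0 := by
  have key : ∀ n, ∀ hn : n < K, a ⟨n, hn⟩ = 0 := by
    intro n
    induction n using Nat.strong_induction_on with
    | _ n ih =>
      intro hn
      have := h n
      rw [sum_eq_single ⟨n, hn⟩ (fun k _ hk => ?_) (by simp)] at this
      · simpa using this
      · rcases lt_or_gt_of_ne (fun h => hk (Fin.ext h) : (k : ℕ) ≠ n) with hlt | hgt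
        · rw [ih k hlt k.2, zero_mul]
        · rw [Nat.choose_eq_zero_of_lt hgt]; simp
  funext k
  exact key k k.2

/-- The generalised Vandermonde matrix of the functions `C(j, k) τ^(t r) β^(t s)` at the nodes
`j = l r + s` has a nonvanishing maximal minor. -/
theorem exists_interpolation_minor {l K L R R₂ S : ℕ} {τ β : ℝ} (hτ : 1 < τ) (hβ : 0 < β)
    (hS : S ≤ l) (hR : R₂ + L ≤ R) (hcount : L * (K - 1) < R₂ * S) :
    ∃ c : Fin K × Fin L → Fin R × Fin S, Function.Injective c ∧
      (Matrix.of fun (i j : Fin K × Fin L) =>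
        ((l * (c j).1 + (c j).2 : ℕ).choose i.1 : ℝ) *
          (τ ^ (i.2 * (c j).1 : ℕ) * β ^ (i.2 * (c j).2 : ℕ))).det ≠ 0 := by
  refine exists_minor_ne_zero (fun (i : Fin K × Fin L) (p : Fin R × Fin S) =>
    ((l * p.1 + p.2 : ℕ).choose i.1 : ℝ) * (τ ^ (i.2 * p.1 : ℕ) * β ^ (i.2 * p.2 : ℕ))) ?_
  intro a ha
  let P : Fin L → ℝ[X] := fun t =>
    ∑ k : Fin K, C (a (k, t) / (k : ℕ).factorial) * descPochhammer ℝ k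
  have hP : ∀ t (n : ℕ), (P t).eval (n : ℝ) = ∑ k : Fin K, a (k, t) * (n.choose k : ℝ) := by
    intro t n
    simp only [P, eval_finsetSum, eval_mul, eval_C, descPochhammer_eval_eq_descFactorial]
    refine sum_congr rfl fun k _ => ?_
    rw [Nat.descFactorial_eq_factorial_mul_choose, Nat.cast_mul]
    have : ((k : ℕ).factorial : ℝ) ≠ 0 := by positivity
    field_simp
  have hP0 : ∀ t, P t = 0 := by
    refine eq_zero_of_expPoly_eq_zero (l := l) hτ hβ hS hR hcount P (fun t => ?_) fun r hr s hs => ?_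
    · refine natDegree_sum_le_of_forall_le _ _ fun k _ => ?_
      refine (natDegree_C_mul_le _ _).trans ?_
      rw [descPochhammer_natDegree]
      omega
    · rw [← ha (⟨r, hr⟩, ⟨s, hs⟩), Fintype.sum_prod_type_right]
      refine sum_congr rfl fun t _ => ?_
      have : (l * r + s : ℝ) = ((l * r + s : ℕ) : ℝ) := by push_cast; ring
      rw [this, hP, sum_mul]
      exact sum_congr rfl fun k _ => by ring
  funext ⟨k, t⟩
  have := eq_zero_of_sum_choose_eq_zero (fun k => a (k, t)) fun n => by
    rw [← hP, hP0, eval_zero]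
  exact congrFun this k

end TwoLogs

namespace TwoLogs

open Finset Polynomial

theorem sum_abs_coeff_mul_X_sub_C_le (p : ℝ[X]) (c y : ℝ) (hy : 0 ≤ y) (n : ℕ)
    (hn : p.natDegree < n) :
    ∑ i ∈ range (n + 1), |(p * (X - C c)).coeff i| * y ^ i ≤
      (∑ i ∈ range n, |p.coeff i| * y ^ i) * (y + |c|) := by
  have hlast : p.coeff n = 0 := coeff_eq_zero_of_natDegree_lt hn
  rw [sum_range_succ', mul_add, sum_mul, sum_mul]
  have h0 : |(p * (X - C c)).coeff 0| * y ^ 0 = |p.coeff 0| * y ^ 0 * |c| := by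
    simp [mul_sub, abs_mul]
  have hsplit : ∑ i ∈ range n, |p.coeff i| * y ^ i * |c| =
      ∑ i ∈ range n, |p.coeff (i + 1)| * y ^ (i + 1) * |c| + |p.coeff 0| * y ^ 0 * |c| := by
    rw [← sum_range_succ' (fun i => |p.coeff i| * y ^ i * |c|), sum_range_succ, hlast]
    simp
  rw [h0, hsplit, ← add_assoc, ← sum_add_distrib]
  refine add_le_add_left (sum_le_sum fun i _ => ?_) _
  have : |(p * (X - C c)).coeff (i + 1)| ≤ |p.coeff i| + |p.coeff (i + 1)| * |c| := by
    rw [mul_sub, coeff_sub, coeff_mul_X, coeff_mul_C, ← abs_mul]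
    exact abs_sub _ _
  calc _ ≤ (|p.coeff i| + |p.coeff (i + 1)| * |c|) * y ^ (i + 1) :=
        mul_le_mul_of_nonneg_right this (by positivity)
    _ = _ := by ring

theorem sum_abs_coeff_descPochhammer_le {y : ℝ} (hy : 0 ≤ y) (k : ℕ) :
    ∀ n, k < n → ∑ i ∈ range n, |(descPochhammer ℝ k).coeff i| * y ^ i ≤ (y + k) ^ k := by
  suffices h : ∀ n, k < n →
      ∑ i ∈ range n, |(descPochhammer ℝ k).coeff i| * y ^ i ≤ ∏ i ∈ range k, (y + i) by
    intro n hn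
    refine (h n hn).trans ?_
    calc _ ≤ ∏ _i ∈ range k, (y + k) := by
          refine prod_le_prod (fun i _ => by positivity) fun i hi => ?_
          have : (i : ℝ) ≤ k := by exact_mod_cast (mem_range.mp hi).le
          linarith
      _ = _ := by simp
  induction k with
  | zero =>
    intro n hn
    obtain ⟨n, rfl⟩ : ∃ m, n = m + 1 := ⟨n - 1, by omega⟩
    rw [sum_range_succ']
    simp [coeff_one]
  | succ k ih =>
    intro n hn
    obtain ⟨n, rfl⟩ : ∃ m, n = m + 1 := ⟨n - 1, by omega⟩
    have hX : (X - (k : ℝ[X])) = X - C (k : ℝ) := by simp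
    rw [descPochhammer_succ_right, hX, prod_range_succ]
    refine (sum_abs_coeff_mul_X_sub_C_le _ _ y hy n ?_).trans ?_
    · rw [descPochhammer_natDegree]; omega
    · rw [Nat.abs_cast]
      exact mul_le_mul_of_nonneg_right (ih n (by omega)) (by positivity)

theorem abs_pow_sub_pow_le_of_le {x y H : ℝ} (hx : 0 ≤ x) (hy : 0 ≤ y) (hxH : x ≤ H) (hyH : y ≤ H)
    (hH : 1 ≤ H) (m : ℕ) : |x ^ m - y ^ m| ≤ |x - y| * (m * H ^ m) := by
  have h := abs_pow_sub_pow_le x y m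
  refine h.trans ?_
  have hmax : max |x| |y| ≤ H := by
    rw [abs_of_nonneg hx, abs_of_nonneg hy]; exact max_le hxH hyH
  rw [mul_assoc]
  refine mul_le_mul_of_nonneg_left (mul_le_mul_of_nonneg_left ?_ (by positivity)) (abs_nonneg _)
  exact (pow_le_pow_left₀ (le_max_of_le_left (abs_nonneg _)) hmax _).trans
    (pow_le_pow_right₀ hH (Nat.sub_le m 1))

theorem choose_le_pow_div {n k : ℕ} : (n.choose k : ℝ) ≤ (n : ℝ) ^ k / (k.factorial : ℝ) :=
  Nat.choose_le_pow_div k n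

open Filter Topology in
/-- Upper bound for the interpolation determinant of the functions `C(j, k) τ^(t r) β^(t s)` when
`τ` is close to `β ^ l`. -/
theorem abs_interpolation_det_le {l K L R S : ℕ} {τ β δ : ℝ} (hτ : 0 ≤ τ) (hτH : τ ≤ 1024)
    (hβ : 1 ≤ β) (hβH : β ^ l ≤ 1024) (hδ : |τ - β ^ l| ≤ δ) (hS : S ≤ l)
    (hsmall : (16 : ℝ) ^ (K * L) * (L * R * δ) ≤ 1)
    (c : Fin K × Fin L → Fin R × Fin S) :
    |(Matrix.of fun (i j : Fin K × Fin L) =>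
        ((l * (c j).1 + (c j).2 : ℕ).choose i.1 : ℝ) *
          (τ ^ (i.2 * (c j).1 : ℕ) * β ^ (i.2 * (c j).2 : ℕ))).det| *
        16 ^ (K * L * (K * L - 1) / 2) ≤
      (K * L).factorial * ∏ i : Fin K × Fin L,
        (2 * ((16 * l * R + K : ℝ) ^ (i.1 : ℕ) / (i.1 : ℕ).factorial *
          2 ^ (160 * R * i.2 : ℕ))) := by
  have hδ0 : 0 ≤ δ := (abs_nonneg _).trans hδ
  have hβ0 : 0 < β := by linarith
  set lam := Real.log β with hlam
  have hlam0 : 0 ≤ lam := Real.log_nonneg hβ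
  have hexp : ∀ t n : ℕ, Real.exp (t * lam * n) = β ^ (t * n : ℕ) := by
    intro t n
    rw [← Real.exp_log (show 0 < β ^ (t * n : ℕ) by positivity), Real.log_pow]
    congr 1
    push_cast
    ring
  let node : Fin K × Fin L → ℕ := fun j => l * (c j).1 + (c j).2
  have hnode : ∀ j, node j ≤ l * R := fun j => by
    have h1 := (c j).1.2
    have h2 := (c j).2.2
    have : l * ((c j).1 + 1) ≤ l * R := Nat.mul_le_mul_left l h1
    simp only [node]
    rw [mul_add] at this
    omega
  let e : Fin K × Fin L → Fin K × Fin L → ℝ := fun i j => ((node j).choose i.1 : ℝ) *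
    (τ ^ (i.2 * (c j).1 : ℕ) * β ^ (i.2 * (c j).2 : ℕ) - β ^ (i.2 * node j : ℕ))
  let F : Fin K × Fin L → ℝ := fun i => (16 * l * R + K : ℝ) ^ (i.1 : ℕ) / (i.1 : ℕ).factorial *
    2 ^ (160 * R * i.2 : ℕ)
  let E : Fin K × Fin L → ℝ := fun i => F i * (L * R * δ)
  have hF0 : ∀ i, 0 ≤ F i := fun i => by positivity
  have he : ∀ i j, |e i j| ≤ E i := by
    intro i j
    have hr := (c j).1.2
    have hs := (c j).2.2
    have ht := i.2.2
    set r : ℕ := (c j).1.val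
    set s : ℕ := (c j).2.val
    set t : ℕ := i.2.val
    have hfac : τ ^ (t * r) * β ^ (t * s) - β ^ (t * node j) =
        (τ ^ (t * r) - (β ^ l) ^ (t * r)) * β ^ (t * s) := by
      rw [sub_mul, ← pow_mul, ← pow_add]
      congr 2
      simp only [node, r, s]
      ring
    have h1 : |τ ^ (t * r) - (β ^ l) ^ (t * r)| ≤ δ * ((t * r : ℕ) * 1024 ^ (t * r)) :=
      (abs_pow_sub_pow_le_of_le hτ (by positivity) hτH hβH (by norm_num) _).trans
        (mul_le_mul_of_nonneg_right hδ (by positivity))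
    have h2 : β ^ (t * s) ≤ 1024 ^ t := by
      rw [mul_comm, pow_mul]
      exact pow_le_pow_left₀ (by positivity)
        ((pow_le_pow_right₀ hβ (by omega)).trans hβH) _
    have h3 : ((node j).choose i.1 : ℝ) ≤
        (16 * l * R + K : ℝ) ^ (i.1 : ℕ) / (i.1 : ℕ).factorial := by
      refine choose_le_pow_div.trans (div_le_div_of_nonneg_right ?_ (by positivity))
      refine pow_le_pow_left₀ (by positivity) ?_ _
      have : (node j : ℝ) ≤ l * R := by exact_mod_cast hnode j
      have : (0 : ℝ) ≤ l * R := by positivity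
      have : (0 : ℝ) ≤ K := by positivity
      nlinarith
    have h4 : ((t * r : ℕ) : ℝ) ≤ L * R := by
      exact_mod_cast Nat.mul_le_mul ht.le hr.le
    have h5 : (1024 : ℝ) ^ (t * r) * 1024 ^ t ≤ 2 ^ (160 * R * t) := by
      rw [← pow_add, show (1024 : ℝ) = 2 ^ 10 by norm_num, ← pow_mul]
      refine pow_le_pow_right₀ (by norm_num) ?_
      have : t * (r + 1) ≤ t * R := Nat.mul_le_mul_left t hr
      nlinarith
    calc |e i j| = ((node j).choose i.1 : ℝ) *
          (|τ ^ (t * r) - (β ^ l) ^ (t * r)| * β ^ (t * s)) := by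
          simp only [e]
          rw [hfac, abs_mul, abs_mul, Nat.abs_cast, abs_of_pos (show 0 < β ^ (t * s) by positivity)]
      _ ≤ ((16 * l * R + K : ℝ) ^ (i.1 : ℕ) / (i.1 : ℕ).factorial) *
          ((δ * (L * R * 1024 ^ (t * r))) * 1024 ^ t) := by
          refine mul_le_mul h3 (mul_le_mul (h1.trans ?_) h2 (by positivity) (by positivity))
            (by positivity) (by positivity)
          refine mul_le_mul_of_nonneg_left (mul_le_mul_of_nonneg_right h4 (by positivity)) hδ0
      _ = ((16 * l * R + K : ℝ) ^ (i.1 : ℕ) / (i.1 : ℕ).factorial) *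
          (1024 ^ (t * r) * 1024 ^ t) * (L * R * δ) := by ring
      _ ≤ _ := mul_le_mul_of_nonneg_right (mul_le_mul_of_nonneg_left h5 (by positivity))
          (by positivity)
  have hE : ∀ i, (16 : ℝ) ^ Fintype.card (Fin K × Fin L) * E i ≤ F i := by
    intro i
    rw [Fintype.card_prod, Fintype.card_fin, Fintype.card_fin]
    calc (16 : ℝ) ^ (K * L) * E i = F i * (16 ^ (K * L) * (L * R * δ)) := by simp only [E]; ring
      _ ≤ F i * 1 := mul_le_mul_of_nonneg_left hsmall (hF0 i)
      _ = F i := mul_one _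
  let P : ℕ → Fin K × Fin L → ℝ → ℝ := fun M i x =>
    ∑ m ∈ range M, ((i.2 : ℕ) * lam * x) ^ m / m.factorial
  let A : ℕ → Matrix (Fin K × Fin L) (Fin K × Fin L) ℝ := fun M => Matrix.of fun i j =>
    ((node j).choose i.1 : ℝ) * P M i (node j) + e i j
  have hbound : ∀ M, |(A M).det| * 16 ^ (K * L * (K * L - 1) / 2) ≤
      (K * L).factorial * ∏ i, (2 * F i) := by
    intro M
    have hcard : Fintype.card (Fin K × Fin L) = K * L := by simp
    have := abs_det_le (ι := Fin K × Fin L) (O := Fin K × Fin M) (fun o => (o.1 : ℕ) + o.2)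
      (fun i o => (descPochhammer ℝ i.1).coeff o.1 / (i.1 : ℕ).factorial *
        (((i.2 : ℕ) * lam) ^ (o.2 : ℕ) / (o.2 : ℕ).factorial))
      (fun j => node j) e (X := l * R) (ρ := 16) (by norm_num) F E
      (fun j => by rw [Nat.abs_cast]; exact_mod_cast hnode j) he hE ?_ (A M) ?_
    · rwa [hcard] at this
    · intro i
      rw [Fintype.sum_prod_type]
      have h1 := sum_abs_coeff_descPochhammer_le (y := 16 * l * R) (by positivity) i.1 K i.1.2
      have h2 : ∑ m ∈ range M, ((i.2 : ℕ) * lam * (16 * l * R)) ^ m / m.factorial ≤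
          (2 : ℝ) ^ (160 * R * i.2 : ℕ) := by
        refine (Real.sum_le_exp_of_nonneg (by positivity) M).trans ?_
        have := hexp i.2 (16 * l * R)
        push_cast at this
        rw [this, show (i.2 : ℕ) * (16 * l * R) = l * (16 * R * i.2) by ring, pow_mul]
        refine (pow_le_pow_left₀ (by positivity) hβH _).trans_eq ?_
        rw [show (1024 : ℝ) = 2 ^ 10 by norm_num, ← pow_mul]
        congr 1
        ring
      calc _ = (∑ p ∈ range K, |(descPochhammer ℝ i.1).coeff p| * (16 * l * R) ^ p) /
            (i.1 : ℕ).factorial *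
            ∑ m ∈ range M, ((i.2 : ℕ) * lam * (16 * l * R)) ^ m / m.factorial := by
            rw [sum_div, sum_mul_sum, ← Fin.sum_univ_eq_sum_range
              (fun p => ∑ m ∈ range M, _ * _) K]
            refine sum_congr rfl fun p _ => ?_
            rw [← Fin.sum_univ_eq_sum_range (fun m => _ * _) M]
            refine sum_congr rfl fun m _ => ?_
            rw [abs_mul, abs_div, Nat.abs_cast, abs_of_nonneg (show
              0 ≤ ((i.2 : ℕ) * lam) ^ (m : ℕ) / ((m : ℕ).factorial : ℝ) by positivity)]
            rw [pow_add, mul_pow ((i.2 : ℕ) * lam), ← mul_assoc (16 : ℝ) (l : ℝ) (R : ℝ)]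
            ring
        _ ≤ (16 * l * R + (i.1 : ℕ)) ^ (i.1 : ℕ) / (i.1 : ℕ).factorial *
            2 ^ (160 * R * i.2 : ℕ) := by
            refine mul_le_mul (div_le_div_of_nonneg_right h1 (by positivity)) h2 ?_ (by positivity)
            exact sum_nonneg fun m _ => by positivity
        _ ≤ _ := by
            refine mul_le_mul_of_nonneg_right (div_le_div_of_nonneg_right (pow_le_pow_left₀
              (by positivity) ?_ _) (by positivity)) (by positivity)
            have : ((i.1 : ℕ) : ℝ) ≤ K := by exact_mod_cast i.1.2.le
            linarith
    · intro i j
      simp only [A, Matrix.of_apply, P]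
      congr 1
      have hch : ((node j).choose i.1 : ℝ) = ∑ p ∈ range K,
          (descPochhammer ℝ i.1).coeff p / (i.1 : ℕ).factorial * (node j : ℝ) ^ p := by
        have h1 := descPochhammer_eval_eq_descFactorial ℝ (node j) i.1
        rw [eval_eq_sum_range' (n := K) (by rw [descPochhammer_natDegree]; exact i.1.2),
          Nat.descFactorial_eq_factorial_mul_choose, Nat.cast_mul] at h1
        rw [eq_div_of_mul_eq (by positivity) ((mul_comm _ _).trans h1.symm), sum_div]
        exact sum_congr rfl fun p _ => by ring
      rw [hch, Fintype.sum_prod_type, sum_mul_sum,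
        ← Fin.sum_univ_eq_sum_range (fun p => ∑ m ∈ range M, _ * _) K]
      refine sum_congr rfl fun p _ => ?_
      rw [← Fin.sum_univ_eq_sum_range (fun m => _ * _) M]
      refine sum_congr rfl fun m _ => ?_
      rw [pow_add, mul_pow]
      ring
  have hlim : Tendsto (fun M => (A M).det) atTop (𝓝 (Matrix.of fun (i j : Fin K × Fin L) =>
        ((l * (c j).1 + (c j).2 : ℕ).choose i.1 : ℝ) *
          (τ ^ (i.2 * (c j).1 : ℕ) * β ^ (i.2 * (c j).2 : ℕ))).det) := by
    refine (Continuous.matrix_det continuous_id).continuousAt.tendsto.comp ?_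
    refine tendsto_pi_nhds.mpr fun i => tendsto_pi_nhds.mpr fun j => ?_
    have hP : Tendsto (fun M => P M i (node j)) atTop (𝓝 (β ^ (i.2 * node j : ℕ))) := by
      rw [← hexp, Real.exp_eq_exp_ℝ]
      exact (NormedSpace.expSeries_div_hasSum_exp (𝔸 := ℝ) _).tendsto_sum_nat
    have := (hP.const_mul ((node j).choose i.1 : ℝ)).add_const (e i j)
    have hval : ((node j).choose i.1 : ℝ) * β ^ (i.2 * node j : ℕ) + e i j =
        ((l * (c j).1 + (c j).2 : ℕ).choose i.1 : ℝ) *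
          (τ ^ (i.2 * (c j).1 : ℕ) * β ^ (i.2 * (c j).2 : ℕ)) := by
      simp only [e, node]
      ring
    rwa [hval] at this
  exact le_of_tendsto ((hlim.abs).mul_const _) (Eventually.of_forall hbound)

end TwoLogs

namespace TwoLogs

open Finset

/-- A nonzero interpolation determinant is bounded below by its denominator. -/
theorem one_le_abs_interpolation_det {l K L R S a b U V : ℕ} (hb : 0 < b) (hU : 0 < U)
    (c : Fin K × Fin L → Fin R × Fin S) (hc : Function.Injective c)
    (hdet : (Matrix.of fun (i j : Fin K × Fin L) =>
        ((l * (c j).1 + (c j).2 : ℕ).choose i.1 : ℝ) *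
          (((a : ℝ) / b) ^ (i.2 * (c j).1 : ℕ) * ((V : ℝ) / U) ^ (i.2 * (c j).2 : ℕ))).det ≠ 0) :
    1 ≤ |(Matrix.of fun (i j : Fin K × Fin L) =>
        ((l * (c j).1 + (c j).2 : ℕ).choose i.1 : ℝ) *
          (((a : ℝ) / b) ^ (i.2 * (c j).1 : ℕ) * ((V : ℝ) / U) ^ (i.2 * (c j).2 : ℕ))).det| *
      ((b : ℝ) ^ (L * R * (K * L)) * (U : ℝ) ^ ((L - 1) * (R * (S * (S - 1) / 2)))) := by
  set A : Matrix (Fin K × Fin L) (Fin K × Fin L) ℝ := Matrix.of fun i j =>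
        ((l * (c j).1 + (c j).2 : ℕ).choose i.1 : ℝ) *
          (((a : ℝ) / b) ^ (i.2 * (c j).1 : ℕ) * ((V : ℝ) / U) ^ (i.2 * (c j).2 : ℕ)) with hA
  let w : Fin K × Fin L → ℝ := fun j =>
    (b : ℝ) ^ ((L - 1) * (c j).1 : ℕ) * (U : ℝ) ^ ((L - 1) * (c j).2 : ℕ)
  let B : Matrix (Fin K × Fin L) (Fin K × Fin L) ℤ := Matrix.of fun i j =>
    ((l * (c j).1 + (c j).2 : ℕ).choose i.1 : ℤ) *
      ((a : ℤ) ^ (i.2 * (c j).1 : ℕ) * (b : ℤ) ^ ((L - 1 - i.2) * (c j).1 : ℕ) *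
      ((V : ℤ) ^ (i.2 * (c j).2 : ℕ) * (U : ℤ) ^ ((L - 1 - i.2) * (c j).2 : ℕ)))
  have hbR : (0 : ℝ) < b := by exact_mod_cast hb
  have hUR : (0 : ℝ) < U := by exact_mod_cast hU
  have hw : ∀ j, 0 < w j := fun j => by positivity
  have hscale : ∀ (p q : ℝ), 0 < q → ∀ t r : ℕ, t ≤ L - 1 →
      q ^ ((L - 1) * r) * (p / q) ^ (t * r) = p ^ (t * r) * q ^ ((L - 1 - t) * r) := by
    intro p q hq t r ht
    rw [show (L - 1) * r = (L - 1 - t) * r + t * r by rw [← add_mul, Nat.sub_add_cancel ht],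
      pow_add, mul_assoc, ← mul_pow, mul_div_cancel₀ _ hq.ne']
    ring
  have hBA : B.map (Int.castRingHom ℝ) = Matrix.of fun i j => w j * A i j := by
    ext i j
    have ht : (i.2 : ℕ) ≤ L - 1 := by have := i.2.2; omega
    have h1 := hscale a b hbR i.2 (c j).1 ht
    have h2 := hscale V U hUR i.2 (c j).2 ht
    simp only [B, A, w, Matrix.map_apply, Matrix.of_apply, eq_intCast]
    push_cast
    calc _ = ((l * (c j).1 + (c j).2 : ℕ).choose i.1 : ℝ) *
          (((b : ℝ) ^ ((L - 1) * (c j).1 : ℕ) * ((a : ℝ) / b) ^ (i.2 * (c j).1 : ℕ)) *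
          ((U : ℝ) ^ ((L - 1) * (c j).2 : ℕ) * ((V : ℝ) / U) ^ (i.2 * (c j).2 : ℕ))) := by
          rw [h1, h2]
      _ = _ := by ring
  have hdetB : ((B.det : ℤ) : ℝ) = (∏ j, w j) * A.det := by
    have := (Int.castRingHom ℝ).map_det B
    rw [eq_intCast] at this
    rw [this, ← Matrix.det_mul_row]
    exact congrArg Matrix.det hBA
  have hwpos : 0 < ∏ j, w j := prod_pos fun j _ => hw j
  have hB1 : (1 : ℝ) ≤ |((B.det : ℤ) : ℝ)| := by
    have hne : B.det ≠ 0 := by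
      intro h0
      rw [h0, Int.cast_zero] at hdetB
      exact mul_ne_zero hwpos.ne' hdet hdetB.symm
    exact_mod_cast Int.one_le_abs hne
  rw [hdetB, abs_mul, abs_of_pos hwpos, mul_comm] at hB1
  refine hB1.trans (mul_le_mul_of_nonneg_left ?_ (abs_nonneg _))
  have hb1 : (1 : ℝ) ≤ b := by exact_mod_cast hb
  have hU1 : (1 : ℝ) ≤ U := by exact_mod_cast hU
  rw [prod_mul_distrib, prod_pow_eq_pow_sum, prod_pow_eq_pow_sum]
  refine mul_le_mul (pow_le_pow_right₀ hb1 ?_) (pow_le_pow_right₀ hU1 ?_) (by positivity)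
    (by positivity)
  · calc ∑ j, (L - 1) * ((c j).1 : ℕ) ≤ ∑ _j : Fin K × Fin L, L * R :=
          sum_le_sum fun j _ => Nat.mul_le_mul (Nat.sub_le _ _) (c j).1.2.le
      _ = L * R * (K * L) := by
          rw [sum_const, card_univ, Fintype.card_prod, Fintype.card_fin, Fintype.card_fin,
            smul_eq_mul, mul_comm]
  · rw [← mul_sum]
    refine Nat.mul_le_mul_left _ ?_
    calc ∑ j, ((c j).2 : ℕ) = ∑ p ∈ univ.image c, (p.2 : ℕ) :=
          by
          rw [sum_image fun x _ y _ h => hc h]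
      _ ≤ ∑ p : Fin R × Fin S, (p.2 : ℕ) := sum_le_sum_of_subset (subset_univ _)
      _ = R * (S * (S - 1) / 2) := by
          rw [Fintype.sum_prod_type]
          simp only [sum_const, card_univ, Fintype.card_fin, smul_eq_mul]
          rw [Fin.sum_univ_eq_sum_range (fun s => s) S, sum_range_id]

theorem superfactorial_ge (K : ℕ) :
    ((K : ℝ) / 8) ^ (K * (K - 1) / 2) ≤ ∏ k ∈ range K, (k.factorial : ℝ) := by
  induction K with
  | zero => simp
  | succ K ih =>
    rcases Nat.eq_zero_or_pos K with rfl | hK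
    · simp
    have hK0 : (0 : ℝ) < K := by exact_mod_cast hK
    have htri : (K + 1) * K / 2 = K * (K - 1) / 2 + K := by
      have := sum_range_succ (fun i => i) K
      rw [sum_range_id, sum_range_id, Nat.add_sub_cancel] at this
      exact this
    have hmul : K * (K - 1) / 2 * 2 = K * (K - 1) :=
      Nat.div_mul_cancel (Nat.even_mul_pred_self K).two_dvd
    rw [prod_range_succ, Nat.add_sub_cancel, htri, pow_add]
    set T := K * (K - 1) / 2
    have hratio : ((K + 1 : ℕ) : ℝ) / 8 ≤ (K / 8) * Real.exp (1 / K) := by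
      have := Real.add_one_le_exp (1 / (K : ℝ))
      calc ((K + 1 : ℕ) : ℝ) / 8 = (K / 8) * (1 / K + 1) := by
            push_cast; field_simp; ring
        _ ≤ _ := mul_le_mul_of_nonneg_left this (by positivity)
    have hpos : (0 : ℝ) ≤ ((K + 1 : ℕ) : ℝ) / 8 := by positivity
    have h1 : (((K + 1 : ℕ) : ℝ) / 8) ^ T ≤ (K / 8 : ℝ) ^ T * Real.exp ((K - 1) / 2) := by
      refine (pow_le_pow_left₀ hpos hratio T).trans_eq ?_
      rw [mul_pow, ← Real.exp_nat_mul]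
      congr 2
      have : (T : ℝ) * 2 = K * (K - 1) := by
        rw [← Nat.cast_pred hK]; exact_mod_cast hmul
      field_simp
      linarith
    have h2 : (((K + 1 : ℕ) : ℝ) / 8) ^ K ≤ (K : ℝ) ^ K / 8 ^ K * Real.exp 1 := by
      refine (pow_le_pow_left₀ hpos hratio K).trans_eq ?_
      rw [mul_pow, ← Real.exp_nat_mul, div_pow]
      congr 2
      field_simp
    have h3 : (K : ℝ) ^ K ≤ Real.exp K * K.factorial := by
      have := Real.pow_div_factorial_le_exp (K : ℝ) hK0.le K
      rwa [div_le_iff₀ (by positivity)] at this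
    have h4 : Real.exp ((K - 1) / 2) * Real.exp 1 * Real.exp K ≤ 8 ^ K := by
      have he : Real.exp 2 ≤ 8 := by
        have := Real.exp_one_lt_d9
        have h2 : Real.exp 2 = Real.exp 1 * Real.exp 1 := by rw [← Real.exp_add]; norm_num
        have := Real.exp_pos 1
        rw [h2]; nlinarith
      rw [← Real.exp_add, ← Real.exp_add]
      calc Real.exp ((K - 1) / 2 + 1 + K) ≤ Real.exp (K * 2) := by
            rw [Real.exp_le_exp]
            have : (1 : ℝ) ≤ K := by exact_mod_cast hK
            linarith
        _ = Real.exp 2 ^ K := Real.exp_nat_mul 2 K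
        _ ≤ _ := pow_le_pow_left₀ (Real.exp_pos _).le he K
    calc _ ≤ ((K / 8 : ℝ) ^ T * Real.exp ((K - 1) / 2)) * ((K : ℝ) ^ K / 8 ^ K * Real.exp 1) :=
          mul_le_mul h1 h2 (by positivity) (by positivity)
      _ ≤ ((K / 8 : ℝ) ^ T * Real.exp ((K - 1) / 2)) *
          (Real.exp K * K.factorial / 8 ^ K * Real.exp 1) := by gcongr
      _ = (K / 8 : ℝ) ^ T * K.factorial *
          ((Real.exp ((K - 1) / 2) * Real.exp 1 * Real.exp K) / 8 ^ K) := by ring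
      _ ≤ (K / 8 : ℝ) ^ T * K.factorial * 1 := by
          refine mul_le_mul_of_nonneg_left ?_ (by positivity)
          rw [div_le_one (by positivity)]
          exact h4
      _ ≤ _ := by
          rw [mul_one]
          exact mul_le_mul_of_nonneg_right ih (by positivity)

end TwoLogs

namespace TwoLogs

open Finset

theorem sq_mul_le_two_pow {L : ℕ} (hL : 10 ≤ L) : 655 * L ^ 2 ≤ 2 ^ (L + 6) := by
  induction L, hL using Nat.le_induction with
  | base => norm_num
  | succ n hn ih =>
    rw [show n + 1 + 6 = (n + 6) + 1 by ring, pow_succ 2]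
    nlinarith

/-- Exponent comparison for the choice of parameters made in `false_of_close_powers`. -/
theorem exponent_lt {u L k : ℕ} (hL : 10 ≤ L) (hu : 12 ≤ u) (hk : 655 * (u * L) < 513 * (k + 1)) :
    128 * k * L * (k + L) + 128 * k * L + (L + 8) * (64 * k * (128 * k)) * L
      + 80 * (k + L) * L * (L - 1) * (128 * k) + 3 * (L * (k + L) * (128 * k * L))
      + (u + 1) * ((L - 1) * ((k + L) * (8192 * L ^ 2)))
      < 2 * (128 * k * L * (128 * k * L - 1)) := by
  obtain ⟨n, rfl⟩ := Nat.exists_eq_add_of_le hL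
  obtain ⟨m, rfl⟩ : ∃ m, k = 15 * (10 + n) + m := Nat.exists_eq_add_of_le (by nlinarith)
  have hk1 : 1 ≤ 128 * (15 * (10 + n) + m) * (10 + n) := by
    have : 0 < 128 * (15 * (10 + n) + m) * (10 + n) := by positivity
    exact this
  have hL1 : 10 + n - 1 = 9 + n := by omega
  rw [hL1]
  zify [hk1] at hk ⊢
  set P : ℤ := (9 + n) * ((15 * (10 + n) + m) + (10 + n)) with hP
  have hP0 : 0 ≤ P := by positivity
  have key : 655 * (((u : ℤ) + 1) * (10 + n)) * (64 * P) ≤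
      (513 * (15 * (10 + n) + m + 1) + 655 * (10 + n)) * (64 * P) :=
    mul_le_mul_of_nonneg_right (by nlinarith) (by positivity)
  have hmain : 655 * ((15 * (10 + n) + m) * ((15 * (10 + n) + m) + (10 + n)) + (15 * (10 + n) + m)
      + (15 * (10 + n) + m) * (64 * (15 * (10 + n) + m)) * (10 + n + 8)
      + (15 * (10 + n) + m) * (80 * ((15 * (10 + n) + m) + (10 + n)) * (9 + n))
      + (15 * (10 + n) + m) * (3 * (10 + n) * ((15 * (10 + n) + m) + (10 + n))))
      + (513 * (15 * (10 + n) + m + 1) + 655 * (10 + n)) * (64 * P)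
      < 655 * (2 * ((15 * (10 + n) + m) * (128 * (15 * (10 + n) + m) * (10 + n) - 1)) : ℤ) := by
    rw [hP, ← sub_pos]
    ring_nf
    positivity
  have h2 : 655 * ((15 * (10 + n) + m) * ((15 * (10 + n) + m) + (10 + n)) + (15 * (10 + n) + m)
      + (15 * (10 + n) + m) * (64 * (15 * (10 + n) + m)) * (10 + n + 8)
      + (15 * (10 + n) + m) * (80 * ((15 * (10 + n) + m) + (10 + n)) * (9 + n))
      + (15 * (10 + n) + m) * (3 * (10 + n) * ((15 * (10 + n) + m) + (10 + n)))
      + ((u : ℤ) + 1) * (10 + n) * (64 * P))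
      < 655 * (2 * ((15 * (10 + n) + m) * (128 * (15 * (10 + n) + m) * (10 + n) - 1)) : ℤ) := by
    linarith
  have h3 := lt_of_mul_lt_mul_left h2 (by norm_num)
  have h4 := mul_lt_mul_of_pos_left h3 (show (0 : ℤ) < 128 * (10 + n) by positivity)
  rw [hP] at h4
  linarith [h4]

theorem prod_row_bound_le {K L : ℕ} {M B : ℝ} {e : ℕ} (hK : 0 < K) (hM : 0 ≤ M) (hB : 0 ≤ B)
    (hMB : M ≤ B * (K / 8)) :
    ∏ i : Fin K × Fin L, (2 * (M ^ (i.1 : ℕ) / (i.1 : ℕ).factorial * 2 ^ (e * i.2 : ℕ))) ≤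
      2 ^ (K * L) * (B ^ (K * (K - 1) / 2)) ^ L * (2 : ℝ) ^ (e * (L * (L - 1) / 2) * K) := by
  have hK8 : (0 : ℝ) < K / 8 := by positivity
  have h1 : ∏ i : Fin K × Fin L, (2 * (M ^ (i.1 : ℕ) / (i.1 : ℕ).factorial * 2 ^ (e * i.2 : ℕ))) =
      2 ^ (K * L) * (M ^ (K * (K - 1) / 2) / ∏ k ∈ range K, (k.factorial : ℝ)) ^ L *
        (2 : ℝ) ^ (e * (L * (L - 1) / 2) * K) := by
    rw [prod_mul_distrib, prod_mul_distrib, Fintype.prod_prod_type, Fintype.prod_prod_type,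
      Fintype.prod_prod_type]
    simp only [prod_const, card_univ, Fintype.card_fin, prod_pow_eq_pow_sum, ← mul_sum]
    rw [Fin.sum_univ_eq_sum_range (fun s => s) L, sum_range_id, prod_pow,
      Fin.prod_univ_eq_prod_range (fun k => M ^ k / (k.factorial : ℝ)) K, prod_div_distrib,
      prod_pow_eq_pow_sum, sum_range_id]
    ring
  rw [h1]
  gcongr
  have hpos : (0 : ℝ) < ∏ k ∈ range K, (k.factorial : ℝ) := prod_pos fun k _ => by positivity
  rw [div_le_iff₀ hpos]
  calc M ^ (K * (K - 1) / 2) ≤ (B * (K / 8)) ^ (K * (K - 1) / 2) := pow_le_pow_left₀ hM hMB _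
    _ = B ^ (K * (K - 1) / 2) * (K / 8 : ℝ) ^ (K * (K - 1) / 2) := mul_pow _ _ _
    _ ≤ _ := mul_le_mul_of_nonneg_left (superfactorial_ge K) (by positivity)

theorem lt_eleven_mul {l U V : ℕ} (hU : 0 < U) (hUV : U < V) (hV : V ^ l ≤ 1024 * U ^ l) :
    l < 11 * U := by
  by_contra! hcon
  have hUR : (0 : ℝ) < U := by exact_mod_cast hU
  have h1 : (2 : ℝ) ≤ (1 + 1 / (U : ℝ)) ^ U := by
    have := one_add_mul_le_pow (a := 1 / (U : ℝ)) (by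
      have : (0 : ℝ) ≤ 1 / U := by positivity
      linarith) U
    rw [mul_one_div_cancel hUR.ne'] at this
    linarith
  have h2 : (1 + 1 / (U : ℝ)) ≤ V / U := by
    rw [le_div_iff₀ hUR]
    have : (U : ℝ) + 1 ≤ V := by exact_mod_cast hUV
    field_simp
    linarith
  have h3 : ((V : ℝ) / U) ^ l ≤ 1024 := by
    rw [div_pow, div_le_iff₀ (by positivity)]
    exact_mod_cast hV
  have h0 : (1 : ℝ) ≤ 1 + 1 / (U : ℝ) := by
    have : (0 : ℝ) ≤ 1 / U := by positivity
    linarith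
  have h4 : (2 : ℝ) ^ 11 ≤ 1024 := calc
    (2 : ℝ) ^ 11 ≤ ((1 + 1 / (U : ℝ)) ^ U) ^ 11 := pow_le_pow_left₀ (by norm_num) h1 _
    _ = (1 + 1 / (U : ℝ)) ^ (11 * U) := by rw [← pow_mul, mul_comm]
    _ ≤ (1 + 1 / (U : ℝ)) ^ l := pow_le_pow_right₀ h0 hcon
    _ ≤ (V / U : ℝ) ^ l := pow_le_pow_left₀ (by positivity) h2 _
    _ ≤ 1024 := h3
  norm_num at h4

/-- For large exponents `b V ^ l` and `a U ^ l` cannot be within a bounded distance. -/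
theorem false_of_close_powers {l a b U V : ℕ} (hl : 2 ^ 16 ≤ l) (hb : 0 < b) (hb8 : b ≤ 8)
    (hab : b < a) (ha : a ≤ 1024 * b) (hU : 0 < U) (hUV : U < V) (hV : V ^ l ≤ 1024 * U ^ l)
    (h : |(b : ℤ) * V ^ l - a * U ^ l| ≤ 2048) : False := by
  have hlU := lt_eleven_mul hU hUV hV
  set u := Nat.log 2 U with hu_def
  have hu : 12 ≤ u := Nat.le_log_of_pow_le (by norm_num) (by omega)
  have hUu : 2 ^ u ≤ U := Nat.pow_log_le_self 2 hU.ne'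
  have hUu' : U ≤ 2 ^ (u + 1) := (Nat.lt_pow_succ_log_self (by norm_num) U).le
  obtain ⟨L, hL, hlL, hlL'⟩ : ∃ L, 10 ≤ L ∧ 2 ^ (L + 6) ≤ l ∧ l ≤ 2 ^ (L + 7) := by
    have h16 : 16 ≤ Nat.log 2 l := Nat.le_log_of_pow_le (by norm_num) hl
    refine ⟨Nat.log 2 l - 6, by omega, ?_, ?_⟩
    · rw [Nat.sub_add_cancel (by omega)]
      exact Nat.pow_log_le_self 2 (by omega)
    · rw [show Nat.log 2 l - 6 + 7 = Nat.log 2 l + 1 by omega]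
      exact (Nat.lt_pow_succ_log_self (by norm_num) l).le
  set k := u * l / (513 * L) with hk_def
  have hk1 : 513 * L * k ≤ u * l := Nat.mul_div_le _ _
  have hk2 : 655 * (u * L) < 513 * (k + 1) := by
    have h1 : u * l < 513 * L * (k + 1) := Nat.lt_mul_div_succ _ (by omega)
    have h2 : u * (655 * L ^ 2) ≤ u * l :=
      Nat.mul_le_mul_left _ ((sq_mul_le_two_pow hL).trans hlL)
    have h3 : L * (655 * (u * L)) < L * (513 * (k + 1)) := by
      calc L * (655 * (u * L)) = u * (655 * L ^ 2) := by ring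
        _ < 513 * L * (k + 1) := h2.trans_lt h1
        _ = _ := by ring
    exact lt_of_mul_lt_mul_left h3 (Nat.zero_le _)
  have hkL : 15 * L ≤ k := by nlinarith
  have hexp := exponent_lt hL hu hk2
  set K := 128 * k with hK
  set S := 128 * L with hS
  set R := k + L with hR
  have hLpow : L < 2 ^ L := Nat.lt_two_pow_self
  have hkpow : k < 2 ^ k := Nat.lt_two_pow_self
  have hUR : (0 : ℝ) < U := by exact_mod_cast hU
  have hbR : (0 : ℝ) < b := by exact_mod_cast hb
  set τ : ℝ := a / b with hτ
  set β : ℝ := V / U with hβ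
  have hτ1 : 1 < τ := by
    rw [hτ, one_lt_div hbR]; exact_mod_cast hab
  have hτ2 : τ ≤ 1024 := by
    rw [hτ, div_le_iff₀ hbR]; exact_mod_cast ha
  have hβ1 : 1 ≤ β := by
    rw [hβ, one_le_div hUR]; exact_mod_cast hUV.le
  have hβ2 : β ^ l ≤ 1024 := by
    rw [hβ, div_pow, div_le_iff₀ (by positivity)]
    exact_mod_cast hV
  have hδ : |τ - β ^ l| ≤ 2048 / (U : ℝ) ^ l := by
    have h1 : τ - β ^ l = -(((b : ℝ) * V ^ l - a * U ^ l) / (b * U ^ l)) := by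
      rw [hτ, hβ, div_pow]
      field_simp
      ring
    have h2 : |(b : ℝ) * V ^ l - a * U ^ l| ≤ 2048 := by exact_mod_cast h
    rw [h1, abs_neg, abs_div, abs_of_pos (show (0 : ℝ) < b * U ^ l by positivity)]
    refine div_le_div₀ (by norm_num) h2 (by positivity) ?_
    exact le_mul_of_one_le_left (by positivity) (by exact_mod_cast hb)
  have hSl : S ≤ l := by
    refine le_trans ?_ hlL
    have : 2 * L ≤ 2 ^ L := by
      have := Nat.lt_two_pow_self (n := L - 1)
      have h2 : 2 ^ L = 2 * 2 ^ (L - 1) := by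
        rw [← pow_succ', Nat.sub_add_cancel (by omega)]
      omega
    rw [pow_add]
    omega
  have hsmall : (16 : ℝ) ^ (K * L) * (L * R * (2048 / (U : ℝ) ^ l)) ≤ 1 := by
    have h1 : L * R * 2048 ≤ 2 ^ (k * L) := by
      calc L * R * 2048 ≤ 2 ^ L * 2 ^ (k + 1) * 2 ^ 11 := by
            have : R ≤ 2 ^ (k + 1) := by rw [pow_succ]; omega
            exact Nat.mul_le_mul (Nat.mul_le_mul hLpow.le this) (by norm_num)
        _ = 2 ^ (L + (k + 1) + 11) := by rw [← pow_add, ← pow_add]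
        _ ≤ 2 ^ (k * L) := Nat.pow_le_pow_right (by norm_num) (by nlinarith)
    have h2 : 16 ^ (K * L) * (L * R * 2048) ≤ U ^ l := by
      calc 16 ^ (K * L) * (L * R * 2048) ≤ 2 ^ (4 * (K * L)) * 2 ^ (k * L) := by
            refine Nat.mul_le_mul (le_of_eq ?_) h1
            rw [pow_mul 2]; norm_num
        _ = 2 ^ (513 * L * k) := by rw [← pow_add]; congr 1; rw [hK]; ring
        _ ≤ 2 ^ (u * l) := Nat.pow_le_pow_right (by norm_num) hk1
        _ = (2 ^ u) ^ l := pow_mul _ _ _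
        _ ≤ U ^ l := Nat.pow_le_pow_left hUu l
    rw [← mul_div_assoc, ← mul_div_assoc, div_le_one (by positivity)]
    exact_mod_cast h2
  obtain ⟨c, hc, hdet⟩ := exists_interpolation_minor (l := l) (K := K) (L := L) (R := R) (R₂ := k)
    (S := S) hτ1 (by linarith : 0 < β) hSl le_rfl (by
      rw [hK, hS]
      calc L * (128 * k - 1) < L * (128 * k) :=
            Nat.mul_lt_mul_of_pos_left (by omega) (by omega)
        _ = k * (128 * L) := by ring)
  have hup := abs_interpolation_det_le (l := l) (K := K) (L := L) (R := R) (S := S)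
    (by linarith) hτ2 hβ1 hβ2 hδ hSl hsmall c
  have hlow := one_le_abs_interpolation_det (l := l) hb hU c hc hdet
  have hprod := prod_row_bound_le (K := K) (L := L) (M := 16 * l * R + K) (B := 2 ^ (L + 8))
    (e := 160 * R) (by omega) (by positivity) (by positivity) (by
      have h1 : 16 * l * R + K ≤ 2 ^ (L + 8) * (16 * k) := by
        have hp : 2 ^ (L + 8) = 2 * 2 ^ (L + 7) := by rw [← pow_succ']
        have hp1 : 2 ^ (L + 7) = 128 * 2 ^ L := by rw [pow_add]; ring
        have : l * R ≤ 2 ^ (L + 7) * (2 * k - L) := Nat.mul_le_mul hlL' (by omega)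
        have h3 : l * R ≤ 2 ^ (L + 7) * k + 2 ^ (L + 7) * L := by
          calc l * R ≤ 2 ^ (L + 7) * R := Nat.mul_le_mul_right _ hlL'
            _ = _ := by rw [hR]; ring
        have h4 : 15 * (2 ^ (L + 7) * L) ≤ 2 ^ (L + 7) * k := by
          calc 15 * (2 ^ (L + 7) * L) = 2 ^ (L + 7) * (15 * L) := by ring
            _ ≤ _ := Nat.mul_le_mul_left _ hkL
        have h5 : 128 * k ≤ 2 ^ (L + 7) * k := Nat.mul_le_mul_right _ (by omega)
        calc 16 * l * R + K = 16 * (l * R) + 128 * k := by rw [hK]; ring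
          _ ≤ 32 * (2 ^ (L + 7) * k) := by omega
          _ = _ := by rw [hp]; ring
      have h2 : ((2 : ℝ) ^ (L + 8)) * ((K : ℕ) / 8) = ((2 ^ (L + 8) * (16 * k) : ℕ) : ℝ) := by
        rw [hK]; push_cast; ring
      rw [h2]
      exact_mod_cast h1)
  have hfact : (((K * L).factorial : ℕ) : ℝ) ≤ 2 ^ (K * L * (k + L)) := by
    have h1 : K * L ≤ 2 ^ (k + L) := by
      have hk7 : 2 ^ k = 2 ^ 8 * 2 ^ (k - 8) := by rw [← pow_add]; congr 1; omega
      have h2 : 128 * k ≤ 2 ^ k := by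
        have := Nat.lt_two_pow_self (n := k - 8)
        rw [hk7]; omega
      rw [pow_add, hK]
      exact Nat.mul_le_mul h2 hLpow.le
    have h2 : (K * L).factorial ≤ 2 ^ (K * L * (k + L)) := by
      calc (K * L).factorial ≤ (K * L) ^ (K * L) := Nat.factorial_le_pow _
        _ ≤ (2 ^ (k + L)) ^ (K * L) := Nat.pow_le_pow_left h1 _
        _ = _ := by rw [← pow_mul]; congr 1; ring
    exact_mod_cast h2
  have hbpow : (b : ℝ) ^ (L * R * (K * L)) ≤ 2 ^ (3 * (L * R * (K * L))) := by
    rw [pow_mul 2]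
    exact pow_le_pow_left₀ hbR.le (by norm_num; exact_mod_cast hb8) _
  have hUpow : (U : ℝ) ^ ((L - 1) * (R * (S * (S - 1) / 2))) ≤
      2 ^ ((u + 1) * ((L - 1) * (R * (S * (S - 1) / 2)))) := by
    rw [pow_mul 2]
    exact pow_le_pow_left₀ hUR.le (by exact_mod_cast hUu') _
  set N := K * L with hN
  have hfinal : (2 : ℝ) ^ (4 * (N * (N - 1) / 2)) ≤
      2 ^ (N * (k + L)) * (2 ^ N * (((2 : ℝ) ^ (L + 8)) ^ (K * (K - 1) / 2)) ^ L *
        (2 : ℝ) ^ (160 * R * (L * (L - 1) / 2) * K)) *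
      (2 ^ (3 * (L * R * N)) * 2 ^ ((u + 1) * ((L - 1) * (R * (S * (S - 1) / 2))))) := by
    have h16 : (16 : ℝ) ^ (N * (N - 1) / 2) = 2 ^ (4 * (N * (N - 1) / 2)) := by
      rw [pow_mul 2]; norm_num
    rw [← h16]
    calc (16 : ℝ) ^ (N * (N - 1) / 2) ≤ _ :=
          le_mul_of_one_le_right (by positivity) hlow
      _ = _ := (mul_assoc _ _ _).symm
      _ ≤ _ := by
          refine mul_le_mul ?_ (mul_le_mul hbpow hUpow (by positivity) (by positivity))
            (by positivity) (by positivity)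
          rw [mul_comm]
          exact hup.trans (mul_le_mul hfact hprod (by positivity) (by positivity))
  simp only [← pow_mul, ← pow_add] at hfinal
  have hle := (pow_le_pow_iff_right₀ (by norm_num : (1 : ℝ) < 2)).1 hfinal
  have htri : ∀ m : ℕ, 2 * (m * (m - 1) / 2) = m * (m - 1) := fun m =>
    Nat.mul_div_cancel' (Nat.even_mul_pred_self m).two_dvd
  have hT : K * (K - 1) / 2 ≤ 64 * k * (128 * k) := by
    have := htri K
    have h2 : K * (K - 1) ≤ K * K := Nat.mul_le_mul_left _ (Nat.sub_le _ _)
    have h3 : K * K = 2 * (64 * k * (128 * k)) := by rw [hK]; ring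
    omega
  have hS2 : S * (S - 1) / 2 ≤ 8192 * L ^ 2 := by
    have := htri S
    have h2 : S * (S - 1) ≤ S * S := Nat.mul_le_mul_left _ (Nat.sub_le _ _)
    have h3 : S * S = 2 * (8192 * L ^ 2) := by rw [hS]; ring
    omega
  have e1 : (L + 8) * (K * (K - 1) / 2) * L ≤ (L + 8) * (64 * k * (128 * k)) * L :=
    Nat.mul_le_mul_right _ (Nat.mul_le_mul_left _ hT)
  have e2 : (u + 1) * ((L - 1) * (R * (S * (S - 1) / 2))) ≤
      (u + 1) * ((L - 1) * (R * (8192 * L ^ 2))) :=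
    Nat.mul_le_mul_left _ (Nat.mul_le_mul_left _ (Nat.mul_le_mul_left _ hS2))
  have e3 : 160 * R * (L * (L - 1) / 2) * K = 80 * R * L * (L - 1) * K := by
    calc 160 * R * (L * (L - 1) / 2) * K = 80 * R * (2 * (L * (L - 1) / 2)) * K := by ring
      _ = _ := by rw [htri]; ring
  have e4 : 4 * (N * (N - 1) / 2) = 2 * (N * (N - 1)) := by
    have := htri N
    omega
  rw [e3, e4, ← hR] at hle
  rw [← hK] at e1
  omega

end TwoLogs

/-! ### Sums of five consecutive cubes -/

namespace FiveCubes

/-- Splitting `5 z (z ^ 2 + 6) = y ^ l` into the two almost coprime factors. -/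
theorem exists_factorization {l z y : ℕ} (hl : 2 ≤ l) (hz : 0 < z) (h : 5 * z * (z ^ 2 + 6) = y ^ l) :
    ∃ a b c u v : ℕ, a ≤ 1 ∧ b ≤ 1 ∧ c ≤ 1 ∧
      z = 2 ^ (a * (l - 1)) * 3 ^ (b * (l - 1)) * 5 ^ (c * (l - 1)) * u ^ l ∧
      z ^ 2 + 6 = 2 ^ a * 3 ^ b * 5 ^ ((1 - c) * (l - 1)) * v ^ l := by
  obtain ⟨a, ha, ha0, ha1⟩ : ∃ a, a ≤ 1 ∧ (a = 0 → ¬ 2 ∣ z) ∧ (a = 1 → 2 ∣ z) := by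
    by_cases hd : 2 ∣ z
    · exact ⟨1, le_rfl, by simp, fun _ => hd⟩
    · exact ⟨0, by simp, fun _ => hd, by simp⟩
  obtain ⟨b, hb, hb0, hb1⟩ : ∃ b, b ≤ 1 ∧ (b = 0 → ¬ 3 ∣ z) ∧ (b = 1 → 3 ∣ z) := by
    by_cases hd : 3 ∣ z
    · exact ⟨1, le_rfl, by simp, fun _ => hd⟩
    · exact ⟨0, by simp, fun _ => hd, by simp⟩
  have hsplit : ∃ w, z ^ 2 + 6 = 2 ^ a * 3 ^ b * w ∧ Nat.Coprime w z ∧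
      Nat.Coprime w (2 ^ a * 3 ^ b) := by
    have hmod : ∃ w, z ^ 2 + 6 = 2 ^ a * 3 ^ b * w ∧ ((2 ∣ z ∨ a = 1) → ¬ 2 ∣ w) ∧
        ((3 ∣ z ∨ b = 1) → ¬ 3 ∣ w) := by
      interval_cases a <;> interval_cases b <;> simp only [forall_const, zero_ne_one,
        one_ne_zero, false_implies, or_false, or_true, pow_zero, pow_one, one_mul, mul_one] at *
      · exact ⟨_, rfl, fun h => absurd h ha0, fun h => absurd h hb0⟩
      · obtain ⟨t, rfl⟩ := hb1
        refine ⟨3 * t ^ 2 + 2, by ring, fun h => absurd h ha0, ?_⟩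
        omega
      · obtain ⟨t, rfl⟩ := ha1
        refine ⟨2 * t ^ 2 + 3, by ring, ?_, fun h => absurd h hb0⟩
        omega
      · obtain ⟨t, rfl⟩ := (Nat.Coprime.mul_dvd_of_dvd_of_dvd (by norm_num) ha1 hb1 : 2 * 3 ∣ z)
        refine ⟨6 * t ^ 2 + 1, by ring, ?_, ?_⟩ <;> omega
    obtain ⟨w, hw, h2, h3⟩ := hmod
    have hprime : ∀ p, p.Prime → p ∣ w → p ∣ z → False := by
      intro p hp hpw hpz
      have h6 : p ∣ 6 := by
        have h1 : p ∣ z ^ 2 + 6 := hw ▸ hpw.mul_left _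
        exact (Nat.dvd_add_right (hpz.pow (by norm_num))).1 h1
      have : p = 2 ∨ p = 3 := by
        have h23 : p ∣ 2 * 3 := h6
        rcases hp.dvd_mul.1 h23 with h | h
        · exact Or.inl ((Nat.prime_dvd_prime_iff_eq hp Nat.prime_two).1 h)
        · exact Or.inr ((Nat.prime_dvd_prime_iff_eq hp Nat.prime_three).1 h)
      rcases this with rfl | rfl
      · exact h2 (Or.inl hpz) hpw
      · exact h3 (Or.inl hpz) hpw
    refine ⟨w, hw, Nat.Coprime.symm (Nat.coprime_of_dvd fun p hp h h' => hprime p hp h' h), ?_⟩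
    refine Nat.Coprime.mul_right ?_ ?_
    · rcases Nat.le_one_iff_eq_zero_or_eq_one.1 ha with rfl | rfl
      · simp
      · exact ((Nat.Prime.coprime_iff_not_dvd Nat.prime_two).2 (h2 (Or.inr rfl))).symm.pow_right 1
    · rcases Nat.le_one_iff_eq_zero_or_eq_one.1 hb with rfl | rfl
      · simp
      · exact ((Nat.Prime.coprime_iff_not_dvd Nat.prime_three).2 (h3 (Or.inr rfl))).symm.pow_right 1
  obtain ⟨w, hw, hwz, hwg⟩ := hsplit
  have hl0 : l ≠ 0 := by omega
  have hroot : ∀ {m n : ℕ}, m.Coprime n → m * n = y ^ l → (∃ t, m = t ^ l) ∧ ∃ t, n = t ^ l := by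
    intro m n hmn hmul
    refine ⟨exists_eq_pow_of_mul_eq_pow (Nat.isUnit_iff.2 hmn) hmul,
      exists_eq_pow_of_mul_eq_pow (Nat.isUnit_iff.2 hmn.symm) ((mul_comm n m).trans hmul)⟩
  have hextract : ∀ {g m t : ℕ}, 0 < g → Squarefree g → g * m = t ^ l →
      ∃ u, m = g ^ (l - 1) * u ^ l := by
    intro g m t hg hsq hgm
    obtain ⟨u, rfl⟩ := (hsq.dvd_pow_iff_dvd hl0).1 ⟨m, hgm.symm⟩
    refine ⟨u, Nat.eq_of_mul_eq_mul_left hg ?_⟩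
    rw [hgm, mul_pow, ← mul_assoc, ← pow_succ', Nat.sub_add_cancel (by omega)]
  have hsq5 : ∀ c, c ≤ 1 → Squarefree (2 ^ a * 3 ^ b * 5 ^ c) := by
    have h30 : Squarefree 30 := by
      rw [show 30 = 2 * (3 * 5) by norm_num, Nat.squarefree_mul (by norm_num),
        Nat.squarefree_mul (by norm_num)]
      exact ⟨Nat.prime_two.prime.squarefree, Nat.prime_three.prime.squarefree,
        Nat.prime_five.prime.squarefree⟩
    intro c hc
    refine h30.squarefree_of_dvd ?_
    interval_cases a <;> interval_cases b <;> interval_cases c <;> norm_num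
  have hform : ∀ c u, (2 ^ a * 3 ^ b * 5 ^ c) ^ (l - 1) * u ^ l =
      2 ^ (a * (l - 1)) * 3 ^ (b * (l - 1)) * 5 ^ (c * (l - 1)) * u ^ l := by
    intro c u
    rw [mul_pow, mul_pow, pow_mul, pow_mul, pow_mul]
  rw [hw] at h
  by_cases h5 : 5 ∣ z
  · have h5w : Nat.Coprime 5 w := Nat.Coprime.coprime_dvd_left h5 hwz.symm
    obtain ⟨⟨t, ht⟩, v, hv⟩ := hroot (m := 2 ^ a * 3 ^ b * 5 ^ 1 * z) (n := w)
      (Nat.Coprime.mul_left (Nat.Coprime.mul_left hwg.symm (by simpa using h5w)) hwz.symm)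
      (by rw [← h]; ring)
    obtain ⟨u, hu⟩ := hextract (by positivity) (hsq5 1 le_rfl) ht
    exact ⟨a, b, 1, u, v, ha, hb, le_rfl, hu.trans (hform 1 u), by simp [hw, hv]⟩
  · have h5z : Nat.Coprime 5 z := (Nat.Prime.coprime_iff_not_dvd Nat.prime_five).2 h5
    have h5g : Nat.Coprime (2 ^ a * 3 ^ b) 5 :=
      Nat.Coprime.mul_left (Nat.Coprime.pow_left _ (by norm_num))
        (Nat.Coprime.pow_left _ (by norm_num))
    obtain ⟨⟨t, ht⟩, s, hs⟩ := hroot (m := 2 ^ a * 3 ^ b * 5 ^ 0 * z) (n := 5 * w)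
      (by
        rw [pow_zero, mul_one]
        exact Nat.Coprime.mul_left (Nat.Coprime.mul_right h5g hwg.symm)
          (Nat.Coprime.mul_right h5z.symm hwz.symm))
      (by rw [← h]; ring)
    obtain ⟨u, hu⟩ := hextract (by positivity) (hsq5 0 (by simp)) ht
    obtain ⟨v, hv⟩ := hextract (by norm_num) Nat.prime_five.prime.squarefree hs
    exact ⟨a, b, 0, u, v, ha, hb, by simp, hu.trans (hform 0 u), by simp [hw, hv, mul_assoc]⟩

theorem false_of_close_powers_of_add_eq {l a b U V r : ℕ} (hl : 2 ^ 16 ≤ l) (hb : 0 < b)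
    (hb8 : b ≤ 8) (hab : b < a) (ha : a ≤ 1024 * b) (hU : 2 ≤ U) (hr : r ≤ 2048)
    (h : b * V ^ l + r = a * U ^ l) : False := by
  have hpow : 2048 < U ^ l := by
    calc 2048 < 2 ^ 16 := by norm_num
      _ ≤ 2 ^ l := Nat.pow_le_pow_right (by norm_num) (by omega)
      _ ≤ U ^ l := Nat.pow_le_pow_left hU l
  refine TwoLogs.false_of_close_powers hl hb hb8 hab ha (U := U) (V := V) (by omega) ?_ ?_ ?_
  · by_contra! hle
    have h1 : b * V ^ l ≤ b * U ^ l := Nat.mul_le_mul_left _ (Nat.pow_le_pow_left hle l)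
    have h2 : (b + 1) * U ^ l ≤ a * U ^ l := Nat.mul_le_mul_right _ hab
    rw [add_mul] at h2
    omega
  · refine le_of_mul_le_mul_left ?_ hb
    calc b * V ^ l ≤ a * U ^ l := by omega
      _ ≤ 1024 * b * U ^ l := Nat.mul_le_mul_right _ ha
      _ = _ := by ring
  · have h1 : (b : ℤ) * V ^ l - a * U ^ l = -(r : ℤ) := by
      have : (b : ℤ) * V ^ l + r = a * U ^ l := by exact_mod_cast h
      linarith
    rw [h1, abs_neg, Nat.abs_cast]
    exact_mod_cast hr

/-- For large exponents, only the case `30 ∣ z` of the factorization can occur. -/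
theorem false_of_large_exponent {l a b c u v z : ℕ} (hl : 2 ^ 16 ≤ l) (ha : a ≤ 1) (hb : b ≤ 1)
    (hc : c ≤ 1) (habc : ¬(a = 1 ∧ b = 1 ∧ c = 1)) (hz4 : 4 ≤ z)
    (hz : z = 2 ^ (a * (l - 1)) * 3 ^ (b * (l - 1)) * 5 ^ (c * (l - 1)) * u ^ l)
    (hz6 : z ^ 2 + 6 = 2 ^ a * 3 ^ b * 5 ^ ((1 - c) * (l - 1)) * v ^ l) : False := by
  have hl0 : l ≠ 0 := by omega
  obtain ⟨g, hg, hg6, hgc⟩ : ∃ g, g = 2 ^ a * 3 ^ b ∧ (g = 1 ∨ g = 2 ∨ g = 3 ∨ g = 6) ∧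
      (g = 6 → c = 0) := by
    refine ⟨_, rfl, ?_, ?_⟩ <;> interval_cases a <;> interval_cases b <;> norm_num
    all_goals try omega
  have hu : u ≠ 0 := by
    rintro rfl
    simp [hl0] at hz
    omega
  have hv : v ≠ 0 := by
    rintro rfl
    simp [hl0] at hz6
  have hpow : ∀ n : ℕ, n * n ^ (l - 1) = n ^ l := fun n => by
    rw [← pow_succ', Nat.sub_add_cancel (by omega)]
  have hzg : z = g ^ (l - 1) * 5 ^ (c * (l - 1)) * u ^ l := by
    rw [hz, hg, mul_pow, pow_mul, pow_mul]
  rw [← hg] at hz6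
  have hgz : g * z = g ^ l * 5 ^ (c * (l - 1)) * u ^ l := by
    rw [hzg, ← hpow g]; ring
  rcases Nat.le_one_iff_eq_zero_or_eq_one.1 hc with rfl | rfl
  · have key : 5 * (g ^ 2 * u ^ 2) ^ l + 30 * g ^ 2 = g ^ 3 * (5 * v) ^ l := by
      calc 5 * (g ^ 2 * u ^ 2) ^ l + 30 * g ^ 2
          = 5 * (g ^ l * 5 ^ (0 * (l - 1)) * u ^ l) ^ 2 + 30 * g ^ 2 := by
            rw [mul_pow (g ^ 2), ← pow_mul, ← pow_mul, mul_comm 2 l]; ring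
        _ = 5 * g ^ 2 * (z ^ 2 + 6) := by rw [← hgz]; ring
        _ = g ^ 3 * (5 * 5 ^ (l - 1)) * v ^ l := by rw [hz6]; simp only [Nat.sub_zero, one_mul]; ring
        _ = _ := by rw [hpow, mul_pow]; ring
    have h5v : 2 ≤ 5 * v := by omega
    rcases hg6 with h | h | h | h <;> rw [h] at key
    · have hu1 : 0 < u ^ 2 := by positivity
      have hul : 1 ≤ (u ^ 2) ^ l := Nat.one_le_pow _ _ hu1
      have key' : 5 * (u ^ 2) ^ l + 30 = (5 * v) ^ l := by simpa using key
      refine TwoLogs.false_of_close_powers (a := 5) (b := 1) (U := u ^ 2) (V := 5 * v) hl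
        (by norm_num) (by norm_num) (by norm_num) (by norm_num) hu1 ?_ (by omega) ?_
      · refine lt_of_pow_lt_pow_left₀ l (Nat.zero_le _) ?_
        omega
      · have : (5 : ℤ) * (u ^ 2) ^ l + 30 = (5 * v) ^ l := by exact_mod_cast key'
        push_cast
        rw [← this]
        ring_nf
        norm_num
    · exact false_of_close_powers_of_add_eq hl (by norm_num) (by norm_num) (by norm_num)
        (by norm_num) h5v (by norm_num) key
    · exact false_of_close_powers_of_add_eq hl (by norm_num) (by norm_num) (by norm_num)
        (by norm_num) h5v (by norm_num) key
    · exact false_of_close_powers_of_add_eq hl (by norm_num) (by norm_num) (by norm_num)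
        (by norm_num) h5v (by norm_num) key
  · have hg6' : g = 1 ∨ g = 2 ∨ g = 3 := by omega
    have hv2 : 2 ≤ v := by
      by_contra! hlt
      have : v = 1 := by omega
      rw [this] at hz6
      simp only [Nat.sub_self, zero_mul, pow_zero, mul_one, one_pow] at hz6
      have : 0 < z ^ 2 := by positivity
      omega
    have key : 1 * (25 * g ^ 2 * u ^ 2) ^ l + 150 * g ^ 2 = 25 * g ^ 3 * v ^ l := by
      calc 1 * (25 * g ^ 2 * u ^ 2) ^ l + 150 * g ^ 2
          = (g ^ l * (5 * 5 ^ (l - 1)) * u ^ l) ^ 2 + 150 * g ^ 2 := by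
            rw [hpow, mul_pow, mul_pow, show 25 = 5 ^ 2 by norm_num, ← pow_mul, ← pow_mul,
              ← pow_mul, mul_comm 2 l]; ring
        _ = 25 * (g ^ l * 5 ^ (1 * (l - 1)) * u ^ l) ^ 2 + 150 * g ^ 2 := by rw [one_mul]; ring
        _ = 25 * g ^ 2 * (z ^ 2 + 6) := by rw [← hgz]; ring
        _ = _ := by rw [hz6]; simp only [Nat.sub_self, zero_mul, pow_zero, mul_one]; ring
    rcases hg6' with h | h | h <;> rw [h] at key <;>
    exact false_of_close_powers_of_add_eq hl (by norm_num) (by norm_num) (by norm_num)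
        (by norm_num) hv2 (by norm_num) key

theorem false_of_locallyInsoluble {l a b c u v z : ℕ} (h : CubeSieve.LocallyInsoluble l a b c)
    (hz : z = 2 ^ (a * (l - 1)) * 3 ^ (b * (l - 1)) * 5 ^ (c * (l - 1)) * u ^ l)
    (hz6 : z ^ 2 + 6 = 2 ^ a * 3 ^ b * 5 ^ ((1 - c) * (l - 1)) * v ^ l) : False := by
  obtain ⟨q, hq⟩ := h
  refine hq u v ?_
  have h1 : 4 ^ (a * (l - 1)) * 9 ^ (b * (l - 1)) * 25 ^ (c * (l - 1)) * u ^ (2 * l) + 6 =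
      2 ^ a * 3 ^ b * 5 ^ ((1 - c) * (l - 1)) * v ^ l := by
    rw [← hz6, hz, show 4 = 2 ^ 2 by norm_num, show 9 = 3 ^ 2 by norm_num,
      show 25 = 5 ^ 2 by norm_num, ← pow_mul, ← pow_mul, ← pow_mul]
    ring
  exact_mod_cast congrArg (Nat.cast : ℕ → ZMod q) h1

end FiveCubes

namespace FiveCubes

open Zsqrtd

/-- A short vector in the lattice `B ≡ w A (mod v)`. -/
theorem exists_small_congruent {v : ℕ} (hv : 0 < v) (w : ℤ) :
    ∃ A B : ℤ, ((v : ℤ) ∣ B - w * A) ∧ (A ≠ 0 ∨ B ≠ 0) ∧ A ^ 2 + 6 * B ^ 2 < 5 * v := by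
  have : NeZero v := ⟨hv.ne'⟩
  set X := Nat.sqrt (5 * v / 2) with hX
  set Y := Nat.sqrt (2 * v / 5) with hY
  have hX1 : X * X ≤ 5 * v / 2 := Nat.sqrt_le _
  have hY1 : Y * Y ≤ 2 * v / 5 := Nat.sqrt_le _
  have hX2 : 5 * v / 2 < (X + 1) * (X + 1) := Nat.lt_succ_sqrt _
  have hY2 : 2 * v / 5 < (Y + 1) * (Y + 1) := Nat.lt_succ_sqrt _
  have hcard : v < (X + 1) * (Y + 1) := by
    have h1 : 5 * v < 2 * ((X + 1) * (X + 1)) := by omega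
    have h2 : 2 * v < 5 * ((Y + 1) * (Y + 1)) := by omega
    by_contra! hle
    have h3 : ((X + 1) * (Y + 1)) * ((X + 1) * (Y + 1)) ≤ v * v := Nat.mul_le_mul hle hle
    have h4 := Nat.mul_lt_mul'' h1 h2
    nlinarith
  obtain ⟨p, hp, q, hq, hne, heq⟩ := Finset.exists_ne_map_eq_of_card_lt_of_maps_to
    (s := Finset.range (X + 1) ×ˢ Finset.range (Y + 1)) (t := (Finset.univ : Finset (ZMod v)))
    (f := fun p => ((p.2 : ZMod v) - (w : ZMod v) * p.1)) (by simpa using hcard)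
    (fun _ _ => Finset.mem_coe.2 (Finset.mem_univ _))
  simp only [Finset.mem_product, Finset.mem_range] at hp hq
  refine ⟨(p.1 : ℤ) - q.1, (p.2 : ℤ) - q.2, ?_, ?_, ?_⟩
  · rw [← ZMod.intCast_zmod_eq_zero_iff_dvd]
    push_cast
    linear_combination heq
  · by_contra! hcon
    exact hne (Prod.ext (by omega) (by omega))
  · have h1 : ((p.1 : ℤ) - q.1) ^ 2 ≤ (X : ℤ) ^ 2 := sq_le_sq' (by omega) (by omega)
    have h2 : ((p.2 : ℤ) - q.2) ^ 2 ≤ (Y : ℤ) ^ 2 := sq_le_sq' (by omega) (by omega)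
    have h3 : (2 * (X : ℤ) ^ 2) ≤ 5 * v := by
      have : 2 * (X * X) ≤ 5 * v := by omega
      rw [sq]; exact_mod_cast this
    have h4 : (5 * (Y : ℤ) ^ 2) ≤ 2 * v := by
      have : 5 * (Y * Y) ≤ 2 * v := by omega
      rw [sq]; exact_mod_cast this
    have : (0 : ℤ) < v := by exact_mod_cast hv
    linarith

/-- Reduction of binary forms of discriminant `-24`. -/
theorem exists_norm_eq_or_eq_two_mul {v : ℕ} {w : ℤ} (hv : Odd v) (hw : (v : ℤ) ∣ 6 * w ^ 2 + 1) :
    ∃ A B : ℤ, ((v : ℤ) ∣ B - w * A) ∧ (A ^ 2 + 6 * B ^ 2 = v ∨ A ^ 2 + 6 * B ^ 2 = 2 * v) := by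
  have hv0 : 0 < v := hv.pos
  have hvZ : (0 : ℤ) < v := by exact_mod_cast hv0
  obtain ⟨A, B, hAB, hne, hlt⟩ := exists_small_congruent hv0 w
  obtain ⟨m, hm⟩ := hAB
  obtain ⟨n, hn⟩ := hw
  have hB : B = w * A + v * m := by linarith
  have hk : A ^ 2 + 6 * B ^ 2 = v * (n * A ^ 2 + 12 * w * A * m + 6 * v * m ^ 2) := by
    rw [hB]; linear_combination A ^ 2 * hn
  set k := n * A ^ 2 + 12 * w * A * m + 6 * v * m ^ 2
  have hpos : 0 < A ^ 2 + 6 * B ^ 2 := by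
    rcases hne with h | h <;> positivity
  have hk1 : 0 < k := by
    rw [hk] at hpos; exact pos_of_mul_pos_right hpos hvZ.le
  have hk5 : k < 5 := by
    rw [hk, mul_comm] at hlt
    exact lt_of_mul_lt_mul_right hlt hvZ.le
  interval_cases k
  · exact ⟨A, B, ⟨m, hm⟩, Or.inl (by linarith)⟩
  · exact ⟨A, B, ⟨m, hm⟩, Or.inr (by linarith)⟩
  · obtain ⟨C, rfl⟩ : (3 : ℤ) ∣ A := by
      refine Int.Prime.dvd_pow' Nat.prime_three (k := 2) ?_
      exact ⟨v - 2 * B ^ 2, by push_cast; linarith⟩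
    refine ⟨-2 * B, C, ⟨C * n + 2 * w * m, ?_⟩, Or.inr (by nlinarith)⟩
    linear_combination 2 * w * hm + C * hn
  · obtain ⟨C, rfl⟩ : (2 : ℤ) ∣ A := by
      refine Int.Prime.dvd_pow' Nat.prime_two (k := 2) ?_
      exact ⟨2 * v - 3 * B ^ 2, by push_cast; linarith⟩
    obtain ⟨D, rfl⟩ : (2 : ℤ) ∣ B := by
      refine Int.Prime.dvd_pow' Nat.prime_two (k := 2) ?_
      refine ⟨v - C ^ 2 - B ^ 2, by push_cast; linarith⟩
    refine ⟨C, D, ?_, Or.inl (by linarith)⟩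
    have h2 : IsCoprime (v : ℤ) 2 := by
      have := Nat.isCoprime_iff_coprime.2 hv.coprime_two_right
      exact_mod_cast this
    exact h2.dvd_of_dvd_mul_left ⟨m, by linarith⟩

theorem sq_add_six_mul_sq_ne_two_pow (n : ℕ) (x y : ℤ) : x ^ 2 + 6 * y ^ 2 ≠ 2 ^ (2 * n + 1) := by
  induction n generalizing x y with
  | zero =>
    intro h
    rcases eq_or_ne y 0 with rfl | hy
    · have h1 : x ^ 2 = 2 := by simpa using h
      have hx : x < 2 := by nlinarith
      have hx' : -2 < x := by nlinarith
      interval_cases x <;> omega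
    · have : 0 < y ^ 2 := by positivity
      rw [mul_zero, zero_add, pow_one] at h
      nlinarith [sq_nonneg x]
  | succ n ih =>
    intro h
    rw [show 2 * (n + 1) + 1 = 2 * n + 1 + 2 by ring, pow_add] at h
    obtain ⟨C, rfl⟩ : (2 : ℤ) ∣ x := by
      refine Int.Prime.dvd_pow' Nat.prime_two (k := 2) ?_
      exact ⟨2 ^ (2 * n + 1) * 2 - 3 * y ^ 2, by push_cast; linarith⟩
    obtain ⟨D, rfl⟩ : (2 : ℤ) ∣ y := by
      refine Int.Prime.dvd_pow' Nat.prime_two (k := 2) ?_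
      exact ⟨2 ^ (2 * n + 1) - C ^ 2 - y ^ 2, by push_cast; linarith⟩
    exact ih C D (by linarith)

theorem eq_zero_of_mul_eq_zero {x y : ℤ√(-6)} (h : x * y = 0) (hx : x ≠ 0) : y = 0 := by
  have hnorm := congrArg Zsqrtd.norm h
  rw [Zsqrtd.norm_mul, Zsqrtd.norm_zero, mul_eq_zero, Zsqrtd.norm_eq_zero_iff (by norm_num),
    Zsqrtd.norm_eq_zero_iff (by norm_num)] at hnorm
  exact hnorm.resolve_left hx

theorem exists_mul_eq_pow {l v : ℕ} {w : ℤ} (hl : Odd l) (hw : 6 * w ^ 2 + 1 = (v : ℤ) ^ l) :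
    ∃ β κ : ℤ√(-6), κ * ⟨1, w⟩ = β ^ l ∧ κ.norm = 1 := by
  have hl0 : l ≠ 0 := hl.pos.ne'
  have hvodd : Odd v := by
    have : Odd ((v : ℤ) ^ l) := ⟨3 * w ^ 2, by rw [← hw]; ring⟩
    have := (Int.odd_pow' hl0).1 this
    exact_mod_cast this
  obtain ⟨A, B, ⟨m, hm⟩, hN⟩ := exists_norm_eq_or_eq_two_mul hvodd
    (w := w) (hw ▸ dvd_pow_self _ hl0)
  obtain ⟨n, hn⟩ : (v : ℤ) ∣ 6 * w ^ 2 + 1 := hw ▸ dvd_pow_self _ hl0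
  set α : ℤ√(-6) := ⟨1, w⟩ with hα
  set β : ℤ√(-6) := ⟨A, B⟩ with hβ
  have hαnorm : α * star α = (v : ℤ√(-6)) ^ l := by
    have h1 : α * star α = ((6 * w ^ 2 + 1 : ℤ) : ℤ√(-6)) := by
      ext <;> simp [hα, pow_two]
      ring
    rw [h1, hw]; push_cast; rfl
  have hβnorm : β * star β = ((A ^ 2 + 6 * B ^ 2 : ℤ) : ℤ√(-6)) := by
    ext <;> simp [hβ, pow_two] <;> ring
  have hαα : IsCoprime α (star α) := by
    obtain ⟨j, hj⟩ : Odd ((v : ℤ) ^ l) := ⟨3 * w ^ 2, by rw [← hw]; ring⟩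
    refine ⟨star α - (j : ℤ√(-6)), -(j : ℤ√(-6)), ?_⟩
    have h1 : α + star α = 2 := by ext <;> simp [hα]
    have h2 : (v : ℤ√(-6)) ^ l = 2 * j + 1 := by
      have := congrArg (Int.cast : ℤ → ℤ√(-6)) hj
      push_cast at this; exact this
    linear_combination hαnorm + h2 - (j : ℤ√(-6)) * h1
  have hα2 : IsCoprime α 2 := by
    obtain ⟨j, hj⟩ : Odd ((v : ℤ) ^ l) := ⟨3 * w ^ 2, by rw [← hw]; ring⟩
    refine ⟨star α, -(j : ℤ√(-6)), ?_⟩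
    have h2 : (v : ℤ√(-6)) ^ l = 2 * j + 1 := by
      have := congrArg (Int.cast : ℤ → ℤ√(-6)) hj
      push_cast at this; exact this
    linear_combination hαnorm + h2
  have hvdvd : α * star β = (v : ℤ√(-6)) * ⟨A * n + 6 * w * m, -m⟩ := by
    have : (v : ℤ√(-6)) = ((v : ℤ) : ℤ√(-6)) := by push_cast; rfl
    rw [this]
    ext
    · simp [hα, hβ]; linear_combination A * hn + 6 * w * hm
    · simp [hα, hβ]; linear_combination -hm
  have hvpos : v ≠ 0 := hvodd.pos.ne'
  have hβ0 : β ≠ 0 := by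
    intro h0
    have : A ^ 2 + 6 * B ^ 2 = 0 := by
      have h1 : A = 0 := congrArg Zsqrtd.re h0
      have h2 : B = 0 := congrArg Zsqrtd.im h0
      rw [h1, h2]; ring
    rcases hN with h | h <;> omega
  have hstar0 : star β ≠ 0 := by
    intro h0; apply hβ0; rw [← star_star β, h0, star_zero]
  have hdvd : β ∣ 2 * α := by
    rcases hN with h | h
    · refine ⟨2 * ⟨A * n + 6 * w * m, -m⟩, ?_⟩
      have h1 : star β * (2 * α - β * (2 * ⟨A * n + 6 * w * m, -m⟩)) = 0 := by
        rw [h] at hβnorm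
        push_cast at hβnorm
        linear_combination 2 * hvdvd - 2 * (⟨A * n + 6 * w * m, -m⟩ : ℤ√(-6)) * hβnorm
      exact sub_eq_zero.1 (eq_zero_of_mul_eq_zero h1 hstar0)
    · refine ⟨⟨A * n + 6 * w * m, -m⟩, ?_⟩
      have h1 : star β * (2 * α - β * (⟨A * n + 6 * w * m, -m⟩)) = 0 := by
        rw [h] at hβnorm
        push_cast at hβnorm
        linear_combination 2 * hvdvd - (⟨A * n + 6 * w * m, -m⟩ : ℤ√(-6)) * hβnorm
      exact sub_eq_zero.1 (eq_zero_of_mul_eq_zero h1 hstar0)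
  have hcop : IsCoprime α (star β) := by
    have h1 : IsCoprime α (2 * star α) := hα2.mul_right hαα
    refine h1.of_isCoprime_of_dvd_right ?_
    obtain ⟨d, hd⟩ := hdvd
    refine ⟨star d, ?_⟩
    have := congrArg star hd
    rw [star_mul', star_mul'] at this
    rw [← this]
    congr 1
  have hαdvd : α ∣ β ^ l := by
    refine (hcop.pow_right (n := l)).dvd_of_dvd_mul_right ?_
    rw [← mul_pow, hβnorm]
    have hdv : α ∣ (v : ℤ√(-6)) ^ l := ⟨star α, hαnorm.symm⟩
    refine hdv.trans (pow_dvd_pow_of_dvd ?_ l)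
    rcases hN with h | h <;> rw [h]
    · exact ⟨1, by push_cast; ring⟩
    · exact ⟨2, by push_cast; ring⟩
  obtain ⟨κ, hκ⟩ := hαdvd
  refine ⟨β, κ, by rw [hκ, mul_comm], ?_⟩
  have hnorm := congrArg Zsqrtd.norm hκ
  have hnα : α.norm = (v : ℤ) ^ l := by
    rw [← hw]; simp [Zsqrtd.norm_def, hα]; ring
  have hnβ : β.norm = A ^ 2 + 6 * B ^ 2 := by
    simp [Zsqrtd.norm_def, hβ]; ring
  have hpow : (β ^ l).norm = β.norm ^ l := map_pow (Zsqrtd.normMonoidHom) β l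
  rw [hpow, hnβ, Zsqrtd.norm_mul, hnα] at hnorm
  have hvl : ((v : ℤ) ^ l) ≠ 0 := by positivity
  rcases hN with h | h
  · rw [h] at hnorm
    exact (mul_left_cancel₀ hvl (by rw [mul_one]; exact hnorm)).symm
  · exfalso
    rw [h, mul_pow, mul_comm] at hnorm
    have h2 : κ.norm = 2 ^ l := (mul_left_cancel₀ hvl hnorm).symm
    obtain ⟨j, hj⟩ := hl
    refine sq_add_six_mul_sq_ne_two_pow j κ.re κ.im ?_
    rw [← hj, ← h2, Zsqrtd.norm_def]; ring

/-- The elements `1 + 3 N B² c + N B d √-6` with `c ≡ d ≡ k (mod 2)`. -/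
def IsNearOne (N B : ℤ) (k : ℤ) (x : ℤ√(-6)) : Prop :=
  ∃ c d : ℤ, x = ⟨1 + 3 * N * B ^ 2 * c, N * B * d⟩ ∧ Even (c - k) ∧ Even (d - k)

theorem IsNearOne.mul {N B k k' : ℤ} (hN : Even N) {x y : ℤ√(-6)} (hx : IsNearOne N B k x)
    (hy : IsNearOne N B k' y) : IsNearOne N B (k + k') (x * y) := by
  obtain ⟨c, d, rfl, hc, hd⟩ := hx
  obtain ⟨c', d', rfl, hc', hd'⟩ := hy
  refine ⟨c + c' + 3 * N * B ^ 2 * c * c' - 2 * N * d * d',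
    d + d' + 3 * N * B ^ 2 * (c * d' + c' * d), ?_, ?_, ?_⟩
  · ext <;> simp <;> ring
  · obtain ⟨n, rfl⟩ := hN
    obtain ⟨i, hi⟩ := hc
    obtain ⟨j, hj⟩ := hc'
    exact ⟨i + j + 3 * n * B ^ 2 * c * c' - 2 * n * d * d', by linear_combination hi + hj⟩
  · obtain ⟨n, rfl⟩ := hN
    obtain ⟨i, hi⟩ := hd
    obtain ⟨j, hj⟩ := hd'
    exact ⟨i + j + 3 * n * B ^ 2 * (c * d' + c' * d), by linear_combination hi + hj⟩

theorem IsNearOne.pow {N B : ℤ} (hN : Even N) {x : ℤ√(-6)} (hx : IsNearOne N B 1 x) (m : ℕ) :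
    IsNearOne N B m (x ^ m) := by
  induction m with
  | zero => exact ⟨0, 0, by ext <;> simp, by simp, by simp⟩
  | succ m ih => rw [pow_succ]; push_cast; exact ih.mul hN hx

theorem isNearOne_two_pow {B : ℤ} (hB : Even B) (r : ℕ) :
    IsNearOne (2 ^ (r + 1)) B 1 ((⟨1, B⟩ : ℤ√(-6)) ^ 2 ^ (r + 1)) := by
  induction r with
  | zero =>
    refine ⟨-1, 1, ?_, by decide, by simp⟩
    ext <;> simp [pow_two] <;> ring
  | succ r ih =>
    obtain ⟨c, d, hx, ⟨i, hi⟩, ⟨j, hj⟩⟩ := ih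
    obtain ⟨b, hb⟩ := hB
    rw [pow_succ (2 : ℕ) (r + 1), pow_mul, hx]
    refine ⟨c + 3 * 2 ^ r * B ^ 2 * c ^ 2 - 2 ^ (r + 1) * d ^ 2,
      d * (1 + 3 * 2 ^ (r + 1) * B ^ 2 * c), ?_, ?_, ?_⟩
    · ext <;> simp [pow_two] <;> ring
    · refine ⟨i + 3 * 2 ^ r * b * B * c ^ 2 - 2 ^ r * d ^ 2, ?_⟩
      linear_combination hi + 3 * 2 ^ r * B * c ^ 2 * hb
    · exact ⟨j + d * 3 * 2 ^ r * B ^ 2 * c, by linear_combination hj⟩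

theorem re_pow_ne {l : ℕ} {B : ℤ} (hl : Odd l) (hl1 : 1 < l) (hB : Even B) (hB0 : B ≠ 0) :
    ((⟨1, B⟩ : ℤ√(-6)) ^ l).re ≠ 1 ∧ ((⟨1, B⟩ : ℤ√(-6)) ^ l).re ≠ -1 := by
  obtain ⟨r, m, hm, hrm⟩ := Nat.exists_eq_two_pow_mul_odd (n := l - 1) (by omega)
  obtain ⟨r, rfl⟩ : ∃ s, r = s + 1 := by
    refine Nat.exists_eq_succ_of_ne_zero ?_
    rintro rfl
    rw [pow_zero, one_mul] at hrm
    obtain ⟨i, hi⟩ := hl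
    obtain ⟨j, hj⟩ := hm
    omega
  have hN : Even ((2 : ℤ) ^ (r + 1)) := ⟨2 ^ r, by ring⟩
  obtain ⟨c, d, hx, hc, -⟩ := (isNearOne_two_pow hB r).pow hN m
  have hpow : (⟨1, B⟩ : ℤ√(-6)) ^ l = ((⟨1, B⟩ : ℤ√(-6)) ^ 2 ^ (r + 1)) ^ m * ⟨1, B⟩ := by
    rw [← pow_mul, ← hrm, ← pow_succ]
    congr 1; omega
  have hre : ((⟨1, B⟩ : ℤ√(-6)) ^ l).re = 1 + 3 * 2 ^ (r + 1) * B ^ 2 * (c - 2 * d) := by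
    rw [hpow, hx]; simp; ring
  have hcodd : Odd c := by
    have hm' : Odd (m : ℤ) := by exact_mod_cast hm
    have := hc.add_odd hm'
    simpa using this
  have hc2 : c - 2 * d ≠ 0 := by
    obtain ⟨i, hi⟩ := hcodd
    omega
  rw [hre]
  constructor
  · intro h
    have : 3 * 2 ^ (r + 1) * B ^ 2 * (c - 2 * d) = 0 := by linarith
    simp [hB0, hc2] at this
  · obtain ⟨b, rfl⟩ := hB
    intro h
    have : (4 : ℤ) * (3 * 2 ^ (r + 1) * b ^ 2 * (c - 2 * d)) = -2 := by linear_combination h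
    omega

/-- The case in which `30` divides the middle term. -/
theorem six_mul_sq_add_one_ne_pow {l v : ℕ} {w : ℤ} (hl : Odd l) (hl1 : 1 < l) (hw2 : Even w)
    (hw0 : w ≠ 0) : 6 * w ^ 2 + 1 ≠ (v : ℤ) ^ l := by
  intro hw
  obtain ⟨β, κ, hκ, hκ1⟩ := exists_mul_eq_pow hl hw
  have hκ' : κ = 1 ∨ κ = -1 := by
    rw [Zsqrtd.norm_def] at hκ1
    have him : κ.im = 0 := by
      by_contra hne
      have h1 : 0 < κ.im ^ 2 := by positivity
      nlinarith [sq_nonneg κ.re]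
    rw [him] at hκ1
    have : κ.re = 1 ∨ κ.re = -1 := mul_self_eq_one_iff.1 (by linarith)
    rcases this with h | h
    · left; ext <;> simp [h, him]
    · right; ext <;> simp [h, him]
  obtain ⟨β, hβ⟩ : ∃ β : ℤ√(-6), β ^ l = ⟨1, w⟩ := by
    rcases hκ' with rfl | rfl
    · exact ⟨β, by rw [← hκ, one_mul]⟩
    · exact ⟨-β, by rw [hl.neg_pow, ← hκ]; ring⟩
  have hA : β.re = 1 ∨ β.re = -1 := by
    have h1 : β + star β ∣ β ^ l + star β ^ l := hl.add_dvd_pow_add_pow β (star β)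
    have h2 : β + star β = ((2 * β.re : ℤ) : ℤ√(-6)) := by ext <;> simp; ring
    have h3 : β ^ l + star β ^ l = ((2 : ℤ) : ℤ√(-6)) := by
      rw [← star_pow, hβ]; ext <;> simp
    rw [h2, h3, Zsqrtd.intCast_dvd_intCast] at h1
    have : β.re ∣ 1 := by
      obtain ⟨c, hc⟩ := h1
      exact ⟨c, by linarith⟩
    exact Int.isUnit_iff.1 (isUnit_of_dvd_one this)
  obtain ⟨B, hB⟩ : ∃ B : ℤ, (⟨1, B⟩ : ℤ√(-6)) ^ l = ⟨1, w⟩ ∨ (⟨1, B⟩ : ℤ√(-6)) ^ l = -⟨1, w⟩ := by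
    rcases hA with h | h
    · exact ⟨β.im, Or.inl (by rw [← hβ, ← h])⟩
    · refine ⟨-β.im, Or.inr ?_⟩
      rw [← hβ, ← hl.neg_pow]
      congr 1
      ext <;> simp [h]
  have hre : ((⟨1, B⟩ : ℤ√(-6)) ^ l).re = 1 ∨ ((⟨1, B⟩ : ℤ√(-6)) ^ l).re = -1 := by
    rcases hB with h | h <;> rw [h] <;> simp
  have him : Even ((⟨1, B⟩ : ℤ√(-6)) ^ l).im := by
    rcases hB with h | h <;> rw [h] <;> simpa using hw2
  have hBeven : Even B := by
    obtain ⟨k, hk⟩ := hl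
    have h1 : ((2 : ℤ) : ℤ√(-6)) ∣ (⟨1, B⟩ : ℤ√(-6)) ^ 2 - 1 :=
      (Zsqrtd.intCast_dvd _ _).2 ⟨⟨-3 * B ^ 2, by simp [pow_two]; ring⟩,
        ⟨B, by simp [pow_two]; ring⟩⟩
    have h2 : ((2 : ℤ) : ℤ√(-6)) ∣ (⟨1, B⟩ : ℤ√(-6)) ^ l - ⟨1, B⟩ := by
      have h3 := h1.trans (sub_dvd_pow_sub_pow ((⟨1, B⟩ : ℤ√(-6)) ^ 2) 1 k)
      have h4 : (⟨1, B⟩ : ℤ√(-6)) ^ l - ⟨1, B⟩ =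
          (((⟨1, B⟩ : ℤ√(-6)) ^ 2) ^ k - 1 ^ k) * ⟨1, B⟩ := by
        rw [hk, pow_succ, pow_mul]; ring
      rw [h4]
      exact h3.mul_right _
    have h5 := ((Zsqrtd.intCast_dvd _ _).1 h2).2
    rw [Zsqrtd.im_sub] at h5
    have h6 := (Int.even_sub.1 (even_iff_two_dvd.2 h5)).1 him
    simpa using h6
  have hB0 : B ≠ 0 := by
    rintro rfl
    have h1 : (⟨1, 0⟩ : ℤ√(-6)) = 1 := rfl
    rw [h1, one_pow] at hB
    rcases hB with h | h
    · have := congrArg Zsqrtd.im h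
      simp at this
      exact hw0 this.symm
    · have := congrArg Zsqrtd.im h
      simp at this
      exact hw0 this
  obtain ⟨h1, h2⟩ := re_pow_ne hl hl1 hBeven hB0
  rcases hre with h | h
  · exact h1 h
  · exact h2 h

end FiveCubes

namespace FiveCubes

/-- The norm of `a + b ∛5 + c ∛25`. -/
def cubicNorm (a b c : ℤ) : ℤ := a ^ 3 + 5 * b ^ 3 + 25 * c ^ 3 - 15 * a * b * c

/-- Congruences satisfied by the coordinates of all powers of `1 - 4 ∛5 + 2 ∛25`. -/
def UnitCongruence (a b c : ℤ) : Prop :=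
  a % 2 = 1 ∧ b % 2 = 0 ∧ c % 2 = 0 ∧ (a : ZMod 5) = 1 ∧ (c : ZMod 5) = 4 * b + 3 * b ^ 2

theorem five_eq_zero_zmod : (5 : ZMod 5) = 0 := by decide

theorem unitCongruence_mul_iff (a b c : ℤ) :
    UnitCongruence (a + 10 * b - 20 * c) (-4 * a + b + 10 * c) (2 * a - 4 * b + c) ↔
      UnitCongruence a b c := by
  unfold UnitCongruence
  push_cast
  generalize hA : (a : ZMod 5) = A
  generalize hB : (b : ZMod 5) = B
  generalize hC : (c : ZMod 5) = C
  have h1 : (A + 10 * B - 20 * C = 1 ∧ 2 * A - 4 * B + C = 4 * (-4 * A + B + 10 * C) +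
      3 * (-4 * A + B + 10 * C) ^ 2) ↔ (A = 1 ∧ C = 4 * B + 3 * B ^ 2) := by
    revert A B C
    simp only [forall_eq']
    have : ∀ A B C : ZMod 5, (A + 10 * B - 20 * C = 1 ∧ 2 * A - 4 * B + C =
      4 * (-4 * A + B + 10 * C) +
      3 * (-4 * A + B + 10 * C) ^ 2) ↔ (A = 1 ∧ C = 4 * B + 3 * B ^ 2) := by decide
    exact this _ _ _
  rw [h1]
  have h2 : (a + 10 * b - 20 * c) % 2 = 1 ↔ a % 2 = 1 := by omega
  have h3 : (-4 * a + b + 10 * c) % 2 = 0 ↔ b % 2 = 0 := by omega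
  have h4 : (2 * a - 4 * b + c) % 2 = 0 ↔ c % 2 = 0 := by omega
  rw [h2, h3, h4]

theorem unit_cases_of_bounds {a b c : ℤ} (hN : cubicNorm a b c = 1)
    (hc0 : 0 ≤ c) (hc14 : c ≤ 14) (hb3 : 17099 * c - 6800 ≤ 10000 * b)
    (hb4 : 10000 * b ≤ 17100 * c + 6800) (ha1 : 17099 * b + 29237 * c - 20000 ≤ 20000 * a)
    (ha2 : 20000 * a ≤ 17100 * b + 29242 * c + 20000) :
    (a = 1 ∧ b = 0 ∧ c = 0) ∨ (a = 41 ∧ b = 24 ∧ c = 14) := by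
  have hbl : b ≤ 24 := by omega
  have hb0 : 0 ≤ b := by omega
  have hal : -1 ≤ a := by omega
  have hau : a ≤ 42 := by omega
  have key : ∀ c ∈ Finset.Icc (0 : ℤ) 14,
      ∀ b ∈ (Finset.Icc (0 : ℤ) 24).filter fun b => 17099 * c - 6800 ≤ 10000 * b ∧
        10000 * b ≤ 17100 * c + 6800, ∀ a ∈ Finset.Icc (-1 : ℤ) 42, cubicNorm a b c = 1 →
        (a = 1 ∧ b = 0 ∧ c = 0) ∨ (a = 41 ∧ b = 24 ∧ c = 14) := by
    unfold cubicNorm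
    decide +kernel
  exact key c (Finset.mem_Icc.2 ⟨hc0, hc14⟩) b
    (Finset.mem_filter.2 ⟨Finset.mem_Icc.2 ⟨hb0, hbl⟩, hb3, hb4⟩) a (Finset.mem_Icc.2 ⟨hal, hau⟩) hN

theorem unitCongruence_of_mem_Ico {t : ℝ} (ht : t ^ 3 = 5) (ht1 : 1.7099 < t) (ht2 : t < 1.71)
    {a b c : ℤ} (hN : cubicNorm a b c = 1) (h1 : 1 ≤ (a : ℝ) + b * t + c * t ^ 2)
    (h2 : (a : ℝ) + b * t + c * t ^ 2 < 41 + 24 * t + 14 * t ^ 2) : UnitCongruence a b c := by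
  have hNR : (a : ℝ) ^ 3 + 5 * b ^ 3 + 25 * c ^ 3 - 15 * a * b * c = 1 := by exact_mod_cast hN
  set x : ℝ := a - c * t ^ 2 with hx
  set y : ℝ := b * t - c * t ^ 2 with hy
  set e : ℝ := a + b * t + c * t ^ 2 with he
  have hprod : e * (x ^ 2 - x * y + y ^ 2) = 1 := by
    rw [← hNR, he, hx, hy]
    linear_combination (b ^ 3 - 3 * a * b * c + c ^ 3 * (t ^ 3 + 5)) * ht
  have hM0 : 0 ≤ x ^ 2 - x * y + y ^ 2 := by
    linarith [sq_nonneg (2 * x - y), sq_nonneg y, show (2 * x - y) ^ 2 + 3 * y ^ 2 =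
      4 * (x ^ 2 - x * y + y ^ 2) by ring]
  have hM : x ^ 2 - x * y + y ^ 2 ≤ 1 := by
    linarith [mul_le_mul_of_nonneg_right h1 hM0]
  have hy1 : y ^ 2 ≤ 1.16 ^ 2 := by
    linarith [sq_nonneg (2 * x - y), show (2 * x - y) ^ 2 + 3 * y ^ 2 =
      4 * (x ^ 2 - x * y + y ^ 2) by ring]
  have hx1 : x ^ 2 ≤ 1.16 ^ 2 := by
    linarith [sq_nonneg (2 * y - x), show (2 * y - x) ^ 2 + 3 * x ^ 2 =
      4 * (x ^ 2 - x * y + y ^ 2) by ring]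
  have hxy1 : (2 * x - y) ^ 2 ≤ 2 ^ 2 := by
    linarith [sq_nonneg y, show (2 * x - y) ^ 2 + 3 * y ^ 2 =
      4 * (x ^ 2 - x * y + y ^ 2) by ring]
  obtain ⟨hyl, hyu⟩ := abs_le.1 (abs_le_of_sq_le_sq hy1 (by norm_num))
  obtain ⟨hxl, hxu⟩ := abs_le.1 (abs_le_of_sq_le_sq hx1 (by norm_num))
  obtain ⟨hxyl, hxyu⟩ := abs_le.1 (abs_le_of_sq_le_sq hxy1 (by norm_num))
  have hsum : 3 * (c * t ^ 2) = e - x - y := by rw [he, hx, hy]; ring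
  have ht3 : 2.9237 < t ^ 2 := by nlinarith
  have ht4 : t ^ 2 < 2.9242 := by nlinarith
  have hc0 : 0 ≤ c := by
    by_contra! hneg
    have : (c : ℝ) ≤ -1 := by exact_mod_cast Int.le_sub_one_of_lt hneg
    have := mul_le_mul_of_nonneg_right this (sq_nonneg t)
    linarith
  have hc14 : c ≤ 14 := by
    by_contra! hneg
    have : (15 : ℝ) ≤ c := by exact_mod_cast hneg
    have := mul_le_mul_of_nonneg_right this (sq_nonneg t)
    linarith
  have hcR : (0 : ℝ) ≤ c := by exact_mod_cast hc0
  have hbc : y = (b - c * t) * t := by rw [hy]; ring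
  have ht5 : 0 ≤ t - 1.7099 := by linarith
  have hb1 : -0.68 < (b : ℝ) - c * t := by
    by_contra! hneg
    have := mul_nonneg (show 0 ≤ -((b : ℝ) - c * t) by linarith) ht5
    linarith
  have hb2 : (b : ℝ) - c * t < 0.68 := by
    by_contra! hneg
    have := mul_nonneg (show 0 ≤ ((b : ℝ) - c * t) by linarith) ht5
    linarith
  have hct1 : 1.7099 * (c : ℝ) ≤ c * t := by linarith [mul_le_mul_of_nonneg_left ht1.le hcR]
  have hct2 : c * t ≤ 1.71 * (c : ℝ) := by linarith [mul_le_mul_of_nonneg_left ht2.le hcR]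
  have hct3 : 2.9237 * (c : ℝ) ≤ c * t ^ 2 := by linarith [mul_le_mul_of_nonneg_left ht3.le hcR]
  have hct4 : c * t ^ 2 ≤ 2.9242 * (c : ℝ) := by linarith [mul_le_mul_of_nonneg_left ht4.le hcR]
  have hb3 : 17099 * c - 6800 ≤ 10000 * b := by
    have : (17099 : ℝ) * c - 6800 ≤ 10000 * b := by linarith
    exact_mod_cast this
  have hb4 : 10000 * b ≤ 17100 * c + 6800 := by
    have : (10000 : ℝ) * b ≤ 17100 * c + 6800 := by linarith
    exact_mod_cast this
  have hb0 : 0 ≤ b := by omega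
  have hbR : (0 : ℝ) ≤ b := by exact_mod_cast hb0
  have hbt1 : 1.7099 * (b : ℝ) ≤ b * t := by linarith [mul_le_mul_of_nonneg_left ht1.le hbR]
  have hbt2 : b * t ≤ 1.71 * (b : ℝ) := by linarith [mul_le_mul_of_nonneg_left ht2.le hbR]
  have hxy : 2 * x - y = 2 * a - b * t - c * t ^ 2 := by rw [hx, hy]; ring
  have ha1 : 17099 * b + 29237 * c - 20000 ≤ 20000 * a := by
    have : (17099 : ℝ) * b + 29237 * c - 20000 ≤ 20000 * a := by linarith
    exact_mod_cast this
  have ha2 : 20000 * a ≤ 17100 * b + 29242 * c + 20000 := by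
    have : (20000 : ℝ) * a ≤ 17100 * b + 29242 * c + 20000 := by linarith
    exact_mod_cast this
  rcases unit_cases_of_bounds hN hc0 hc14 hb3 hb4 ha1 ha2 with
    ⟨rfl, rfl, rfl⟩ | ⟨rfl, rfl, rfl⟩
  · simp [UnitCongruence]
  · refine ⟨by norm_num, by norm_num, by norm_num, by decide, by decide⟩

theorem unitCongruence_of_cubicNorm_eq_one {a b c : ℤ} (hN : cubicNorm a b c = 1) :
    UnitCongruence a b c := by
  obtain ⟨t, ht0, ht⟩ : ∃ t : ℝ, 0 < t ∧ t ^ 3 = 5 :=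
    ⟨5 ^ (3 : ℝ)⁻¹, by positivity, by
      rw [← Real.rpow_natCast, ← Real.rpow_mul (by norm_num)]; norm_num⟩
  have ht1 : 1.7099 < t := by
    by_contra! h
    have := pow_le_pow_left₀ ht0.le h 3
    norm_num [ht] at this
  have ht2 : t < 1.71 := by
    by_contra! h
    have := pow_le_pow_left₀ (by norm_num) h 3
    norm_num [ht] at this
  set E : ℝ := 41 + 24 * t + 14 * t ^ 2 with hE
  have hE1 : 1 < E := by rw [hE]; nlinarith
  have hE0 : 0 < E := by linarith
  have hmain : ∀ n : ℤ, ∀ a b c : ℤ, cubicNorm a b c = 1 → E ^ n ≤ (a : ℝ) + b * t + c * t ^ 2 →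
      (a : ℝ) + b * t + c * t ^ 2 < E ^ (n + 1) → UnitCongruence a b c := by
    intro n
    induction n using Int.induction_on with
    | zero =>
      intro a b c hN h1 h2
      simp only [zpow_zero, zero_add, zpow_one] at h1 h2
      exact unitCongruence_of_mem_Ico ht ht1 ht2 hN h1 h2
    | succ n ih =>
      intro a b c hN h1 h2
      have hmul : E * (((a + 10 * b - 20 * c : ℤ) : ℝ) + ((-4 * a + b + 10 * c : ℤ) : ℝ) * t +
          ((2 * a - 4 * b + c : ℤ) : ℝ) * t ^ 2) = a + b * t + c * t ^ 2 := by
        push_cast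
        rw [hE]
        ring_nf
        have h4 : t ^ 4 = 5 * t := by rw [pow_succ, ht]
        rw [ht, h4]; ring
      rw [← hmul] at h1 h2
      rw [zpow_add_one₀ hE0.ne', mul_comm] at h1
      rw [zpow_add_one₀ hE0.ne' (n + 1 : ℤ), mul_comm _ E] at h2
      refine (unitCongruence_mul_iff a b c).1 (ih _ _ _ ?_ (le_of_mul_le_mul_left h1 hE0)
        (lt_of_mul_lt_mul_left h2 hE0.le))
      rw [← hN]; unfold cubicNorm; ring
    | pred n ih =>
      intro a b c hN h1 h2
      have hmul : ((41 * a + 70 * b + 120 * c : ℤ) : ℝ) + ((24 * a + 41 * b + 70 * c : ℤ) : ℝ) * t +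
          ((14 * a + 24 * b + 41 * c : ℤ) : ℝ) * t ^ 2 = E * (a + b * t + c * t ^ 2) := by
        push_cast
        rw [hE]
        ring_nf
        have h4 : t ^ 4 = 5 * t := by rw [pow_succ, ht]
        rw [ht, h4]; ring
      have hback := ih (41 * a + 70 * b + 120 * c) (24 * a + 41 * b + 70 * c)
        (14 * a + 24 * b + 41 * c) (by rw [← hN]; unfold cubicNorm; ring) (by
          rw [hmul]
          have := mul_le_mul_of_nonneg_left h1 hE0.le
          rwa [← zpow_one_add₀ hE0.ne', show 1 + (-(n : ℤ) - 1) = -n by ring] at this) (by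
          rw [hmul]
          have := mul_lt_mul_of_pos_left h2 hE0
          rwa [← zpow_one_add₀ hE0.ne', show 1 + (-(n : ℤ) - 1 + 1) = -n + 1 by ring] at this)
      rw [← unitCongruence_mul_iff] at hback
      ring_nf at hback
      exact hback
  have hpos : 0 < (a : ℝ) + b * t + c * t ^ 2 := by
    have hNR : (a : ℝ) ^ 3 + 5 * b ^ 3 + 25 * c ^ 3 - 15 * a * b * c = 1 := by exact_mod_cast hN
    have hprod : ((a : ℝ) + b * t + c * t ^ 2) * (((a - b * t) ^ 2 + (b * t - c * t ^ 2) ^ 2 +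
        (a - c * t ^ 2) ^ 2) / 2) = 1 := by
      rw [← hNR]
      linear_combination (b ^ 3 - 3 * a * b * c + c ^ 3 * (t ^ 3 + 5)) * ht
    refine pos_of_mul_pos_left (b := ((a - b * t) ^ 2 + (b * t - c * t ^ 2) ^ 2 +
        (a - c * t ^ 2) ^ 2) / 2) ?_ (by positivity)
    rw [hprod]; norm_num
  obtain ⟨n, hn⟩ := exists_mem_Ico_zpow hpos hE1
  exact hmain n a b c hN hn.1 hn.2

theorem cube_emod_six (x : ℤ) : x ^ 3 % 6 = x % 6 := by
  have h : x % 6 = 0 ∨ x % 6 = 1 ∨ x % 6 = 2 ∨ x % 6 = 3 ∨ x % 6 = 4 ∨ x % 6 = 5 := by omega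
  rcases h with h | h | h | h | h | h <;> simp [pow_succ, Int.mul_emod, h]

theorem twentyfive_mul_cube_sub_cube_ne_six (v w : ℤ) : 25 * v ^ 3 - w ^ 3 ≠ 6 := by
  intro h
  have hv := cube_emod_six v
  have hw := cube_emod_six w
  obtain ⟨k, hk⟩ : ∃ k, v = w + 6 * k := ⟨(v - w) / 6, by omega⟩
  have hN : cubicNorm (-(w + 5 * k)) (w + 5 * k) k = 1 := by
    unfold cubicNorm
    rw [hk] at h
    linarith
  obtain ⟨h1, h2, -⟩ := unitCongruence_of_cubicNorm_eq_one hN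
  omega

theorem twentyfive_mul_cube_sub_cube_ne_three (v w : ℤ) : 25 * v ^ 3 - w ^ 3 ≠ 3 := by
  intro h
  have hv := cube_emod_six v
  have hw := cube_emod_six w
  obtain ⟨k, hk⟩ : ∃ k, v = w + 3 * k := ⟨(v - w) / 3, by omega⟩
  have hN : cubicNorm (2 * w + 10 * k) (w + 5 * k) (w + 4 * k) = 1 := by
    unfold cubicNorm
    rw [hk] at h
    linarith
  obtain ⟨h1, -⟩ := unitCongruence_of_cubicNorm_eq_one hN
  omega

theorem cube_sub_ne_six (v w : ℤ) : v ^ 3 - 5 * (5 * w) ^ 3 ≠ 6 := by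
  intro h
  have hv := cube_emod_six v
  have hw := cube_emod_six (5 * w)
  obtain ⟨k, hk⟩ : ∃ k, v = 6 * k - 5 * w := ⟨(v + 5 * w) / 6, by omega⟩
  have hN : cubicNorm (k - 5 * w) (-k) k = 1 := by
    unfold cubicNorm
    rw [hk] at h
    linarith
  obtain ⟨-, -, -, h4, h5⟩ := unitCongruence_of_cubicNorm_eq_one hN
  push_cast at h4 h5
  rw [five_eq_zero_zmod, zero_mul, sub_zero] at h4
  rw [h4] at h5
  revert h5
  decide

/-- The exponent `3`, apart from the case `30 ∣ z`. -/
theorem false_of_exponent_three {a b c u v z : ℕ} (ha : a ≤ 1) (hb : b ≤ 1) (hc : c ≤ 1)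
    (habc : ¬(a = 1 ∧ b = 1 ∧ c = 1))
    (hz : z = 2 ^ (a * (3 - 1)) * 3 ^ (b * (3 - 1)) * 5 ^ (c * (3 - 1)) * u ^ 3)
    (hz6 : z ^ 2 + 6 = 2 ^ a * 3 ^ b * 5 ^ ((1 - c) * (3 - 1)) * v ^ 3) : False := by
  interval_cases a <;> interval_cases b <;> interval_cases c
  · have hz' : ((z : ℤ) ^ 2 + 6 = 25 * v ^ 3) ∧ (z : ℤ) = u ^ 3 := by
      norm_num at hz hz6
      constructor <;> [exact_mod_cast hz6; exact_mod_cast hz]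
    refine twentyfive_mul_cube_sub_cube_ne_six v (u ^ 2) ?_
    rw [← hz'.1, hz'.2]; ring
  · have hz' : ((z : ℤ) ^ 2 + 6 = v ^ 3) ∧ (z : ℤ) = 25 * u ^ 3 := by
      norm_num at hz hz6
      constructor <;> [exact_mod_cast hz6; exact_mod_cast hz]
    refine cube_sub_ne_six v (u ^ 2) ?_
    rw [← hz'.1, hz'.2]; ring
  · exact false_of_locallyInsoluble ⟨7, by decide⟩ hz hz6
  · exact false_of_locallyInsoluble ⟨19, by decide +kernel⟩ hz hz6
  · have hz' : ((z : ℤ) ^ 2 + 6 = 50 * v ^ 3) ∧ (z : ℤ) = 4 * u ^ 3 := by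
      norm_num at hz hz6
      constructor <;> [exact_mod_cast hz6; exact_mod_cast hz]
    refine twentyfive_mul_cube_sub_cube_ne_three v (2 * u ^ 2) ?_
    have h1 := hz'.1
    rw [hz'.2] at h1
    linarith
  · exact false_of_locallyInsoluble ⟨7, by decide⟩ hz hz6
  · exact false_of_locallyInsoluble ⟨19, by decide +kernel⟩ hz hz6
  · simp at habc

theorem isFundamental_five : Pell.IsFundamental (Pell.Solution₁.mk (d := 5) 9 4 (by norm_num)) := by
  refine ⟨by simp, by simp, fun {b} hb => ?_⟩
  have h := b.prop
  by_contra! hlt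
  simp only [Pell.Solution₁.x_mk] at hlt
  generalize b.x = x at *
  generalize b.y = y at *
  have hy : y ^ 2 ≤ 12 := by nlinarith
  have hy1 : y ≤ 3 := by nlinarith
  have hy2 : -3 ≤ y := by nlinarith
  interval_cases x <;> interval_cases y <;> simp at h

theorem exists_lucas_of_two_pow (s : ℕ) : ∃ m : ℤ, 3 ≤ m ∧ m % 4 = 3 ∧
    2 * ((⟨9, 4⟩ : ℤ√5) ^ 2 ^ s).re = m ^ 3 - 3 * m := by
  induction s with
  | zero => exact ⟨3, by norm_num⟩
  | succ s ih =>
    obtain ⟨m, hm, hm4, h⟩ := ih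
    have hn : ((⟨9, 4⟩ : ℤ√5) ^ 2 ^ s).norm = 1 := by
      exact (map_pow (Zsqrtd.normMonoidHom (d := 5)) ⟨9, 4⟩ (2 ^ s)).trans (one_pow _)
    refine ⟨m ^ 2 - 2, by nlinarith, ?_, ?_⟩
    · rw [Int.sub_emod, pow_two, Int.mul_emod, hm4]; norm_num
    · rw [pow_succ 2 s, pow_mul, pow_two]
      generalize (⟨9, 4⟩ : ℤ√5) ^ 2 ^ s = w at *
      rw [Zsqrtd.norm_def] at hn
      rw [Zsqrtd.re_mul]
      linear_combination (2 * w.re + m ^ 3 - 3 * m) * h - 2 * hn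

/-- `-1` is not a square modulo an integer congruent to `3` modulo `4`. -/
theorem not_dvd_sq_add_one {m : ℤ} (hm : 3 ≤ m) (hm4 : m % 4 = 3) (f : ℤ) : ¬ m ∣ f ^ 2 + 1 := by
  intro h
  lift m to ℕ using by omega
  obtain ⟨p, hp, hpm, hp4⟩ : ∃ p : ℕ, p.Prime ∧ p ∣ m ∧ p % 4 = 3 := by
    by_contra! hcon
    have : ∀ n : ℕ, n ∣ m → n % 4 = 1 := by
      intro n
      induction n using Nat.recOnMul with
      | zero => intro h0; rw [zero_dvd_iff.1 h0] at hm; norm_num at hm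
      | one => intro _; rfl
      | prime p hp =>
        intro hpm
        have h3 := hcon p hp hpm
        have h2 : p ≠ 2 := by rintro rfl; omega
        have := hp.eq_two_or_odd
        omega
      | mul a b ha hb =>
        intro hab
        rw [Nat.mul_mod, ha (dvd_of_mul_right_dvd hab), hb (dvd_of_mul_left_dvd hab)]
    have := this m dvd_rfl
    omega
  have := Fact.mk hp
  have hdvd : (p : ℤ) ∣ f ^ 2 + 1 := (Int.natCast_dvd_natCast.2 hpm).trans h
  rw [← ZMod.intCast_zmod_eq_zero_iff_dvd] at hdvd
  push_cast at hdvd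
  exact ZMod.mod_four_ne_three_of_sq_eq_neg_one (eq_neg_of_add_eq_zero_left hdvd) hp4

/-- The only integer points on `5 b ^ 2 = 4 f ^ 4 + 1`. -/
theorem sq_eq_one_of_five_mul_sq {f b : ℕ} (h : 5 * b ^ 2 = 4 * f ^ 4 + 1) : f ^ 2 = 1 := by
  have hf : 1 ≤ f := by
    rcases Nat.eq_zero_or_pos f with rfl | hf
    · omega
    · exact hf
  have hf4 : 1 ≤ f ^ 4 := Nat.one_le_pow _ _ hf
  have hb : (b : ℤ) ≤ f ^ 2 := by
    have : b ≤ f ^ 2 := by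
      refine (Nat.pow_le_pow_iff_left (n := 2) (by norm_num)).1 ?_
      rw [← pow_mul]; norm_num; omega
    exact_mod_cast this
  have hZ : (5 : ℤ) * b ^ 2 = 4 * f ^ 4 + 1 := by exact_mod_cast h
  have hx : 0 < 5 * (b : ℤ) - 4 * f ^ 2 := by
    have : (4 * (f : ℤ) ^ 2) ^ 2 < (5 * b) ^ 2 := by nlinarith
    have := lt_of_pow_lt_pow_left₀ 2 (by positivity) this
    linarith
  obtain ⟨k, hk⟩ := isFundamental_five.eq_pow_of_nonneg
    (a := Pell.Solution₁.mk (5 * (b : ℤ) - 4 * f ^ 2) (2 * f ^ 2 - 2 * b) (by nlinarith))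
    (by simpa using hx) (by simpa using hb)
  have hk' : (⟨2 * f ^ 2, b⟩ : ℤ√5) = ⟨2, 1⟩ * ⟨9, 4⟩ ^ k := by
    have := congrArg (fun w : Pell.Solution₁ 5 => (⟨2, 1⟩ : ℤ√5) * (w : ℤ√5)) hk
    simp only [Pell.Solution₁.coe_mk] at this
    have hpow : ((Pell.Solution₁.mk (d := 5) 9 4 (by norm_num) ^ k : Pell.Solution₁ 5) : ℤ√5) =
        ⟨9, 4⟩ ^ k := rfl
    rw [hpow] at this
    rw [← this]
    ext <;> simp <;> ring
  have hmod : ∀ j : ℕ, ((⟨9, 4⟩ : ℤ√5) ^ (2 * j)).re % 4 = 1 ∧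
      ((⟨9, 4⟩ : ℤ√5) ^ (2 * j)).im % 8 = 0 := by
    intro j
    induction j with
    | zero => simp
    | succ j ih =>
      rw [mul_add, pow_add, mul_one, show (⟨9, 4⟩ : ℤ√5) ^ 2 = ⟨161, 72⟩ by decide]
      generalize (⟨9, 4⟩ : ℤ√5) ^ (2 * j) = w at *
      rw [Zsqrtd.re_mul, Zsqrtd.im_mul]
      dsimp only
      omega
  rcases Nat.eq_zero_or_pos k with rfl | hkpos
  · have := congrArg Zsqrtd.re hk'
    simp at this
    simp [this]
  exfalso
  rcases Nat.even_or_odd' k with ⟨j, rfl | rfl⟩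
  · obtain ⟨s, m, hm, hjm⟩ := Nat.exists_eq_two_pow_mul_odd (n := j) (by omega)
    obtain ⟨q, hq, hq4, hqe⟩ := exists_lucas_of_two_pow s
    have hn : ((⟨9, 4⟩ : ℤ√5) ^ 2 ^ s).norm = 1 := by
      exact (map_pow (Zsqrtd.normMonoidHom (d := 5)) ⟨9, 4⟩ (2 ^ s)).trans (one_pow _)
    have hdvd : (q : ℤ√5) ∣ ⟨9, 4⟩ ^ 2 ^ (s + 1) + 1 := by
      refine ⟨((q ^ 2 - 3 : ℤ) : ℤ√5) * ⟨9, 4⟩ ^ 2 ^ s, ?_⟩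
      rw [pow_succ 2 s, pow_mul, pow_two, ← mul_assoc, ← Int.cast_mul,
        show q * (q ^ 2 - 3) = 2 * ((⟨9, 4⟩ : ℤ√5) ^ 2 ^ s).re by rw [hqe]; ring]
      generalize (⟨9, 4⟩ : ℤ√5) ^ 2 ^ s = w at *
      rw [Zsqrtd.norm_def] at hn
      ext
      · simp; linarith
      · simp; ring
    have hdvd2 : (q : ℤ√5) ∣ ⟨9, 4⟩ ^ (2 * j) + 1 := by
      refine hdvd.trans ?_
      rw [hjm, ← mul_assoc, ← pow_succ', pow_mul]
      simpa using hm.add_dvd_pow_add_pow ((⟨9, 4⟩ : ℤ√5) ^ 2 ^ (s + 1)) 1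
    have hdvd3 : (q : ℤ√5) ∣ (⟨2, 1⟩ : ℤ√5) * ⟨9, 4⟩ ^ (2 * j) + ⟨2, 1⟩ := by
      rw [← mul_add_one]; exact hdvd2.mul_left _
    rw [← hk', Zsqrtd.intCast_dvd] at hdvd3
    have h2 : q ∣ 2 * ((f : ℤ) ^ 2 + 1) := by
      rw [mul_add]; simpa using hdvd3.1
    refine not_dvd_sq_add_one hq hq4 f (IsCoprime.dvd_of_dvd_mul_left ?_ h2)
    rw [Int.isCoprime_iff_gcd_eq_one, Int.gcd_comm]
    exact Int.isCoprime_iff_gcd_eq_one.1 ((Int.prime_two.coprime_iff_not_dvd).2 (by omega))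
  · obtain ⟨h1, h2⟩ := hmod j
    have := congrArg Zsqrtd.re hk'
    rw [pow_succ (⟨9, 4⟩ : ℤ√5), ← mul_assoc] at this
    generalize (⟨9, 4⟩ : ℤ√5) ^ (2 * j) = w at *
    simp only [Zsqrtd.re_mul, Zsqrtd.im_mul] at this
    rcases Nat.even_or_odd' f with ⟨g, rfl | rfl⟩ <;> push_cast at this <;> ring_nf at this <;> omega

theorem exists_pow_four_of_mul {A B w : ℕ} (h : A.Coprime B) (hw : A * B = w ^ 4) :
    ∃ s t, A = s ^ 4 ∧ B = t ^ 4 ∧ w = s * t := by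
  obtain ⟨s, hs⟩ := exists_eq_pow_of_mul_eq_pow (Nat.isUnit_iff.2 h) hw
  obtain ⟨t, ht⟩ := exists_eq_pow_of_mul_eq_pow (Nat.isUnit_iff.2 h.symm) (mul_comm A B ▸ hw)
  refine ⟨s, t, hs, ht, ?_⟩
  rw [hs, ht, ← mul_pow] at hw
  exact (Nat.pow_left_injective (by norm_num) hw).symm

/-- If `A B = D w ^ 4` with `A`, `B` coprime and a prime power `q ∣ D`, then `q` goes to one side. -/
theorem exists_split_primePow {A B q C : ℕ} (h : A.Coprime B) (hq : IsPrimePow q)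
    (hC : A * B = q * C) :
    (∃ A', A = q * A' ∧ A'.Coprime B ∧ A' * B = C) ∨
      ∃ B', B = q * B' ∧ A.Coprime B' ∧ A * B' = C := by
  rcases (h.isPrimePow_dvd_mul hq).1 (hC ▸ dvd_mul_right q C) with ⟨A', rfl⟩ | ⟨B', rfl⟩
  · refine Or.inl ⟨A', rfl, Nat.Coprime.coprime_mul_left h, ?_⟩
    exact Nat.eq_of_mul_eq_mul_left hq.pos (by rw [← hC]; ring)
  · refine Or.inr ⟨B', rfl, Nat.Coprime.coprime_mul_left_right h, ?_⟩
    exact Nat.eq_of_mul_eq_mul_left hq.pos (by rw [← hC]; ring)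

theorem exists_split_six_hundred {m n w : ℕ} (hmn : m.Coprime n) (h : m * n = 600 * w ^ 4) :
    ∃ d e s t : ℕ, m = d * s ^ 4 ∧ n = e * t ^ 4 ∧ w = s * t ∧
      ((d = 600 ∧ e = 1) ∨ (d = 1 ∧ e = 600) ∨ (d = 8 ∧ e = 75) ∨ (d = 75 ∧ e = 8) ∨
        (d = 3 ∧ e = 200) ∨ (d = 200 ∧ e = 3) ∨ (d = 24 ∧ e = 25) ∨ (d = 25 ∧ e = 24)) := by
  have p8 : IsPrimePow 8 := by
    rw [show 8 = 2 ^ 3 by norm_num]; exact Nat.prime_two.isPrimePow.pow (by norm_num)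
  have p25 : IsPrimePow 25 := by
    rw [show 25 = 5 ^ 2 by norm_num]; exact Nat.prime_five.isPrimePow.pow (by norm_num)
  have p3 : IsPrimePow 3 := Nat.prime_three.isPrimePow
  have h' : m * n = 8 * (25 * (3 * w ^ 4)) := by rw [h]; ring
  rcases exists_split_primePow hmn p8 h' with ⟨m, rfl, hmn, h'⟩ | ⟨n, rfl, hmn, h'⟩ <;>
  rcases exists_split_primePow hmn p25 h' with ⟨m, rfl, hmn, h'⟩ | ⟨n, rfl, hmn, h'⟩ <;>
  rcases exists_split_primePow hmn p3 h' with ⟨m, rfl, hmn, h'⟩ | ⟨n, rfl, hmn, h'⟩ <;>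
  obtain ⟨s, t, rfl, rfl, rfl⟩ := exists_pow_four_of_mul hmn h' <;>
  simp only [← mul_assoc] <;>
  [exact ⟨600, 1, s, t, by ring, by ring, rfl, by simp⟩;
   exact ⟨200, 3, s, t, by ring, by ring, rfl, by simp⟩;
   exact ⟨24, 25, s, t, by ring, by ring, rfl, by simp⟩;
   exact ⟨8, 75, s, t, by ring, by ring, rfl, by simp⟩;
   exact ⟨75, 8, s, t, by ring, by ring, rfl, by simp⟩;
   exact ⟨25, 24, s, t, by ring, by ring, rfl, by simp⟩;
   exact ⟨3, 200, s, t, by ring, by ring, rfl, by simp⟩;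
   exact ⟨1, 600, s, t, by ring, by ring, rfl, by simp⟩]

theorem pow_four_mod_three (x : ℕ) : x ^ 4 % 3 = 0 ∨ x ^ 4 % 3 = 1 := by
  have h : x % 3 = 0 ∨ x % 3 = 1 ∨ x % 3 = 2 := by omega
  rcases h with h | h | h <;> simp [Nat.pow_mod, h]

theorem pow_four_mod_five (x : ℕ) : x ^ 4 % 5 = 0 ∨ x ^ 4 % 5 = 1 := by
  have h : x % 5 = 0 ∨ x % 5 = 1 ∨ x % 5 = 2 ∨ x % 5 = 3 ∨ x % 5 = 4 := by omega
  rcases h with h | h | h | h | h <;> simp [Nat.pow_mod, h]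

theorem pow_four_mod_sixteen (x : ℕ) : x ^ 4 % 16 = 0 ∨ x ^ 4 % 16 = 1 := by
  rcases Nat.even_or_odd' x with ⟨y, rfl | rfl⟩
  · left; rw [mul_pow]; omega
  · right
    have h16 : (2 * y + 1) % 16 = 1 ∨ (2 * y + 1) % 16 = 3 ∨ (2 * y + 1) % 16 = 5 ∨
        (2 * y + 1) % 16 = 7 ∨ (2 * y + 1) % 16 = 9 ∨ (2 * y + 1) % 16 = 11 ∨
        (2 * y + 1) % 16 = 13 ∨ (2 * y + 1) % 16 = 15 := by omega
    rcases h16 with h | h | h | h | h | h | h | h <;> rw [Nat.pow_mod, h]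

theorem exists_sq_eq_of_odd {t : ℕ} (h : t % 2 = 1) : ∃ c, t ^ 2 = 8 * c + 1 := by
  have : t ^ 2 % 8 = 1 := by
    have h8 : t % 8 = 1 ∨ t % 8 = 3 ∨ t % 8 = 5 ∨ t % 8 = 7 := by omega
    rcases h8 with h | h | h | h <;> simp [Nat.pow_mod, h]
  exact ⟨t ^ 2 / 8, by omega⟩

theorem sq_mod_three (x : ℕ) : x ^ 2 % 3 = 0 ∨ x ^ 2 % 3 = 1 := by
  have h : x % 3 = 0 ∨ x % 3 = 1 ∨ x % 3 = 2 := by omega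
  rcases h with h | h | h <;> simp [Nat.pow_mod, h]

theorem pow_four_eq_one_of_twentyfive {s t : ℕ} (h : 25 * t ^ 4 = 24 * s ^ 4 + 1) :
    s ^ 4 = 1 ∧ t ^ 4 = 1 := by
  have ht4 : t ^ 4 = t ^ 2 * t ^ 2 := by ring
  have hodd : t % 2 = 1 := by
    by_contra hcon
    obtain ⟨y, rfl⟩ : ∃ y, t = 2 * y := ⟨t / 2, by omega⟩
    rw [mul_pow] at h; omega
  obtain ⟨c, hc⟩ := exists_sq_eq_of_odd hodd
  have h1 : (10 * c + 1) * (20 * c + 3) = 3 * s ^ 4 := by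
    rw [ht4, hc] at h
    nlinarith
  have h3 : c % 3 = 0 := by
    have := sq_mod_three t
    have h4 := pow_four_mod_three t
    have hne : t ^ 2 % 3 ≠ 0 := by
      intro h0
      rw [ht4] at h
      obtain ⟨e, he⟩ := Nat.dvd_of_mod_eq_zero h0
      rw [he] at h
      have : 25 * (3 * e * (3 * e)) = 3 * (25 * e * (3 * e)) := by ring
      omega
    omega
  obtain ⟨d, rfl⟩ := Nat.dvd_of_mod_eq_zero h3
  have h2 : (30 * d + 1) * (20 * d + 1) = s ^ 4 := by nlinarith
  have hcop : (30 * d + 1).Coprime (20 * d + 1) := by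
    have : IsCoprime ((30 * d + 1 : ℕ) : ℤ) ((20 * d + 1 : ℕ) : ℤ) := ⟨-2, 3, by push_cast; ring⟩
    exact Nat.isCoprime_iff_coprime.1 this
  obtain ⟨f, -, hf, -, -⟩ := exists_pow_four_of_mul hcop h2
  have hf2 := sq_eq_one_of_five_mul_sq (f := f) (b := t) (by rw [← hf, hc]; ring)
  have hf4 : f ^ 4 = 1 := by rw [show f ^ 4 = (f ^ 2) ^ 2 by ring, hf2]; rfl
  have hd : d = 0 := by omega
  subst hd
  refine ⟨by omega, by rw [ht4, hc]⟩

/-- The only integer points on `v ^ 2 = 150 u ^ 4 + 1`. -/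
theorem eq_zero_or_two_of_sq_eq {u v : ℕ} (h : v ^ 2 = 150 * u ^ 4 + 1) : u = 0 ∨ u = 2 := by
  induction u using Nat.strong_induction_on generalizing v with
  | _ u ih =>
  have hv : v % 2 = 1 := by
    by_contra hcon
    obtain ⟨y, rfl⟩ : ∃ y, v = 2 * y := ⟨v / 2, by omega⟩
    rw [mul_pow] at h; omega
  obtain ⟨c, hc⟩ := exists_sq_eq_of_odd hv
  have hu : u % 2 = 0 := by
    by_contra hcon
    obtain ⟨e, he⟩ := exists_sq_eq_of_odd (t := u ^ 2)
      (by rw [Nat.pow_mod]; simp [show u % 2 = 1 by omega])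
    norm_num [← pow_mul] at he
    omega
  obtain ⟨w, rfl⟩ := Nat.dvd_of_mod_eq_zero hu
  obtain ⟨m, rfl⟩ : ∃ m, v = 2 * m + 1 := ⟨v / 2, by omega⟩
  have hm : m * (m + 1) = 600 * w ^ 4 := by linarith
  obtain ⟨d, e, s, t, h1, h2, rfl, hde⟩ := exists_split_six_hundred (Nat.coprime_self_add_right.2 (Nat.coprime_one_right m)) hm
  have hst : e * t ^ 4 = d * s ^ 4 + 1 := by rw [← h1, ← h2]
  have hde' : (d = 600 ∧ e = 1) ∨ (d = 24 ∧ e = 25) := by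
    clear ih h hm hc hv hu h1 h2
    rcases hde with h | ⟨rfl, rfl⟩ | ⟨rfl, rfl⟩ | ⟨rfl, rfl⟩ | ⟨rfl, rfl⟩ | ⟨rfl, rfl⟩ |
      h | ⟨rfl, rfl⟩
    · exact Or.inl h
    · have := pow_four_mod_three s; omega
    · have := pow_four_mod_five s; omega
    · have := pow_four_mod_five t; omega
    · have := pow_four_mod_five s; omega
    · have := pow_four_mod_five t; omega
    · exact Or.inr h
    · have := pow_four_mod_three s; omega
  rcases hde' with ⟨rfl, rfl⟩ | ⟨rfl, rfl⟩
  · have ht : t ^ 4 = 600 * s ^ 4 + 1 := by omega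
    have ht4 : t ^ 4 = t ^ 2 * t ^ 2 := by ring
    have hodd : t % 2 = 1 := by
      by_contra hcon
      obtain ⟨y, rfl⟩ : ∃ y, t = 2 * y := ⟨t / 2, by omega⟩
      rw [mul_pow] at ht; omega
    obtain ⟨c, hc⟩ := exists_sq_eq_of_odd hodd
    have hc3 : c % 3 = 0 := by
      have := sq_mod_three t
      have hne : t ^ 2 % 3 ≠ 0 := by
        intro h0
        obtain ⟨e, he⟩ := Nat.dvd_of_mod_eq_zero h0
        rw [ht4, he] at ht
        have : 3 * e * (3 * e) = 3 * (e * (3 * e)) := by ring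
        omega
      omega
    have hs : 2 * (c * (4 * c + 1)) = 75 * s ^ 4 := by
      rw [ht4, hc] at ht; nlinarith
    have hse : s % 2 = 0 := by
      by_contra hcon
      obtain ⟨e, he⟩ := exists_sq_eq_of_odd (t := s ^ 2)
        (by rw [Nat.pow_mod]; simp [show s % 2 = 1 by omega])
      norm_num [← pow_mul] at he
      omega
    obtain ⟨r, rfl⟩ := Nat.dvd_of_mod_eq_zero hse
    have hr : c * (4 * c + 1) = 600 * r ^ 4 := by linarith
    have hcop : c.Coprime (4 * c + 1) := by simp
    obtain ⟨d, e, p, q, h3, h4, rfl, hde⟩ := exists_split_six_hundred hcop hr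
    have hpq : e * q ^ 4 = 4 * (d * p ^ 4) + 1 := by rw [← h3, ← h4]
    obtain ⟨rfl, rfl⟩ : d = 600 ∧ e = 1 := by
      rw [h3] at hc3
      clear ih h hm hc h1 h2 ht hst hr hs h3 h4 hcop
      rcases hde with h | ⟨rfl, rfl⟩ | ⟨rfl, rfl⟩ | ⟨rfl, rfl⟩ | ⟨rfl, rfl⟩ | ⟨rfl, rfl⟩ |
        ⟨rfl, rfl⟩ | ⟨rfl, rfl⟩
      · exact h
      · omega
      · have := pow_four_mod_five p; omega
      · omega
      · omega
      · omega
      · have := pow_four_mod_sixteen q; omega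
      · omega
    rcases Nat.eq_zero_or_pos p with rfl | hp
    · simp
    have hq0 : 0 < q := Nat.pos_of_ne_zero (by rintro rfl; omega)
    have ht0 : 0 < t := by omega
    have hlt : 2 * p < 2 * (2 * (p * q) * t) := by nlinarith [Nat.mul_pos hp hq0, mul_pos (mul_pos hp hq0) ht0, Nat.mul_le_mul (Nat.mul_le_mul (le_refl p) hq0) ht0]
    rcases ih (2 * p) hlt (v := q ^ 2) (by rw [← pow_mul, mul_pow]; norm_num; omega) with h0 | h0
    · omega
    · obtain rfl : p = 1 := by omega
      have : t ^ 2 = 4801 := by omega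
      have h69 : 69 < t := by nlinarith
      have h70 : t < 70 := by nlinarith
      omega
  · obtain ⟨hs, ht⟩ := pow_four_eq_one_of_twentyfive (s := s) (t := t) (by omega)
    right
    rw [Nat.pow_eq_one.1 hs |>.resolve_right (by norm_num),
      Nat.pow_eq_one.1 ht |>.resolve_right (by norm_num)]

end FiveCubes

/-! ### Units of relative norm one in biquadratic towers -/

namespace Skolem

/-- Powers of `1 + 2δ` stay away from `1` in a controlled way, as measured by a functional `f`
which is odd at `δ` and even at `δ²`. -/
theorem exists_one_add_two_mul_pow_eq {S : Type*} [CommRing S] (f : S →+ ℤ) {δ : S}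
    (h1 : Odd (f δ)) (h2 : Even (f (δ * δ))) {b : ℕ} (hb : b ≠ 0) :
    ∃ (N : ℤ) (e : S), N ≠ 0 ∧ (1 + 2 * δ) ^ b = 1 + 2 * (N : S) * e ∧ Odd (f e) := by
  have hf2 : ∀ x : S, f (2 * x) = 2 * f x := fun x => by rw [two_mul, map_add, two_mul]
  have hpow : ∀ s : ℕ, ∃ e : S, (1 + 2 * δ) ^ 2 ^ (s + 1) = 1 + 2 ^ (s + 2) * e ∧ Odd (f e) := by
    intro s
    induction s with
    | zero => exact ⟨δ + δ * δ, by ring, by rw [map_add]; exact h1.add_even h2⟩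
    | succ s ih =>
      obtain ⟨e, he, hodd⟩ := ih
      refine ⟨e + 2 * (2 ^ s * e ^ 2), ?_, ?_⟩
      · rw [pow_succ 2 (s + 1), pow_mul, he]; ring
      · rw [map_add, hf2]; exact hodd.add_even (even_two_mul _)
  have hpow' : ∃ (N : ℤ) (e : S), N ≠ 0 ∧
      (1 + 2 * δ) ^ 2 ^ b.factorization 2 = 1 + 2 * (N : S) * e ∧ Odd (f e) := by
    rcases h : b.factorization 2 with _ | s
    · exact ⟨1, δ, one_ne_zero, by simp, h1⟩
    · obtain ⟨e, he, hodd⟩ := hpow s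
      exact ⟨2 ^ (s + 1), e, by positivity, by rw [he]; push_cast; ring, hodd⟩
  obtain ⟨N, e, hN, he, hodd⟩ := hpow'
  obtain ⟨k, hk⟩ : Odd (b / 2 ^ b.factorization 2) := by
    rw [← Nat.not_even_iff_odd, even_iff_two_dvd]
    exact Nat.not_dvd_ordCompl Nat.prime_two hb
  obtain ⟨g, hg⟩ : (4 * (N : S) * (e + N * e ^ 2)) ∣ (1 + 4 * (N : S) * (e + N * e ^ 2)) ^ k - 1 := by
    have h := sub_dvd_pow_sub_pow (1 + 4 * (N : S) * (e + N * e ^ 2)) 1 k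
    rwa [add_sub_cancel_left, one_pow] at h
  refine ⟨N, e + 2 * ((e + N * e ^ 2) * g * (1 + 2 * N * e)), hN, ?_, ?_⟩
  · rw [← Nat.ordProj_mul_ordCompl_eq_self b 2, pow_mul, he, hk, pow_succ, pow_mul,
      show (1 + 2 * (N : S) * e) ^ 2 = 1 + 4 * (N : S) * (e + N * e ^ 2) by ring,
      eq_add_of_sub_eq hg]
    ring
  · rw [map_add, hf2]; exact hodd.add_even (even_two_mul _)

theorem eq_zpow_of_pos {U : Type*} [CommGroup U] (σ : U →* ℝ) {μ : U} (hμ : 1 < σ μ)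
    (hmin : ∀ x, 1 ≤ σ x → σ x ^ 2 ≤ σ μ → x = 1) {x : U} (hx : 0 < σ x) :
    ∃ b : ℤ, x = μ ^ b := by
  have hμ0 : 0 < σ μ := zero_lt_one.trans hμ
  have hinv : ∀ y, σ y * σ y⁻¹ = 1 := fun y => by rw [← map_mul, mul_inv_cancel, map_one]
  have hzpow : ∀ b : ℤ, σ (μ ^ b) = σ μ ^ b := by
    intro b
    have hn : ∀ n : ℕ, σ (μ ^ n) = σ μ ^ n := map_pow σ μ
    cases b with
    | ofNat n => simp
    | negSucc n =>
      rw [zpow_negSucc, zpow_negSucc, ← hn]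
      exact eq_inv_of_mul_eq_one_right (hinv _)
  obtain ⟨b, hb1, hb2⟩ := exists_mem_Ico_zpow hx hμ
  have hb0 : 0 < σ μ ^ b := zpow_pos hμ0 b
  have ht : σ μ ^ b * σ (x * (μ ^ b)⁻¹) = σ x := by
    rw [map_mul, ← hzpow, mul_left_comm, hinv, mul_one]
  rw [zpow_add_one₀ hμ0.ne'] at hb2
  generalize hT : x * (μ ^ b)⁻¹ = t at ht
  have ht1 : 1 ≤ σ t := by rw [← ht] at hb1; exact le_of_mul_le_mul_left (by simpa using hb1) hb0
  have ht2 : σ t < σ μ := by rw [← ht] at hb2; exact lt_of_mul_lt_mul_left hb2 hb0.le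
  by_cases h : σ t ^ 2 ≤ σ μ
  · rw [hmin t ht1 h, mul_inv_eq_one] at hT
    exact ⟨b, hT⟩
  · have hs : σ t * σ (μ * t⁻¹) = σ μ := by rw [map_mul, mul_left_comm, hinv, mul_one]
    have hs1 : 1 ≤ σ (μ * t⁻¹) := by nlinarith
    have hs2 : σ (μ * t⁻¹) ^ 2 ≤ σ μ := by
      have : σ μ * σ (μ * t⁻¹) ^ 2 ≤ σ μ * σ μ := by
        calc _ ≤ σ t ^ 2 * σ (μ * t⁻¹) ^ 2 := by gcongr; exact (not_le.mp h).le
          _ = σ μ * σ μ := by rw [← mul_pow, hs, sq]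
      exact le_of_mul_le_mul_left this hμ0
    have h1 := hmin _ hs1 hs2
    rw [mul_inv_eq_one, ← hT, eq_mul_inv_iff_mul_eq] at h1
    exact ⟨b + 1, by rw [zpow_add_one, ← h1, mul_comm]⟩

/-- `ℤ[√n][√(c + √n)]`. -/
abbrev Tower (n c : ℤ) := QuadraticAlgebra (ℤ√n) ⟨c, 1⟩ 0

namespace Tower
open QuadraticAlgebra

variable {n c : ℤ}

/-- The value of an element of the tower at real roots. -/
def realVal (r θ : ℝ) (x : Tower n c) : ℝ :=
  (x.re.re + x.re.im * r) + (x.im.re + x.im.im * r) * θ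

theorem realVal_mul {r θ : ℝ} (hr : r ^ 2 = n) (hθ : θ ^ 2 = c + r) (x y : Tower n c) :
    realVal r θ (x * y) = realVal r θ x * realVal r θ y := by
  simp only [realVal, re_mul, im_mul, Zsqrtd.re_mul, Zsqrtd.im_mul, Zsqrtd.re_add, Zsqrtd.im_add,
    Zsqrtd.re_zero, Zsqrtd.im_zero]
  push_cast
  linear_combination (-(x.im.re + x.im.im * r) * (y.im.re + y.im.im * r) : ℝ) * hθ +
    (-(x.re.im * y.re.im + (c + r) * x.im.im * y.im.im
      + θ * (x.re.im * y.im.im + x.im.im * y.re.im)) - x.im.re * y.im.im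
      - x.im.im * y.im.re : ℝ) * hr

/-- A linear functional of the coefficient of `√(c + √n)`. -/
def imCoord (t : ℤ) : Tower n c →+ ℤ where
  toFun x := x.im.re + t * x.im.im
  map_zero' := by simp
  map_add' x y := by simp only [im_add, Zsqrtd.re_add, Zsqrtd.im_add]; ring

theorem eq_one_or_neg_one {t : ℤ} {r θ : ℝ} (hr : r ^ 2 = n) (hθ : θ ^ 2 = c + r) {δ : Tower n c}
    (hμ : norm (1 + 2 * δ) = 1) (hμ1 : 1 < realVal r θ (1 + 2 * δ))
    (hmin : ∀ x : Tower n c, norm x = 1 → 1 ≤ realVal r θ x →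
      realVal r θ x ^ 2 ≤ realVal r θ (1 + 2 * δ) → x = 1)
    (h1 : Odd (imCoord t δ)) (h2 : Even (imCoord t (δ * δ)))
    {G : Tower n c → ℤ} (hneg : ∀ x, G (-x) = G x)
    (hG : ∀ (N : ℤ) (e : Tower n c), Odd (imCoord t e) → ∃ k : ℤ,
      G (1 + 2 * (N : Tower n c) * e) = 2 * N * (2 * k + 1))
    {x : Tower n c} (hx : norm x = 1) (hGx : G x = 0) : x = 1 ∨ x = -1 := by
  have key : ∀ ε : Tower n c, Odd (imCoord t ε) → Even (imCoord t (ε * ε)) → ∀ b : ℕ,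
      G ((1 + 2 * ε) ^ b) = 0 → b = 0 := by
    intro ε h1 h2 b hb
    by_contra hb0
    obtain ⟨N, e, hN, he, hodd⟩ := exists_one_add_two_mul_pow_eq (imCoord (n := n) (c := c) t)
      (δ := ε) h1 h2 hb0
    obtain ⟨k, hk⟩ := hG N e hodd
    rw [he, hk] at hb
    have : 2 * k + 1 ≠ 0 := by omega
    exact mul_ne_zero (mul_ne_zero two_ne_zero hN) this hb
  have hstar : ∀ x : Tower n c, imCoord t (star x) = -imCoord t x := fun x => by
    simp only [imCoord, AddMonoidHom.coe_mk, ZeroHom.coe_mk, im_star, Zsqrtd.re_neg, Zsqrtd.im_neg]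
    ring
  have hs1 : Odd (imCoord t (star δ)) := by rw [hstar]; exact h1.neg
  have hs2 : Even (imCoord t (star δ * star δ)) := by
    rw [← star_mul', hstar]; exact h2.neg
  let σ : unitary (Tower n c) →* ℝ :=
    { toFun x := realVal r θ (x : Tower n c)
      map_one' := by simp [realVal]
      map_mul' x y := realVal_mul hr hθ _ _ }
  let μ : unitary (Tower n c) := ⟨1 + 2 * δ, norm_eq_one_iff_mem_unitary.mp hμ⟩
  have pos : ∀ y : Tower n c, norm y = 1 → G y = 0 → 0 < realVal r θ y → y = 1 := by
    intro y hy hGy hpos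
    obtain ⟨b, hb⟩ := eq_zpow_of_pos σ (μ := μ) hμ1
      (fun x h1 h2 => Subtype.ext (hmin x (norm_eq_one_iff_mem_unitary.mpr x.2) h1 h2))
      (x := ⟨y, norm_eq_one_iff_mem_unitary.mp hy⟩) hpos
    obtain ⟨m, rfl | rfl⟩ := b.eq_nat_or_neg
    · have hb' : y = (1 + 2 * δ) ^ m := by
        have := congrArg Subtype.val hb
        simpa using this
      rw [hb'] at hGy
      rw [hb', key δ h1 h2 m hGy, pow_zero]
    · have hb' : y = (1 + 2 * star δ) ^ m := by
        have := congrArg Subtype.val hb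
        rw [zpow_neg, zpow_natCast, ← inv_pow] at this
        simpa [μ, ← Unitary.star_eq_inv, star_add] using this
      rw [hb'] at hGy
      rw [hb', key _ hs1 hs2 m hGy, pow_zero]
  have hne : realVal r θ x ≠ 0 := by
    intro h0
    have h := congrArg (realVal r θ) (show x * star x = 1 by
      rw [← algebraMap_norm_eq_mul_star, hx, map_one])
    rw [realVal_mul hr hθ, h0, zero_mul] at h
    simp [realVal] at h
  rcases hne.lt_or_gt with h | h
  · right
    have := pos (-x) (by rw [QuadraticAlgebra.norm_neg, hx]) (by rw [hneg, hGx]) (by simp [realVal] at h ⊢; linarith)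
    rw [← this, neg_neg]
  · exact Or.inl (pos x hx hGx h)

end Tower
end Skolem

namespace Skolem
namespace Tower
open QuadraticAlgebra

variable {n c : ℤ}

theorem norm_eq_one_iff {x : Tower n c} : norm x = 1 ↔
    x.re.re ^ 2 + n * x.re.im ^ 2 - c * (x.im.re ^ 2 + n * x.im.im ^ 2)
        - 2 * n * (x.im.re * x.im.im) = 1 ∧
      2 * (x.re.re * x.re.im) - 2 * c * (x.im.re * x.im.im)
        - (x.im.re ^ 2 + n * x.im.im ^ 2) = 0 := by
  rw [norm_def, Zsqrtd.ext_iff]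
  simp only [Zsqrtd.re_sub, Zsqrtd.re_add, Zsqrtd.re_mul, Zsqrtd.im_mul, Zsqrtd.im_sub,
    Zsqrtd.im_add, Zsqrtd.re_zero, Zsqrtd.im_zero, Zsqrtd.re_one, Zsqrtd.im_one]
  constructor <;> rintro ⟨h1, h2⟩ <;> constructor <;> linarith

theorem bounds_of_norm_eq_one {r θ s : ℝ} (hr : r ^ 2 = n) (hθ : θ ^ 2 = c + r) {x : Tower n c}
    (hx : norm x = 1) (h1 : 1 ≤ realVal r θ x) (hs : realVal r θ x ≤ s) :
    0 ≤ x.re.re + x.re.im * r ∧ 2 * (x.re.re + x.re.im * r) ≤ s + 1 ∧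
      0 ≤ (x.im.re + x.im.im * r) * θ ∧ 2 * ((x.im.re + x.im.im * r) * θ) ≤ s ∧
      (x.re.re - x.re.im * r) ^ 2 + (r - c) * (x.im.re - x.im.im * r) ^ 2 = 1 := by
  obtain ⟨e1, e2⟩ := norm_eq_one_iff.mp hx
  have e1' := congrArg (Int.cast : ℤ → ℝ) e1
  have e2' := congrArg (Int.cast : ℤ → ℝ) e2
  push_cast at e1' e2'
  unfold realVal at h1 hs
  set A : ℝ := x.re.re + x.re.im * r with hA
  set B : ℝ := x.im.re + x.im.im * r with hB
  have hprod : (A + B * θ) * (A - B * θ) = 1 := by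
    rw [hA, hB]
    linear_combination e1' + r * e2' - (x.im.re + x.im.im * r) ^ 2 * hθ
      + (x.re.im ^ 2 - x.im.im ^ 2 * (c + r) : ℝ) * hr
      - (2 * (x.im.re * x.im.im) : ℝ) * hr
  have hpos : 0 < A - B * θ := by
    by_contra! h; nlinarith
  have hle : A - B * θ ≤ 1 := by nlinarith
  refine ⟨by linarith, by linarith, by linarith, by linarith, ?_⟩
  linear_combination e1' - r * e2' + (x.re.im ^ 2 + x.im.im ^ 2 * (r - c) : ℝ) * hr
      - (2 * (x.im.re * x.im.im) : ℝ) * hr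

theorem eq_one_of_realVal_le {r θ s t R : ℝ} {K₁ K₂ K₃ K₄ : ℕ} (hr : r ^ 2 = n)
    (hθ : θ ^ 2 = c + r) (hr3 : 3 < r) (ht : 0 < t) (htθ : t ≤ θ) (hR0 : 0 ≤ R) (hR2 : R < 2)
    (hR : 1 ≤ R ^ 2 * (r - c)) (hcr : c < r) (hK₁ : s + 3 < 4 * K₁) (hK₂ : s + 3 < 12 * K₂)
    (hK₃ : s + 2 * t * R < 4 * t * K₃) (hK₄ : s + 2 * t * R < 12 * t * K₄)
    (hfin : ∀ (a₁ : Fin K₁) (a₂ : Fin K₂) (b₁ : Fin K₃) (b₂ : Fin K₄),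
      norm (⟨⟨(a₁ : ℕ), (a₂ : ℕ)⟩, ⟨(b₁ : ℕ), (b₂ : ℕ)⟩⟩ : Tower n c) = 1 →
      (a₁ : ℕ) = 1 ∧ (a₂ : ℕ) = 0 ∧ (b₁ : ℕ) = 0 ∧ (b₂ : ℕ) = 0)
    {x : Tower n c} (hx : norm x = 1) (h1 : 1 ≤ realVal r θ x) (hs : realVal r θ x ≤ s) :
    x = 1 := by
  obtain ⟨hA0, hA1, hB0, hB1, hc⟩ := bounds_of_norm_eq_one hr hθ hx h1 hs
  obtain ⟨⟨a1, a2⟩, ⟨b1, b2⟩⟩ := x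
  dsimp only at *
  have hcr' : 0 < r - c := sub_pos.mpr hcr
  have hB0' : 0 ≤ b1 + b2 * r := nonneg_of_mul_nonneg_left hB0 (ht.trans_le htθ)
  have hB1' : 2 * (t * (b1 + b2 * r)) ≤ s := by nlinarith
  obtain ⟨hA2, hA3⟩ : -1 ≤ a1 - a2 * r ∧ a1 - a2 * r ≤ 1 :=
    abs_le.mp ((sq_le_one_iff_abs_le_one _).mp (by nlinarith [sq_nonneg (b1 - b2 * r : ℝ)]))
  obtain ⟨hB2, hB3⟩ : -R ≤ b1 - b2 * r ∧ b1 - b2 * r ≤ R := by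
    refine abs_le_of_sq_le_sq' (le_of_mul_le_mul_left ?_ hcr') hR0
    nlinarith [sq_nonneg (a1 - a2 * r : ℝ)]
  have htB : t * (b1 - b2 * r) ≤ t * R := by gcongr
  have htB' : -(t * R) ≤ t * (b1 - b2 * r) := by rw [← mul_neg]; gcongr
  have ha1 : 0 ≤ a1 ∧ a1 < K₁ := by
    constructor
    · have : (-1 : ℝ) < a1 := by linarith
      exact_mod_cast this
    · have : (a1 : ℝ) < K₁ := by linarith
      exact_mod_cast this
  have ha2 : 0 ≤ a2 ∧ a2 < K₂ := by
    constructor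
    · have : (-1 : ℝ) < a2 := by
        by_contra! h
        have h2 : (a2 : ℝ) * r ≤ -1 * r := by gcongr
        linarith
      exact_mod_cast this
    · have : (a2 : ℝ) < K₂ := by
        by_contra! h
        have h2 : (K₂ : ℝ) * 3 ≤ a2 * r := by gcongr; exact K₂.cast_nonneg.trans h
        linarith
      exact_mod_cast this
  have hb1 : 0 ≤ b1 ∧ b1 < K₃ := by
    constructor
    · have : (-1 : ℝ) < b1 := by linarith
      exact_mod_cast this
    · have : (b1 : ℝ) < K₃ := lt_of_mul_lt_mul_left (by linarith) ht.le
      exact_mod_cast this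
  have hb2 : 0 ≤ b2 ∧ b2 < K₄ := by
    constructor
    · have : (-1 : ℝ) < b2 := by
        by_contra! h
        have h2 : (b2 : ℝ) * r ≤ -1 * r := by gcongr
        linarith
      exact_mod_cast this
    · have : (b2 : ℝ) < K₄ := by
        by_contra! h
        have h2 : t * ((K₄ : ℝ) * 3) ≤ t * (b2 * r) := by
          gcongr; exact K₄.cast_nonneg.trans h
        linarith
      exact_mod_cast this
  clear * - hfin hx ha1 ha2 hb1 hb2
  lift a1 to ℕ using ha1.1
  lift a2 to ℕ using ha2.1
  lift b1 to ℕ using hb1.1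
  lift b2 to ℕ using hb2.1
  norm_cast at ha1 ha2 hb1 hb2
  obtain ⟨h1, h2, h3, h4⟩ := hfin ⟨a1, ha1.2⟩ ⟨a2, ha2.2⟩ ⟨b1, hb1.2⟩ ⟨b2, hb2.2⟩ hx
  dsimp only at h1 h2 h3 h4
  rw [h1, h2, h3, h4]
  rfl

/-- Uniqueness of the zero `±1` of a function on the units of relative norm one in
`ℤ[√10][√(2 + √10)]`. -/
theorem eq_one_or_neg_one_ten {G : Tower 10 2 → ℤ} (hneg : ∀ x, G (-x) = G x)
    (hG : ∀ (N : ℤ) (e : Tower 10 2), Odd (imCoord 0 e) → ∃ k : ℤ,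
      G (1 + 2 * (N : Tower 10 2) * e) = 2 * N * (2 * k + 1))
    {x : Tower 10 2} (hx : norm x = 1) (hGx : G x = 0) : x = 1 ∨ x = -1 := by
  have hr : √10 ^ 2 = ((10 : ℤ) : ℝ) := by norm_num
  have hr0 := Real.sqrt_nonneg 10
  generalize √10 = r at *
  have hr' : r ^ 2 = 10 := by simpa using hr
  have hr1 : 3.16 < r := by nlinarith
  have hr2 : r < 3.17 := by nlinarith
  have hθ : √(2 + r) ^ 2 = ((2 : ℤ) : ℝ) + r := by
    rw [Real.sq_sqrt (by linarith)]; norm_num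
  have hθ0 := Real.sqrt_nonneg (2 + r)
  generalize √(2 + r) = θ at *
  have hθ' : θ ^ 2 = 2 + r := by simpa using hθ
  have hθ1 : 2.27 < θ := by nlinarith
  have hθ2 : θ < 2.28 := by nlinarith
  have hval : realVal r θ (1 + 2 * ⟨⟨79, 25⟩, ⟨35, 11⟩⟩ : Tower 10 2) =
      159 + 50 * r + (70 + 22 * r) * θ := by
    simp [realVal]
  have h26 : realVal r θ (1 + 2 * ⟨⟨79, 25⟩, ⟨35, 11⟩⟩ : Tower 10 2) ≤ 26 ^ 2 := by
    rw [hval]; nlinarith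
  refine eq_one_or_neg_one hr hθ (δ := ⟨⟨79, 25⟩, ⟨35, 11⟩⟩) (by decide) ?_ ?_ (by decide)
    (by decide) hneg hG hx hGx
  · rw [hval]; nlinarith
  · intro x hx h1 h2
    refine eq_one_of_realVal_le (s := 26) (t := 2.27) (R := 0.94) (K₁ := 8) (K₂ := 3) (K₃ := 4)
      (K₄ := 2) hr hθ (by linarith) (by norm_num) hθ1.le (by norm_num) (by norm_num) ?_ ?_
      (by norm_num) (by norm_num) (by norm_num) (by norm_num) (by decide +kernel) hx h1
      (abs_le_of_sq_le_sq' (h2.trans h26) (by norm_num)).2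
    · push_cast; linarith
    · push_cast; linarith

/-- Uniqueness of the zero `±1` of a function on the units of relative norm one in
`ℤ[√15][√(-3 + √15)]`. -/
theorem eq_one_or_neg_one_fifteen {G : Tower 15 (-3) → ℤ} (hneg : ∀ x, G (-x) = G x)
    (hG : ∀ (N : ℤ) (e : Tower 15 (-3)), Odd (imCoord 1 e) → ∃ k : ℤ,
      G (1 + 2 * (N : Tower 15 (-3)) * e) = 2 * N * (2 * k + 1))
    {x : Tower 15 (-3)} (hx : norm x = 1) (hGx : G x = 0) : x = 1 ∨ x = -1 := by
  have hr : √15 ^ 2 = ((15 : ℤ) : ℝ) := by norm_num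
  have hr0 := Real.sqrt_nonneg 15
  generalize √15 = r at *
  have hr' : r ^ 2 = 15 := by simpa using hr
  have hr1 : 3.87 < r := by nlinarith
  have hr2 : r < 3.88 := by nlinarith
  have hθ : √(-3 + r) ^ 2 = ((-3 : ℤ) : ℝ) + r := by
    rw [Real.sq_sqrt (by linarith)]; norm_num
  have hθ0 := Real.sqrt_nonneg (-3 + r)
  generalize √(-3 + r) = θ at *
  have hθ' : θ ^ 2 = -3 + r := by simpa using hθ
  have hθ1 : 0.93 < θ := by nlinarith
  have hθ2 : θ < 0.94 := by nlinarith
  have hval : realVal r θ (1 + 2 * ⟨⟨3, 1⟩, ⟨4, 1⟩⟩ : Tower 15 (-3)) =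
      7 + 2 * r + (8 + 2 * r) * θ := by
    simp [realVal]
  have h26 : realVal r θ (1 + 2 * ⟨⟨3, 1⟩, ⟨4, 1⟩⟩ : Tower 15 (-3)) ≤ 5.5 ^ 2 := by
    rw [hval]; nlinarith
  refine eq_one_or_neg_one hr hθ (δ := ⟨⟨3, 1⟩, ⟨4, 1⟩⟩) (by decide) ?_ ?_ (by decide)
    (by decide) hneg hG hx hGx
  · rw [hval]; nlinarith
  · intro x hx h1 h2
    refine eq_one_of_realVal_le (s := 5.5) (t := 0.93) (R := 0.39) (K₁ := 3) (K₂ := 1) (K₃ := 2)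
      (K₄ := 1) hr hθ (by linarith) (by norm_num) hθ1.le (by norm_num) (by norm_num) ?_ ?_
      (by norm_num) (by norm_num) (by norm_num) (by norm_num) (by decide +kernel) hx h1
      (abs_le_of_sq_le_sq' (h2.trans h26) (by norm_num)).2
    · push_cast; linarith
    · push_cast; linarith

/-- Uniqueness of the zero `±1` of a function on the units of relative norm one in
`ℤ[√15][√(3 + √15)]`. -/
theorem eq_one_or_neg_one_fifteen' {G : Tower 15 3 → ℤ} (hneg : ∀ x, G (-x) = G x)
    (hG : ∀ (N : ℤ) (e : Tower 15 3), Odd (imCoord 1 e) → ∃ k : ℤ,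
      G (1 + 2 * (N : Tower 15 3) * e) = 2 * N * (2 * k + 1))
    {x : Tower 15 3} (hx : norm x = 1) (hGx : G x = 0) : x = 1 ∨ x = -1 := by
  have hr : √15 ^ 2 = ((15 : ℤ) : ℝ) := by norm_num
  have hr0 := Real.sqrt_nonneg 15
  generalize √15 = r at *
  have hr' : r ^ 2 = 15 := by simpa using hr
  have hr1 : 3.87 < r := by nlinarith
  have hr2 : r < 3.88 := by nlinarith
  have hθ : √(3 + r) ^ 2 = ((3 : ℤ) : ℝ) + r := by
    rw [Real.sq_sqrt (by linarith)]; norm_num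
  have hθ0 := Real.sqrt_nonneg (3 + r)
  generalize √(3 + r) = θ at *
  have hθ' : θ ^ 2 = 3 + r := by simpa using hθ
  have hθ1 : 2.62 < θ := by nlinarith
  have hθ2 : θ < 2.63 := by nlinarith
  have hval : realVal r θ (1 + 2 * ⟨⟨243, 63⟩, ⟨93, 24⟩⟩ : Tower 15 3) =
      487 + 126 * r + (186 + 48 * r) * θ := by
    simp [realVal]
  have h26 : realVal r θ (1 + 2 * ⟨⟨243, 63⟩, ⟨93, 24⟩⟩ : Tower 15 3) ≤ 45 ^ 2 := by
    rw [hval]; nlinarith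
  refine eq_one_or_neg_one hr hθ (δ := ⟨⟨243, 63⟩, ⟨93, 24⟩⟩) (by decide) ?_ ?_ (by decide)
    (by decide) hneg hG hx hGx
  · rw [hval]; nlinarith
  · intro x hx h1 h2
    refine eq_one_of_realVal_le (s := 45) (t := 2.62) (R := 1.08) (K₁ := 13) (K₂ := 5) (K₃ := 5)
      (K₄ := 2) hr hθ (by linarith) (by norm_num) hθ1.le (by norm_num) (by norm_num) ?_ ?_
      (by norm_num) (by norm_num) (by norm_num) (by norm_num) (by decide +kernel) hx h1
      (abs_le_of_sq_le_sq' (h2.trans h26) (by norm_num)).2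
    · push_cast; linarith
    · push_cast; linarith

end Tower
end Skolem

namespace FiveCubes
open Skolem Tower QuadraticAlgebra

theorem isFundamental_ten :
    Pell.IsFundamental (Pell.Solution₁.mk (d := 10) 19 6 (by norm_num)) := by
  refine ⟨by simp, by simp, fun {b} hb => ?_⟩
  have h := b.prop
  by_contra! hlt
  simp only [Pell.Solution₁.x_mk] at hlt
  generalize b.x = x at *
  generalize b.y = y at *
  have hy : y ^ 2 ≤ 33 := by nlinarith
  have hy1 : y ≤ 5 := by nlinarith
  have hy2 : -5 ≤ y := by nlinarith
  interval_cases x <;> interval_cases y <;> simp at h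

theorem isFundamental_fifteen :
    Pell.IsFundamental (Pell.Solution₁.mk (d := 15) 4 1 (by norm_num)) := by
  refine ⟨by simp, by simp, fun {b} hb => ?_⟩
  have h := b.prop
  by_contra! hlt
  simp only [Pell.Solution₁.x_mk] at hlt
  generalize b.x = x at *
  generalize b.y = y at *
  have hy1 : y ≤ 1 := by nlinarith
  have hy2 : -1 ≤ y := by nlinarith
  interval_cases x <;> interval_cases y <;> simp at h

theorem eq_zpow_of_isFundamental {d : ℤ} {a w : Pell.Solution₁ d} (h : Pell.IsFundamental a)
    (hw : 0 < w.x) : ∃ j : ℤ, w = a ^ j := by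
  obtain ⟨j, hj | hj⟩ := h.eq_zpow_or_neg_zpow w
  · exact ⟨j, hj⟩
  · have := Pell.Solution₁.x_zpow_pos h.x_pos j
    rw [hj, Pell.Solution₁.x_neg] at hw
    omega

theorem exists_sq_mul_eq_one_ten {w : ℤ√10} (hw : w.norm = 1) (hre : 0 < w.re) :
    ∃ κ : ℤ√10, κ * κ * w = 1 ∧ (κ.norm = 1 ∨ κ.norm = -1) := by
  obtain ⟨j, hj⟩ := eq_zpow_of_isFundamental isFundamental_ten
    (w := Pell.Solution₁.mk w.re w.im (by rw [Zsqrtd.norm_def] at hw; linarith)) (by simpa using hre)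
  have hn : ∀ (ε : ℤ√10) (m : ℕ), ε.norm = -1 → (ε ^ m).norm = 1 ∨ (ε ^ m).norm = -1 := by
    intro ε m hε
    rw [show (ε ^ m).norm = ε.norm ^ m from map_pow Zsqrtd.normMonoidHom ε m, hε]
    exact neg_one_pow_eq_or ℤ m
  obtain ⟨m, rfl | rfl⟩ := j.eq_nat_or_neg
  · refine ⟨⟨-3, 1⟩ ^ m, ?_, hn _ m (by decide)⟩
    have hw' : w = ⟨19, 6⟩ ^ m := by
      have := congrArg Subtype.val hj
      rw [zpow_natCast] at this
      exact this
    rw [hw', ← mul_pow, ← mul_pow, show (⟨-3, 1⟩ * ⟨-3, 1⟩ * ⟨19, 6⟩ : ℤ√10) = 1 by decide, one_pow]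
  · refine ⟨⟨3, 1⟩ ^ m, ?_, hn _ m (by decide)⟩
    have hw' : w = ⟨19, -6⟩ ^ m := by
      have := congrArg Subtype.val hj
      rw [zpow_neg, zpow_natCast, ← inv_pow] at this
      exact this
    rw [hw', ← mul_pow, ← mul_pow, show (⟨3, 1⟩ * ⟨3, 1⟩ * ⟨19, -6⟩ : ℤ√10) = 1 by decide, one_pow]

theorem exists_sq_mul_eq_fifteen {w : ℤ√15} (hw : w.norm = 1) (hre : 0 < w.re) :
    ∃ κ : ℤ√15, (κ * κ * w = 1 ∨ κ * κ * w = ⟨4, -1⟩) ∧ κ.norm = 1 := by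
  obtain ⟨j, hj⟩ := eq_zpow_of_isFundamental isFundamental_fifteen
    (w := Pell.Solution₁.mk w.re w.im (by rw [Zsqrtd.norm_def] at hw; linarith)) (by simpa using hre)
  set a := Pell.Solution₁.mk (d := 15) 4 1 (by norm_num) with ha
  set W := Pell.Solution₁.mk (d := 15) w.re w.im (by rw [Zsqrtd.norm_def] at hw; linarith)
  have hk : ∀ k : ℤ, ((a ^ k : Pell.Solution₁ 15) : ℤ√15).norm = 1 := fun k => by
    rw [Zsqrtd.norm_def]
    have := (a ^ k).prop
    simp only [Pell.Solution₁.x, Pell.Solution₁.y] at this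
    linarith
  refine ⟨(a ^ (-((j + 1) / 2)) : Pell.Solution₁ 15), ?_, hk _⟩
  have hval : ((a ^ (-((j + 1) / 2)) : Pell.Solution₁ 15) : ℤ√15) *
      (a ^ (-((j + 1) / 2)) : Pell.Solution₁ 15) * w =
      ((a ^ (-((j + 1) / 2)) * a ^ (-((j + 1) / 2)) * W : Pell.Solution₁ 15) : ℤ√15) := rfl
  rw [hval, hj, ← zpow_add, ← zpow_add]
  obtain h | h : -((j + 1) / 2) + -((j + 1) / 2) + j = 0 ∨
      -((j + 1) / 2) + -((j + 1) / 2) + j = -1 := by omega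
  · left; rw [h]; rfl
  · right; rw [h]; rfl

theorem norm_algebraMap_mul {n c : ℤ} (κ : ℤ√n) (ξ : Tower n c) :
    norm (algebraMap _ (Tower n c) κ * ξ) = κ * κ * norm ξ := by
  rw [map_mul, QuadraticAlgebra.norm_algebraMap, sq]

/-- A quadratic form on the tower whose vanishing characterises the elements of interest, up to
units of the base ring. -/
def pairing {n c : ℤ} (α β : ℤ√n) (x : Tower n c) : ℤ :=
  ((α * x.re + β * x.im) * star x.im).im

section pairing
variable {n c : ℤ} (α β : ℤ√n)

theorem pairing_neg (x : Tower n c) : pairing α β (-x) = pairing α β x := by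
  simp [pairing]; ring

theorem pairing_algebraMap_mul (κ : ℤ√n) (x : Tower n c) :
    pairing α β (algebraMap _ (Tower n c) κ * x) = κ.norm * pairing α β x := by
  simp [pairing, Zsqrtd.norm_def]; ring

theorem pairing_one_add (N : ℤ) (e : Tower n c) :
    pairing α β (1 + 2 * (N : Tower n c) * e) =
      2 * N * (α.im * e.im.re - α.re * e.im.im + 2 * N * pairing α β e) := by
  simp [pairing]; ring

end pairing

theorem eq_zero_of_algebraMap_mul_im {n c : ℤ} {κ : ℤ√n} {ξ : Tower n c}
    (hκ : κ.norm = 1 ∨ κ.norm = -1)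
    (h : algebraMap _ (Tower n c) κ * ξ = 1 ∨ algebraMap _ (Tower n c) κ * ξ = -1) : ξ.im = 0 := by
  have him : κ * ξ.im = 0 := by
    rcases h with h | h <;> simpa using congrArg QuadraticAlgebra.im h
  have := congrArg (star κ * ·) him
  simp only [← mul_assoc, mul_comm (star κ) κ, ← Zsqrtd.norm_eq_mul_conj, mul_zero] at this
  rcases hκ with hκ | hκ <;> simpa [hκ] using this

theorem eq_zero_of_quartic_ten {p q : ℤ}
    (h : (p ^ 2 - 10 * p * q + 15 * q ^ 2) ^ 2 - 40 * p ^ 2 * q ^ 2 = 1) : q = 0 := by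
  set ξ : Tower 10 2 := ⟨⟨p - 5 * q, -q⟩, ⟨0, q⟩⟩ with hξ
  have hnorm : norm ξ = ⟨p ^ 2 - 10 * p * q + 15 * q ^ 2, -2 * p * q⟩ := by
    rw [norm_def, hξ]
    ext <;> simp <;> ring
  have hw : (norm ξ).norm = 1 := by rw [hnorm, Zsqrtd.norm_def]; linarith
  have hre : 0 < (norm ξ).re := by
    rw [hnorm]
    dsimp only
    by_contra! hf
    nlinarith [sq_nonneg (p - 2 * q), sq_nonneg q, sq_nonneg (p * q), sq_nonneg (p - 8 * q)]
  obtain ⟨κ, hκ, hκn⟩ := exists_sq_mul_eq_one_ten hw hre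
  have hx := eq_one_or_neg_one_ten (G := pairing ⟨0, 1⟩ ⟨5, 1⟩) (pairing_neg _ _)
    (fun N e ⟨m, hm⟩ => ⟨m + N * pairing ⟨0, 1⟩ ⟨5, 1⟩ e, by
      rw [pairing_one_add]
      simp only [imCoord, AddMonoidHom.coe_mk, ZeroHom.coe_mk] at hm
      dsimp only
      linear_combination 2 * N * hm⟩)
    ((norm_algebraMap_mul κ ξ).trans hκ) (by
      rw [pairing_algebraMap_mul]
      simp [pairing, hξ])
  simpa [hξ] using congrArg Zsqrtd.im (eq_zero_of_algebraMap_mul_im hκn hx)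

theorem eq_zero_of_quartic_ten_neg {q r : ℤ}
    (h : (3 * q ^ 2 - 8 * q * r + 2 * r ^ 2) ^ 2 - 10 * (q ^ 2 + 2 * q * r) ^ 2 = -1) : r = 0 := by
  set ξ : Tower 10 2 := ⟨⟨3 * q - 4 * r, -q - r⟩, ⟨0, -r⟩⟩ with hξ
  have hnorm : norm ξ = ⟨19 * q ^ 2 - 4 * q * r + 6 * r ^ 2, -6 * q ^ 2 + 2 * q * r - 2 * r ^ 2⟩ := by
    rw [norm_def, hξ]
    ext <;> simp <;> ring
  have hw : (norm ξ).norm = 1 := by rw [hnorm, Zsqrtd.norm_def]; linarith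
  have hre : 0 < (norm ξ).re := by
    have h0 : (norm ξ).re ≠ 0 := by
      intro h0
      rw [Zsqrtd.norm_def, h0] at hw
      nlinarith [mul_self_nonneg (norm ξ).im]
    refine lt_of_le_of_ne ?_ h0.symm
    rw [hnorm]
    dsimp only
    nlinarith [sq_nonneg (q - 2 * r), sq_nonneg q, sq_nonneg r]
  obtain ⟨κ, hκ, hκn⟩ := exists_sq_mul_eq_one_ten hw hre
  have hx := eq_one_or_neg_one_ten (G := pairing ⟨10, 3⟩ ⟨-22, -7⟩) (pairing_neg _ _)
    (fun N e ⟨m, hm⟩ => ⟨3 * m + 1 - 5 * e.im.im + N * pairing ⟨10, 3⟩ ⟨-22, -7⟩ e, by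
      rw [pairing_one_add]
      simp only [imCoord, AddMonoidHom.coe_mk, ZeroHom.coe_mk] at hm
      dsimp only
      linear_combination 6 * N * hm⟩)
    ((norm_algebraMap_mul κ ξ).trans hκ) (by
      rw [pairing_algebraMap_mul]
      simp [pairing, hξ]
      right; left
      ring)
  simpa [hξ] using congrArg Zsqrtd.im (eq_zero_of_algebraMap_mul_im hκn hx)

theorem eq_zero_of_quartic_fifteen {p q : ℤ}
    (h : (p ^ 2 - 10 * p * q + 10 * q ^ 2) ^ 2 - 60 * p ^ 2 * q ^ 2 = 1) : q = 0 := by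
  set ξ : Tower 15 (-3) := ⟨⟨p - 5 * q, -q⟩, ⟨5 * q, q⟩⟩ with hξ
  have hnorm : norm ξ = ⟨p ^ 2 - 10 * p * q + 10 * q ^ 2, -2 * p * q⟩ := by
    rw [norm_def, hξ]
    ext <;> simp <;> ring
  have hw : (norm ξ).norm = 1 := by rw [hnorm, Zsqrtd.norm_def]; linarith
  have hre : 0 < (norm ξ).re := by
    rw [hnorm]
    dsimp only
    by_contra! hf
    have := abs_lt_of_sq_lt_sq' (a := 7 * (p * q)) (b := -(p ^ 2 - 10 * p * q + 10 * q ^ 2))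
      (by nlinarith [sq_nonneg (p * q)]) (by linarith)
    nlinarith [sq_nonneg (2 * p - 3 * q), sq_nonneg q]
  obtain ⟨κ, hκ | hκ, hκn⟩ := exists_sq_mul_eq_fifteen hw hre
  · have hx := eq_one_or_neg_one_fifteen (G := pairing ⟨5, 1⟩ ⟨5, 1⟩) (pairing_neg _ _)
      (fun N e ⟨m, hm⟩ => ⟨m - 3 * e.im.im + N * pairing ⟨5, 1⟩ ⟨5, 1⟩ e, by
        rw [pairing_one_add]
        simp only [imCoord, AddMonoidHom.coe_mk, ZeroHom.coe_mk] at hm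
        dsimp only
        linear_combination 2 * N * hm⟩)
      ((norm_algebraMap_mul κ ξ).trans hκ) (by
        rw [pairing_algebraMap_mul]
        simp [pairing, hξ]
        right
        ring)
    simpa [hξ] using congrArg Zsqrtd.im (eq_zero_of_algebraMap_mul_im (Or.inl hκn) hx)
  · set x := algebraMap _ (Tower 15 (-3)) κ * ξ with hxdef
    have hxn : norm x = ⟨4, -1⟩ := (norm_algebraMap_mul κ ξ).trans hκ
    have hxt : x = ⟨1, -1⟩ * (⟨⟨4, 1⟩, ⟨4, 1⟩⟩ * x) := by
      rw [← mul_assoc, show (⟨1, -1⟩ * ⟨⟨4, 1⟩, ⟨4, 1⟩⟩ : Tower 15 (-3)) = 1 by decide, one_mul]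
    have hx := eq_one_or_neg_one_fifteen (x := ⟨⟨4, 1⟩, ⟨4, 1⟩⟩ * x)
      (G := fun t => pairing ⟨5, 1⟩ ⟨5, 1⟩ (⟨1, -1⟩ * t))
      (fun t => by rw [mul_neg, pairing_neg])
      (fun N e ⟨m, hm⟩ => ⟨m - 3 * e.im.im + N * pairing ⟨5, 1⟩ ⟨5, 1⟩ (⟨1, -1⟩ * e), by
        have hexp : pairing ⟨5, 1⟩ ⟨5, 1⟩ ((⟨1, -1⟩ : Tower 15 (-3)) * (1 + 2 * (N : Tower _ _) * e)) =
            2 * N * (e.im.re - 5 * e.im.im + 2 * N * pairing ⟨5, 1⟩ ⟨5, 1⟩ (⟨1, -1⟩ * e)) := by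
          simp [pairing]; ring
        rw [hexp]
        simp only [imCoord, AddMonoidHom.coe_mk, ZeroHom.coe_mk] at hm
        linear_combination 2 * N * hm⟩)
      (by rw [map_mul, hxn]; decide) (by
        rw [← hxt, hxdef, pairing_algebraMap_mul]
        simp [pairing, hξ]
        right
        ring)
    have hsum : x.re + x.im = 0 := by
      rcases hx with hx | hx <;> rw [hx] at hxt <;> rw [hxt] <;> decide
    have hp : κ * ⟨p, 0⟩ = 0 := by
      rw [← hsum, hxdef, hξ]
      ext <;> simp <;> ring
    have hp' := congrArg Zsqrtd.norm hp
    rw [Zsqrtd.norm_mul, hκn, Zsqrtd.norm_def] at hp'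
    have hp0 : p = 0 := by simpa using hp'
    rw [hp0] at h
    have hq : 100 * (q ^ 2 * q ^ 2) = 1 := by linarith
    omega

theorem eq_zero_of_quartic_fifteen' {p q : ℤ}
    (h : (6 * p ^ 2 - 6 * p * q + 4 * q ^ 2) ^ 2 - 15 * (p ^ 2 + q ^ 2) ^ 2 = 1) : p = 0 := by
  set ξ : Tower 15 3 := ⟨⟨-3 * p + 4 * q, -q⟩, ⟨-5 * p, p⟩⟩ with hξ
  have hnorm : norm ξ =
      ⟨39 * p ^ 2 - 24 * p * q + 31 * q ^ 2, -(10 * p ^ 2 - 6 * p * q + 8 * q ^ 2)⟩ := by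
    rw [norm_def, hξ]
    ext <;> simp <;> ring
  have hw : (norm ξ).norm = 1 := by rw [hnorm, Zsqrtd.norm_def]; linarith
  have hre : 0 < (norm ξ).re := by
    have h0 : (norm ξ).re ≠ 0 := by
      intro h0
      rw [Zsqrtd.norm_def, h0] at hw
      nlinarith [mul_self_nonneg (norm ξ).im]
    refine lt_of_le_of_ne ?_ h0.symm
    rw [hnorm]
    dsimp only
    nlinarith [sq_nonneg (p - q), sq_nonneg q, sq_nonneg p]
  obtain ⟨κ, hκ | hκ, hκn⟩ := exists_sq_mul_eq_fifteen hw hre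
  · have hx := eq_one_or_neg_one_fifteen' (G := pairing ⟨5, 1⟩ ⟨-12, -3⟩) (pairing_neg _ _)
      (fun N e ⟨m, hm⟩ => ⟨m - 3 * e.im.im + N * pairing ⟨5, 1⟩ ⟨-12, -3⟩ e, by
        rw [pairing_one_add]
        simp only [imCoord, AddMonoidHom.coe_mk, ZeroHom.coe_mk] at hm
        dsimp only
        linear_combination 2 * N * hm⟩)
      ((norm_algebraMap_mul κ ξ).trans hκ) (by
        rw [pairing_algebraMap_mul]
        simp [pairing, hξ]
        right
        ring)
    simpa [hξ] using congrArg Zsqrtd.im (eq_zero_of_algebraMap_mul_im (Or.inl hκn) hx)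
  · exfalso
    set x := algebraMap _ (Tower 15 3) κ * ξ with hxdef
    have hxn : norm x = ⟨4, -1⟩ := (norm_algebraMap_mul κ ξ).trans hκ
    have hxt : x = ⟨⟨4, 1⟩, 3⟩ * (⟨⟨31, 8⟩, ⟨-12, -3⟩⟩ * x) := by
      rw [← mul_assoc, show (⟨⟨4, 1⟩, 3⟩ * ⟨⟨31, 8⟩, ⟨-12, -3⟩⟩ : Tower 15 3) = 1 by decide,
        one_mul]
    have hx := eq_one_or_neg_one_fifteen' (x := ⟨⟨31, 8⟩, ⟨-12, -3⟩⟩ * x)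
      (G := fun t => pairing ⟨5, 1⟩ ⟨-12, -3⟩ (⟨⟨4, 1⟩, 3⟩ * t))
      (fun t => by rw [mul_neg, pairing_neg])
      (fun N e ⟨m, hm⟩ => ⟨m - 3 * e.im.im + N * pairing ⟨5, 1⟩ ⟨-12, -3⟩ (⟨⟨4, 1⟩, 3⟩ * e), by
        have hexp : pairing ⟨5, 1⟩ ⟨-12, -3⟩ ((⟨⟨4, 1⟩, 3⟩ : Tower 15 3) * (1 + 2 * (N : Tower _ _) * e)) =
            2 * N * (e.im.re - 5 * e.im.im + 2 * N *
              pairing ⟨5, 1⟩ ⟨-12, -3⟩ (⟨⟨4, 1⟩, 3⟩ * e)) := by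
          simp [pairing]; ring
        rw [hexp]
        simp only [imCoord, AddMonoidHom.coe_mk, ZeroHom.coe_mk] at hm
        linear_combination 2 * N * hm⟩)
      (by rw [map_mul, hxn]; decide) (by
        rw [← hxt, hxdef, pairing_algebraMap_mul]
        simp [pairing, hξ]
        right
        ring)
    have him : x.im.norm = 9 := by
      rcases hx with hx | hx <;> rw [hx] at hxt <;> rw [hxt] <;> decide
    have him' : x.im = κ * ⟨-5 * p, p⟩ := by
      rw [hxdef, hξ]
      ext <;> simp
    rw [him', Zsqrtd.norm_mul, hκn, Zsqrtd.norm_def] at him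
    have hp : 10 * (p * p) = 9 := by dsimp only at him; linarith
    omega

end FiveCubes

namespace FiveCubes
open Skolem Tower QuadraticAlgebra

theorem isCoprime_of_mul_eq_squarefree_mul_sq {d P Q y : ℤ} (hd : Squarefree d)
    (h : P * Q = d * y ^ 2) (hy : IsCoprime (P + Q) y) : IsCoprime P Q := by
  refine isCoprime_of_prime_dvd (fun ⟨h0, h1⟩ => ?_) fun z hz hP hQ => ?_
  · subst h0 h1
    have hy1 : IsUnit y := by rwa [add_zero, isCoprime_zero_left] at hy
    have : d = 0 := by simpa [hy1.ne_zero] using h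
    exact hd.ne_zero this
  · have hzz : z * z ∣ d * y ^ 2 := h ▸ mul_dvd_mul hP hQ
    have hzy : z ∣ y := by
      by_contra hcon
      have hco : IsCoprime (z * z) (y ^ 2) := by
        have := (hz.coprime_iff_not_dvd.mpr hcon).pow (m := 2) (n := 2)
        rwa [sq z] at this
      exact hz.not_isUnit (hd z (hco.dvd_of_dvd_mul_right hzz))
    exact hz.not_isUnit (hy.isUnit_of_dvd' (dvd_add hP hQ) hzy)

theorem exists_split_two_primes {r s : ℕ} (hr : r.Prime) (hs : s.Prime) {P Q y : ℤ} (hP : 0 ≤ P)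
    (hQ : 0 ≤ Q) (hPQ : IsCoprime P Q) (h : P * Q = r * (s * y ^ 2)) :
    ∃ p q : ℤ, y = p * q ∧ ((P = p ^ 2 ∧ Q = r * s * q ^ 2) ∨ (P = r * s * p ^ 2 ∧ Q = q ^ 2) ∨
      (P = r * p ^ 2 ∧ Q = s * q ^ 2) ∨ (P = s * p ^ 2 ∧ Q = r * q ^ 2)) := by
  lift P to ℕ using hP
  lift Q to ℕ using hQ
  have hsq : ∀ {A B : ℕ}, A.Coprime B → A * B = y.natAbs ^ 2 →
      ∃ p q : ℤ, y = p * q ∧ (A : ℤ) = p ^ 2 ∧ (B : ℤ) = q ^ 2 := by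
    intro A B hAB hy
    obtain ⟨a, ha⟩ := exists_eq_pow_of_mul_eq_pow (Nat.isUnit_iff.2 hAB) hy
    obtain ⟨b, hb⟩ := exists_eq_pow_of_mul_eq_pow (Nat.isUnit_iff.2 hAB.symm) (mul_comm A B ▸ hy)
    have hab : y ^ 2 = ((a : ℤ) * b) ^ 2 := by
      rw [ha, hb, ← mul_pow] at hy
      rw [← Int.natAbs_sq]
      exact_mod_cast hy.symm
    rcases sq_eq_sq_iff_eq_or_eq_neg.mp hab with h | h
    · exact ⟨a, b, h, by exact_mod_cast ha, by exact_mod_cast hb⟩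
    · exact ⟨-a, b, by linarith, by rw [neg_sq]; exact_mod_cast ha, by exact_mod_cast hb⟩
  have h' : P * Q = r * (s * y.natAbs ^ 2) := by
    zify; rw [sq_abs]; exact h
  rcases exists_split_primePow (Nat.isCoprime_iff_coprime.mp hPQ) hr.isPrimePow h' with
    ⟨P', rfl, h1, h2⟩ | ⟨P', rfl, h1, h2⟩ <;>
  rcases exists_split_primePow h1 hs.isPrimePow h2 with ⟨P'', rfl, h3, h4⟩ | ⟨P'', rfl, h3, h4⟩ <;>
  obtain ⟨p, q, hy, hp, hq⟩ := hsq h3 h4 <;>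
  refine ⟨p, q, hy, ?_⟩ <;> push_cast <;> rw [hp, hq]
  · right; left; exact ⟨by ring, rfl⟩
  · right; right; left; exact ⟨rfl, rfl⟩
  · right; right; right; exact ⟨rfl, rfl⟩
  · left; exact ⟨rfl, by ring⟩

theorem squarefree_ten : Squarefree (10 : ℤ) := by
  have := Int.squarefree_natCast.mpr (show Squarefree 10 by decide +kernel)
  exact_mod_cast this

theorem squarefree_fifteen : Squarefree (15 : ℤ) := by
  have := Int.squarefree_natCast.mpr (show Squarefree 15 by decide +kernel)
  exact_mod_cast this

theorem int_pow_four_mod_five (x : ℤ) : x ^ 4 % 5 = 0 ∨ x ^ 4 % 5 = 1 := by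
  have h : x % 5 = 0 ∨ x % 5 = 1 ∨ x % 5 = 2 ∨ x % 5 = 3 ∨ x % 5 = 4 := by omega
  rcases h with h | h | h | h | h <;> simp [pow_succ, Int.mul_emod, h]

/-- The unit `X + Y√10` of norm one is, up to sign, the square of a unit. -/
theorem exists_sq_ten {X Y : ℤ} (h : X ^ 2 - 10 * Y ^ 2 = 1) :
    ∃ x y : ℤ, (x ^ 2 - 10 * y ^ 2 = 1 ∨ x ^ 2 - 10 * y ^ 2 = -1) ∧
      ((X = x ^ 2 + 10 * y ^ 2 ∧ Y = 2 * x * y) ∨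
        (X = -(x ^ 2 + 10 * y ^ 2) ∧ Y = -(2 * x * y))) := by
  have pos : ∀ {X Y : ℤ}, X ^ 2 - 10 * Y ^ 2 = 1 → 0 < X →
      ∃ x y : ℤ, (x ^ 2 - 10 * y ^ 2 = 1 ∨ x ^ 2 - 10 * y ^ 2 = -1) ∧
        X = x ^ 2 + 10 * y ^ 2 ∧ Y = 2 * x * y := by
    intro X Y h hX
    obtain ⟨κ, hκ, hn⟩ := exists_sq_mul_eq_one_ten (w := ⟨X, Y⟩)
      (by rw [Zsqrtd.norm_def]; linarith) hX
    have hw : (⟨X, Y⟩ : ℤ√10) = star κ * star κ := by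
      have h1 : (κ * star κ) * (κ * star κ) = 1 := by
        rw [← Zsqrtd.norm_eq_mul_conj]
        rcases hn with hn | hn <;> rw [hn] <;> rfl
      calc (⟨X, Y⟩ : ℤ√10) = (κ * star κ) * (κ * star κ) * ⟨X, Y⟩ := by rw [h1, one_mul]
        _ = star κ * star κ * (κ * κ * ⟨X, Y⟩) := by ring
        _ = star κ * star κ := by rw [hκ, mul_one]
    rw [Zsqrtd.norm_def] at hn
    rw [Zsqrtd.ext_iff] at hw
    simp only [Zsqrtd.re_mul, Zsqrtd.im_mul, Zsqrtd.re_star, Zsqrtd.im_star] at hw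
    refine ⟨κ.re, -κ.im, ?_, by linarith, by linarith⟩
    exact hn.imp (fun h => by linarith) (fun h => by linarith)
  rcases lt_trichotomy X 0 with hX | hX | hX
  · obtain ⟨x, y, hn, h1, h2⟩ := pos (X := -X) (Y := -Y) (by linarith) (by omega)
    exact ⟨x, y, hn, Or.inr ⟨by linarith, by linarith⟩⟩
  · subst hX; nlinarith [sq_nonneg Y]
  · obtain ⟨x, y, hn, h1, h2⟩ := pos h hX
    exact ⟨x, y, hn, Or.inl ⟨h1, h2⟩⟩

/-- The norm-one units of `ℤ[√15]` are `±η²` or `±η²(4 - √15)`. -/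
theorem exists_sq_fifteen {X Y s : ℤ} (h : X ^ 2 - 15 * Y ^ 2 = 1) (hs : s = X + 5 * Y) :
    ∃ x y : ℤ, x ^ 2 - 15 * y ^ 2 = 1 ∧
      (x ^ 2 + 10 * x * y + 15 * y ^ 2 = s ∨ x ^ 2 + 10 * x * y + 15 * y ^ 2 = -s) := by
  have pos : ∀ {X Y s : ℤ}, X ^ 2 - 15 * Y ^ 2 = 1 → 0 < X → s = X + 5 * Y →
      ∃ x y : ℤ, x ^ 2 - 15 * y ^ 2 = 1 ∧
      (x ^ 2 + 10 * x * y + 15 * y ^ 2 = s ∨ x ^ 2 + 10 * x * y + 15 * y ^ 2 = -s) := by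
    intro X Y s h hX hs
    obtain ⟨κ, hκ, hn⟩ := exists_sq_mul_eq_fifteen (w := ⟨X, Y⟩)
      (by rw [Zsqrtd.norm_def]; linarith) hX
    have hw : (⟨X, Y⟩ : ℤ√15) = star κ * star κ * (κ * κ * ⟨X, Y⟩) := by
      have h1 : (κ * star κ) * (κ * star κ) = 1 := by
        rw [← Zsqrtd.norm_eq_mul_conj, hn]; rfl
      calc (⟨X, Y⟩ : ℤ√15) = (κ * star κ) * (κ * star κ) * ⟨X, Y⟩ := by rw [h1, one_mul]
        _ = star κ * star κ * (κ * κ * ⟨X, Y⟩) := by ring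
    rw [Zsqrtd.norm_def] at hn
    rcases hκ with hκ | hκ <;> rw [hκ, Zsqrtd.ext_iff] at hw <;>
    simp only [Zsqrtd.re_mul, Zsqrtd.im_mul, Zsqrtd.re_star, Zsqrtd.im_star, Zsqrtd.re_one,
      Zsqrtd.im_one] at hw
    · exact ⟨κ.re, -κ.im, by linarith, Or.inl (by linarith)⟩
    · exact ⟨κ.re, κ.im, by linarith, Or.inr (by linarith)⟩
  rcases lt_trichotomy X 0 with hX | hX | hX
  · obtain ⟨x, y, hn, h1⟩ := pos (X := -X) (Y := -Y) (s := -s) (by linarith) (by omega)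
      (by linarith)
    rw [neg_neg] at h1
    exact ⟨x, y, hn, h1.symm⟩
  · subst hX; nlinarith [sq_nonneg Y]
  · exact pos h hX hs

end FiveCubes

namespace FiveCubes

theorem ne_of_mixed_quartic_ten {p q e : ℤ} (he : e % 5 = 1) :
    (3 * p ^ 2 + 5 * q ^ 2 - 10 * p * q) ^ 2 - 40 * p ^ 2 * q ^ 2 ≠ e := by
  intro h
  have h5 : 9 * p ^ 4 = e - 5 * (5 * q ^ 4 + 18 * p ^ 2 * q ^ 2 - 12 * p ^ 3 * q - 20 * p * q ^ 3) := by
    linear_combination h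
  generalize 5 * q ^ 4 + 18 * p ^ 2 * q ^ 2 - 12 * p ^ 3 * q - 20 * p * q ^ 3 = k at h5
  rcases int_pow_four_mod_five p with hp | hp <;> omega

theorem ne_of_mixed_quartic_fifteen {p q : ℤ} :
    (2 * p ^ 2 + 5 * q ^ 2 - 10 * p * q) ^ 2 - 60 * p ^ 2 * q ^ 2 ≠ 1 := by
  intro h
  have h5 : 4 * p ^ 4 = 1 - 5 * (5 * q ^ 4 + 12 * p ^ 2 * q ^ 2 - 8 * p ^ 3 * q - 20 * p * q ^ 3) := by
    linear_combination h
  generalize 5 * q ^ 4 + 12 * p ^ 2 * q ^ 2 - 8 * p ^ 3 * q - 20 * p * q ^ 3 = k at h5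
  rcases int_pow_four_mod_five p with hp | hp <;> omega

theorem int_sq_mod_four (x : ℤ) : (x % 2 = 0 ∧ x ^ 2 % 4 = 0) ∨ (x % 2 = 1 ∧ x ^ 2 % 8 = 1) := by
  obtain ⟨k, rfl | rfl⟩ := x.even_or_odd'
  · left
    refine ⟨by omega, ?_⟩
    rw [show (2 * k) ^ 2 = 4 * k ^ 2 by ring]; omega
  · right
    refine ⟨by omega, ?_⟩
    obtain ⟨m, hm | hm⟩ := k.even_or_odd'
    · rw [show (2 * k + 1) ^ 2 = 8 * (m * (2 * m + 1)) + 1 by rw [hm]; ring]; omega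
    · rw [show (2 * k + 1) ^ 2 = 8 * ((2 * m + 1) * (m + 1)) + 1 by rw [hm]; ring]; omega

theorem eq_one_of_norm_one_ten {x y u : ℤ} (hu : 0 < u) (hW : 0 ≤ x + 5 * y)
    (h : x ^ 2 - 10 * y ^ 2 = 1) (hxu : x ^ 2 + 10 * x * y + 10 * y ^ 2 = u ^ 2) : u = 1 := by
  have hx2 : x % 2 = 1 := by
    rcases int_sq_mod_four x with ⟨h1, h2⟩ | ⟨h1, h2⟩
    · omega
    · exact h1
  obtain ⟨z, rfl⟩ : ∃ z, y = 2 * z := by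
    rcases int_sq_mod_four x with ⟨h1, h2⟩ | ⟨h1, h2⟩
    · omega
    · rcases int_sq_mod_four y with ⟨h3, h4⟩ | ⟨h3, h4⟩
      · exact ⟨y / 2, by omega⟩
      · omega
  have hu2 : u % 2 = 1 := by
    rcases int_sq_mod_four u with ⟨h1, h2⟩ | ⟨h1, h2⟩
    · rcases int_sq_mod_four x with ⟨h3, h4⟩ | ⟨h3, h4⟩
      · omega
      · have : u ^ 2 = x ^ 2 + 4 * (5 * (x * z) + 10 * z ^ 2) := by linarith
        omega
    · exact h1
  obtain ⟨P, hP⟩ : ∃ P, x + 10 * z - u = 2 * P := ⟨(x + 10 * z - u) / 2, by omega⟩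
  obtain ⟨Q, hQ⟩ : ∃ Q, x + 10 * z + u = 2 * Q := ⟨(x + 10 * z + u) / 2, by omega⟩
  have hx : x = P + Q - 10 * z := by linarith
  have huPQ : u = Q - P := by linarith
  have hPQ : P * Q = 15 * z ^ 2 := by subst hx huPQ; linarith
  have hQ0 : 0 < Q := by linarith
  have hP0 : 0 ≤ P := by
    refine nonneg_of_mul_nonneg_left (b := Q) ?_ hQ0
    rw [hPQ]; positivity
  have hco : IsCoprime P Q := by
    refine isCoprime_of_mul_eq_squarefree_mul_sq squarefree_fifteen hPQ ⟨P + Q - 20 * z, 60 * z, ?_⟩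
    subst hx; linarith
  obtain ⟨p, q, rfl, hpq⟩ := exists_split_two_primes Nat.prime_three Nat.prime_five hP0 hQ0.le hco
    (by rw [hPQ]; push_cast; ring)
  push_cast at hpq
  have hpq0 : p * q = 0 := by
    rcases hpq with ⟨rfl, rfl⟩ | ⟨rfl, rfl⟩ | ⟨rfl, rfl⟩ | ⟨rfl, rfl⟩
    · rw [eq_zero_of_quartic_ten (p := p) (q := q) (by subst hx; linarith), mul_zero]
    · rw [eq_zero_of_quartic_ten (p := q) (q := p) (by subst hx; linarith), zero_mul]
    · exact absurd (by subst hx; linarith) (ne_of_mixed_quartic_ten (p := p) (q := q) (e := 1) rfl)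
    · exact absurd (by subst hx; linarith) (ne_of_mixed_quartic_ten (p := q) (q := p) (e := 1) rfl)
  rw [hpq0] at h hxu
  have : u ^ 2 = 1 := by linarith
  nlinarith

theorem eq_seven_of_norm_neg_one_ten {x y u : ℤ} (hu : 0 < u) (hW : 0 ≤ x + 5 * y)
    (h : x ^ 2 - 10 * y ^ 2 = -1) (hxu : x ^ 2 + 10 * x * y + 10 * y ^ 2 = u ^ 2) : u = 7 := by
  have hy2 : y % 2 = 1 := by
    rcases int_sq_mod_four x with ⟨h1, h2⟩ | ⟨h1, h2⟩
    · omega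
    · rcases int_sq_mod_four y with ⟨h3, h4⟩ | ⟨h3, h4⟩
      · omega
      · exact h3
  have hPQ : (x + 5 * y - u) * (x + 5 * y + u) = 15 * y ^ 2 := by linarith
  have hQ0 : 0 < x + 5 * y + u := by linarith
  have hP0 : 0 ≤ x + 5 * y - u := by
    refine nonneg_of_mul_nonneg_left (b := x + 5 * y + u) ?_ hQ0
    rw [hPQ]; positivity
  have hco : IsCoprime (x + 5 * y - u) (x + 5 * y + u) := by
    refine isCoprime_of_mul_eq_squarefree_mul_sq squarefree_fifteen hPQ ?_
    rw [show x + 5 * y - u + (x + 5 * y + u) = 2 * (x + 5 * y) by ring]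
    refine IsCoprime.mul_left ⟨-(y / 2), 1, by omega⟩ ⟨-(x - 5 * y), -15 * y, ?_⟩
    linarith
  obtain ⟨p, q, rfl, hpq⟩ := exists_split_two_primes Nat.prime_three Nat.prime_five hP0 hQ0.le hco
    (by rw [hPQ]; push_cast; ring)
  push_cast at hpq
  have key : ∀ p q : ℤ, (p * q) % 2 = 1 → 2 * x = p ^ 2 + 15 * q ^ 2 - 10 * (p * q) →
      x ^ 2 - 10 * (p * q) ^ 2 = -1 → p = q ∧ q ^ 2 = 1 := by
    intro p q hodd hx h
    obtain ⟨r, rfl⟩ : ∃ r, p = q + 2 * r := by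
      obtain ⟨a, ha⟩ := (Int.odd_mul.mp (Int.odd_iff.mpr hodd)).1
      obtain ⟨b, hb⟩ := (Int.odd_mul.mp (Int.odd_iff.mpr hodd)).2
      exact ⟨a - b, by omega⟩
    have hx' : x = 3 * q ^ 2 - 8 * q * r + 2 * r ^ 2 := by linarith
    have hr := eq_zero_of_quartic_ten_neg (q := q) (r := r) (by rw [hx'] at h; linarith)
    subst hr
    refine ⟨by ring, ?_⟩
    rw [hx'] at h
    have : (q ^ 2) ^ 2 = 1 := by linarith
    nlinarith [sq_nonneg q]
  rcases hpq with ⟨h1, h2⟩ | ⟨h1, h2⟩ | ⟨h1, h2⟩ | ⟨h1, h2⟩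
  · obtain ⟨rfl, hq⟩ := key p q hy2 (by linarith) h
    linarith
  · obtain ⟨rfl, hq⟩ := key q p (by rwa [mul_comm]) (by linarith) (by rwa [mul_comm q p])
    linarith
  · have hx : 2 * x = 3 * p ^ 2 + 5 * q ^ 2 - 10 * p * q := by linarith
    exact absurd (by rw [← hx]; linarith) (ne_of_mixed_quartic_ten (p := p) (q := q) (e := -4) rfl)
  · have hx : 2 * x = 3 * q ^ 2 + 5 * p ^ 2 - 10 * q * p := by linarith
    exact absurd (by rw [← hx]; linarith) (ne_of_mixed_quartic_ten (p := q) (q := p) (e := -4) rfl)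

theorem int_sq_mod_three (x : ℤ) : (x % 3 = 0 ∧ x ^ 2 % 3 = 0) ∨ (x % 3 ≠ 0 ∧ x ^ 2 % 3 = 1) := by
  have h : x % 3 = 0 ∨ x % 3 = 1 ∨ x % 3 = 2 := by omega
  rcases h with h | h | h <;> simp [pow_succ, Int.mul_emod, h]

theorem eq_one_or_seven_of_sq_eq {u v : ℕ} (h : 5 * v ^ 2 = 2 * u ^ 4 + 3) : u = 1 ∨ u = 7 := by
  have hu : 0 < u := by
    rcases Nat.eq_zero_or_pos u with rfl | hu
    · omega
    · exact hu
  obtain ⟨V, Y, hV, hY⟩ : ∃ V Y : ℤ, 5 * V ^ 2 = 2 * (u : ℤ) ^ 4 + 3 ∧ (u : ℤ) ^ 2 = V + 3 * Y := by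
    have hz : 5 * (v : ℤ) ^ 2 = 2 * (u : ℤ) ^ 4 + 3 := by exact_mod_cast h
    have h3 : (3 : ℤ) ∣ ((u : ℤ) ^ 2 - v) * ((u : ℤ) ^ 2 + v) :=
      ⟨(u : ℤ) ^ 4 - 2 * v ^ 2 + 1, by linarith⟩
    rcases Int.prime_three.dvd_or_dvd h3 with ⟨Y, hY⟩ | ⟨Y, hY⟩
    · exact ⟨v, Y, hz, by linarith⟩
    · exact ⟨-v, Y, by rw [neg_sq]; exact hz, by linarith⟩
  have hpell : (V - 2 * Y) ^ 2 - 10 * Y ^ 2 = 1 := by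
    rw [show (u : ℤ) ^ 4 = (u ^ 2) ^ 2 by ring, hY] at hV
    linarith
  obtain ⟨x, y, hn, hXY⟩ := exists_sq_ten hpell
  have hs : x ^ 2 + 10 * x * y + 10 * y ^ 2 = (u : ℤ) ^ 2 := by
    rcases hXY with ⟨hX, hY'⟩ | ⟨hX, hY'⟩
    · linarith
    · exfalso
      have hu2 : x ^ 2 + 10 * (x * y) + 10 * y ^ 2 + (u : ℤ) ^ 2 = 0 := by linarith
      clear hX hY' hpell hV hY
      have hne : x ^ 2 % 3 ≠ y ^ 2 % 3 := by rcases hn with hn | hn <;> omega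
      have hxy : (x * y) % 3 = 0 := by
        rcases int_sq_mod_three x with ⟨h1, h2⟩ | ⟨h1, h2⟩ <;>
        rcases int_sq_mod_three y with ⟨h3, h4⟩ | ⟨h3, h4⟩ <;>
        first
        | omega
        | exact Int.emod_eq_zero_of_dvd (Dvd.dvd.mul_right (Int.dvd_of_emod_eq_zero h1) _)
        | exact Int.emod_eq_zero_of_dvd (Dvd.dvd.mul_left (Int.dvd_of_emod_eq_zero h3) _)
      rcases int_sq_mod_three x with ⟨-, h2⟩ | ⟨-, h2⟩ <;>
      rcases int_sq_mod_three y with ⟨-, h4⟩ | ⟨-, h4⟩ <;>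
      rcases int_sq_mod_three u with ⟨-, h6⟩ | ⟨-, h6⟩ <;> omega
  have hu' : (0 : ℤ) < u := by exact_mod_cast hu
  obtain ⟨x, y, hW, hn, hs⟩ : ∃ x y : ℤ, 0 ≤ x + 5 * y ∧
      (x ^ 2 - 10 * y ^ 2 = 1 ∨ x ^ 2 - 10 * y ^ 2 = -1) ∧
      x ^ 2 + 10 * x * y + 10 * y ^ 2 = (u : ℤ) ^ 2 := by
    rcases le_total 0 (x + 5 * y) with hW | hW
    · exact ⟨x, y, hW, hn, hs⟩
    · exact ⟨-x, -y, by linarith, by simpa using hn, by rw [← hs]; ring⟩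
  rcases hn with hn | hn
  · left; exact_mod_cast eq_one_of_norm_one_ten hu' hW hn hs
  · right; exact_mod_cast eq_seven_of_norm_neg_one_ten hu' hW hn hs

theorem eq_one_of_norm_one_fifteen {x y u : ℤ} (hu : 0 < u) (hW : 0 ≤ x + 5 * y)
    (h : x ^ 2 - 15 * y ^ 2 = 1) (hxu : x ^ 2 + 10 * x * y + 15 * y ^ 2 = u ^ 2) : u = 1 := by
  obtain ⟨z, rfl⟩ : ∃ z, y = 2 * z := by
    rcases int_sq_mod_four y with ⟨h3, h4⟩ | ⟨h3, h4⟩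
    · exact ⟨y / 2, by omega⟩
    · exfalso
      rcases int_sq_mod_four x with ⟨h1, h2⟩ | ⟨h1, h2⟩
      · obtain ⟨w, rfl⟩ : ∃ w, x = 2 * w := ⟨x / 2, by omega⟩
        have hu2 : (2 * w) ^ 2 + 20 * (w * y) + 15 * y ^ 2 = u ^ 2 := by linarith
        rcases int_sq_mod_four u with ⟨h5, h6⟩ | ⟨h5, h6⟩ <;> omega
      · omega
  have hx2 : x % 2 = 1 := by
    rcases int_sq_mod_four x with ⟨h1, h2⟩ | ⟨h1, h2⟩
    · have : x ^ 2 - 4 * (15 * z ^ 2) = 1 := by linarith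
      omega
    · exact h1
  have hu2 : u % 2 = 1 := by
    rcases int_sq_mod_four u with ⟨h1, h2⟩ | ⟨h1, h2⟩
    · rcases int_sq_mod_four x with ⟨h3, h4⟩ | ⟨h3, h4⟩
      · omega
      · have : u ^ 2 = x ^ 2 + 4 * (5 * (x * z) + 15 * z ^ 2) := by linarith
        omega
    · exact h1
  obtain ⟨P, hP⟩ : ∃ P, x + 10 * z - u = 2 * P := ⟨(x + 10 * z - u) / 2, by omega⟩
  obtain ⟨Q, hQ⟩ : ∃ Q, x + 10 * z + u = 2 * Q := ⟨(x + 10 * z + u) / 2, by omega⟩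
  have hx : x = P + Q - 10 * z := by linarith
  have huPQ : u = Q - P := by linarith
  have hPQ : P * Q = 10 * z ^ 2 := by subst hx huPQ; linarith
  have hQ0 : 0 < Q := by linarith
  have hP0 : 0 ≤ P := by
    refine nonneg_of_mul_nonneg_left (b := Q) ?_ hQ0
    rw [hPQ]; positivity
  have hco : IsCoprime P Q := by
    refine isCoprime_of_mul_eq_squarefree_mul_sq squarefree_ten hPQ ⟨P + Q - 20 * z, 40 * z, ?_⟩
    subst hx; linarith
  obtain ⟨p, q, rfl, hpq⟩ := exists_split_two_primes Nat.prime_two Nat.prime_five hP0 hQ0.le hco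
    (by rw [hPQ]; push_cast; ring)
  push_cast at hpq
  have hpq0 : p * q = 0 := by
    rcases hpq with ⟨rfl, rfl⟩ | ⟨rfl, rfl⟩ | ⟨rfl, rfl⟩ | ⟨rfl, rfl⟩
    · rw [eq_zero_of_quartic_fifteen (p := p) (q := q) (by subst hx; linarith), mul_zero]
    · rw [eq_zero_of_quartic_fifteen (p := q) (q := p) (by subst hx; linarith), zero_mul]
    · exact absurd (by subst hx; linarith) (ne_of_mixed_quartic_fifteen (p := p) (q := q))
    · exact absurd (by subst hx; linarith) (ne_of_mixed_quartic_fifteen (p := q) (q := p))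
  rw [hpq0] at h hxu
  have : u ^ 2 = 1 := by linarith
  nlinarith

theorem ne_of_two_mul_sq_mod_five {x s k e : ℤ} (he : e % 5 = 1 ∨ e % 5 = 4)
    (hx : x = 2 * e * s ^ 2 + 5 * k) : x ^ 2 % 5 ≠ 1 := by
  subst hx
  have h2 : (2 * e * s ^ 2 + 5 * k) ^ 2
      = 4 * (e ^ 2 * s ^ 4) + 5 * (4 * e * s ^ 2 * k + 5 * k ^ 2) := by ring
  have he2 : e ^ 2 % 5 = 1 := by rcases he with h | h <;> simp [pow_succ, Int.mul_emod, h]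
  have : (e ^ 2 * s ^ 4) % 5 = s ^ 4 % 5 := by rw [Int.mul_emod, he2]; omega
  rw [h2]
  rcases int_pow_four_mod_five s with hs | hs <;> omega

theorem sq_eq_nine_of_pythagorean {m n y : ℤ} (h : (3 * m + n - 5 * y) ^ 2 - 15 * y ^ 2 = 1)
    (hy : m ^ 2 + n ^ 2 = y ^ 2) : (3 * n - m) ^ 2 = 9 := by
  have hco : Int.gcd m n = 1 := by
    refine Int.isCoprime_iff_gcd_eq_one.mp ⟨19 * m + 6 * n - 30 * y, 11 * n - 10 * y, ?_⟩
    linarith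
  obtain ⟨p, q, hmn, hy', -, -⟩ := PythagoreanTriple.coprime_classification.mp
    ⟨show PythagoreanTriple m n y by unfold PythagoreanTriple; linarith, hco⟩
  clear hco hy
  have mod_five : (3 * m + n - 5 * y) ^ 2 % 5 = 1 := by omega
  rcases hmn with ⟨rfl, rfl⟩ | ⟨rfl, rfl⟩ <;> rcases hy' with rfl | rfl
  · exact absurd mod_five (ne_of_two_mul_sq_mod_five (s := p + 2 * q) (e := -1)
      (k := 2 * p * q) (by decide) (by ring))
  · exact absurd mod_five (ne_of_two_mul_sq_mod_five (s := p + 2 * q) (e := -1)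
      (k := 2 * p ^ 2 + 2 * p * q + 2 * q ^ 2) (by decide) (by ring))
  · have hq := eq_zero_of_quartic_fifteen' (p := q) (q := p) (by linarith)
    subst hq
    linarith
  · have hp := eq_zero_of_quartic_fifteen' (p := p) (q := -q) (by linarith)
    subst hp
    linarith

theorem eq_three_of_norm_one_fifteen {x y u : ℤ} (hu : 0 < u)
    (h : x ^ 2 - 15 * y ^ 2 = 1) (hxu : x ^ 2 + 10 * x * y + 15 * y ^ 2 = -u ^ 2) : u = 3 := by
  have hpar : (x + 5 * y) % 2 = 1 ∧ u % 2 = 1 := by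
    rcases int_sq_mod_four y with ⟨h3, h4⟩ | ⟨h3, h4⟩
    · obtain ⟨z, rfl⟩ : ∃ w, y = 2 * w := ⟨y / 2, by omega⟩
      have hu2 : x ^ 2 + 20 * (x * z) + 15 * (2 * z) ^ 2 = -u ^ 2 := by linarith
      rcases int_sq_mod_four u with ⟨h5, h6⟩ | ⟨h5, h6⟩ <;>
      rcases int_sq_mod_four x with ⟨h1, h2⟩ | ⟨h1, h2⟩ <;> omega
    · rcases int_sq_mod_four x with ⟨h1, h2⟩ | ⟨h1, h2⟩
      · obtain ⟨w, rfl⟩ : ∃ w, x = 2 * w := ⟨x / 2, by omega⟩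
        have hu2 : (2 * w) ^ 2 + 20 * (w * y) + 15 * y ^ 2 = -u ^ 2 := by linarith
        rcases int_sq_mod_four u with ⟨h5, h6⟩ | ⟨h5, h6⟩ <;> omega
      · omega
  have key : ∀ t : ℤ, t % 2 = 1 → t ^ 2 = u ^ 2 → (5 : ℤ) ∣ x + 5 * y - 2 * t → t ^ 2 = 9 := by
    intro t ht htu h5
    obtain ⟨m, hm⟩ : ∃ m, 3 * (x + 5 * y) - t = 10 * m :=
      ⟨(3 * (x + 5 * y) - t) / 10, by omega⟩
    obtain ⟨n, hn⟩ : ∃ n, x + 5 * y + 3 * t = 10 * n := ⟨(x + 5 * y + 3 * t) / 10, by omega⟩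
    obtain rfl : t = 3 * n - m := by linarith
    obtain rfl : x = 3 * m + n - 5 * y := by linarith
    exact sq_eq_nine_of_pythagorean h (by linarith)
  have hdvd : (5 : ℤ) ∣ (x + 5 * y - 2 * u) * (x + 5 * y - 2 * (-u)) :=
    ⟨2 * y ^ 2 - u ^ 2, by linarith⟩
  have : u ^ 2 = 9 := by
    rcases (Nat.prime_iff_prime_int.mp Nat.prime_five).dvd_or_dvd hdvd with hd | hd
    · exact key u hpar.2 rfl hd
    · rw [← neg_sq]
      exact key (-u) (by omega) (by ring) hd
  nlinarith

theorem eq_one_or_three_of_sq_eq {u v : ℕ} (h : 5 * v ^ 2 = 3 * u ^ 4 + 2) : u = 1 ∨ u = 3 := by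
  have hu : 0 < u := by
    rcases Nat.eq_zero_or_pos u with rfl | hu
    · omega
    · exact hu
  have hV : 5 * (v : ℤ) ^ 2 = 3 * (u : ℤ) ^ 4 + 2 := by exact_mod_cast h
  rw [show (u : ℤ) ^ 4 = (u ^ 2) ^ 2 by ring] at hV
  obtain ⟨Y, hY⟩ : ∃ Y : ℤ, (u : ℤ) ^ 2 = v + 2 * Y := by
    refine ⟨((u : ℤ) ^ 2 - v) / 2, ?_⟩
    rcases int_sq_mod_four v with ⟨h1, h2⟩ | ⟨h1, h2⟩ <;>
    rcases int_sq_mod_four ((u : ℤ) ^ 2) with ⟨h3, h4⟩ | ⟨h3, h4⟩ <;> omega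
  have hpell : ((v : ℤ) - 3 * Y) ^ 2 - 15 * Y ^ 2 = 1 := by
    rw [hY] at hV
    linarith
  have hu' : (0 : ℤ) < u := by exact_mod_cast hu
  obtain ⟨x, y, hn, hs | hs⟩ := exists_sq_fifteen (s := (u : ℤ) ^ 2) hpell (by linarith)
  · left
    rcases le_total 0 (x + 5 * y) with hW | hW
    · exact_mod_cast eq_one_of_norm_one_fifteen hu' hW hn hs
    · exact_mod_cast eq_one_of_norm_one_fifteen hu' (x := -x) (y := -y) (by linarith)
        (by linarith) (by linarith)
  · right
    exact_mod_cast eq_three_of_norm_one_fifteen hu' hn hs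

theorem nat_sq_mod_nine (n : ℕ) :
    n ^ 2 % 9 = 0 ∨ n ^ 2 % 9 = 1 ∨ n ^ 2 % 9 = 4 ∨ n ^ 2 % 9 = 7 := by
  have h : n % 9 = 0 ∨ n % 9 = 1 ∨ n % 9 = 2 ∨ n % 9 = 3 ∨ n % 9 = 4 ∨ n % 9 = 5 ∨ n % 9 = 6 ∨
    n % 9 = 7 ∨ n % 9 = 8 := by omega
  rcases h with h | h | h | h | h | h | h | h | h <;> simp [Nat.pow_mod, h]

theorem eq_of_exponent_two {z y : ℕ} (hz4 : 4 ≤ z) (h : 5 * z * (z ^ 2 + 6) = y ^ 2) :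
    z = 27 ∨ z = 98 ∨ z = 120 := by
  obtain ⟨a, b, c, u, v, ha, hb, hc, hz, hz6⟩ := exists_factorization le_rfl (by omega) h
  have hu9 := nat_sq_mod_nine (u ^ 2)
  have hv9 := nat_sq_mod_nine v
  rw [hz] at hz6
  obtain rfl | rfl : a = 0 ∨ a = 1 := by omega
  all_goals obtain rfl | rfl : b = 0 ∨ b = 1 := by omega
  all_goals obtain rfl | rfl : c = 0 ∨ c = 1 := by omega
  all_goals norm_num [mul_pow] at hz hz6
  all_goals simp only [← pow_mul, Nat.reduceMul] at hz6 hu9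
  · omega
  · clear hu9 hv9
    have hu : u ^ 4 % 16 = 0 ∨ u ^ 4 % 16 = 1 := pow_four_mod_sixteen u
    have hv : v % 8 = 0 ∨ v % 8 = 1 ∨ v % 8 = 2 ∨ v % 8 = 3 ∨ v % 8 = 4 ∨ v % 8 = 5 ∨ v % 8 = 6 ∨
      v % 8 = 7 := by omega
    have hv' : v ^ 2 % 8 = 0 ∨ v ^ 2 % 8 = 1 ∨ v ^ 2 % 8 = 4 := by
      rcases hv with h | h | h | h | h | h | h | h <;> simp [Nat.pow_mod, h]
    omega
  · clear hu9 hv9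
    obtain rfl | rfl := eq_one_or_three_of_sq_eq (u := u) (v := v) (by omega) <;> omega
  · omega
  · clear hu9 hv9
    obtain rfl | rfl := eq_one_or_seven_of_sq_eq (u := u) (v := v) (by omega) <;> omega
  · omega
  · omega
  · clear hu9 hv9
    obtain rfl | rfl := eq_zero_or_two_of_sq_eq (u := u) (v := v) (by omega) <;> omega

theorem false_of_odd_prime_exponent {l z y : ℕ} (hl : l.Prime) (hl2 : l ≠ 2) (hz4 : 4 ≤ z)
    (h : 5 * z * (z ^ 2 + 6) = y ^ l) : False := by
  have hl3 : 3 ≤ l := by have := hl.two_le; omega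
  obtain ⟨a, b, c, u, v, ha, hb, hc, hz, hz6⟩ := exists_factorization hl.two_le (by omega) h
  by_cases habc : a = 1 ∧ b = 1 ∧ c = 1
  · obtain ⟨rfl, rfl, rfl⟩ := habc
    obtain ⟨k, rfl⟩ : ∃ k, l = k + 3 := ⟨l - 3, by omega⟩
    obtain ⟨w, rfl⟩ : ∃ w, z = 6 * (2 * w) := by
      refine ⟨2 ^ k * 3 ^ (k + 1) * 5 ^ (k + 2) * u ^ (k + 3), ?_⟩
      rw [hz]
      simp only [one_mul, show k + 3 - 1 = k + 2 by omega]
      ring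
    refine six_mul_sq_add_one_ne_pow (l := k + 3) (v := v) (w := 2 * w) (hl.odd_of_ne_two hl2)
      (by omega) (even_two_mul _) (by omega) ?_
    have : 6 * (2 * w) ^ 2 + 1 = v ^ (k + 3) := by
      simp only [pow_one, Nat.sub_self, zero_mul, pow_zero, mul_one] at hz6
      linarith
    exact_mod_cast this
  · rcases lt_or_ge l (2 ^ 16) with hlt | hge
    · rcases lt_or_ge l 5 with h5 | h5
      · obtain rfl : l = 3 := by
          interval_cases l
          · rfl
          · exact absurd hl (by decide)
        exact false_of_exponent_three ha hb hc habc hz hz6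
      · exact false_of_locallyInsoluble
          (CubeSieve.locallyInsoluble_of_lt hl h5 hlt ha hb hc habc) hz hz6
    · exact false_of_large_exponent hge ha hb hc habc hz4 hz hz6

end FiveCubes

/-- The only solutions in integers `x ≥ 1`, `y` to
`(x+1)³ + ⋯ + (x+5)³ = yˡ` with `ℓ` prime are
`(x, y, ℓ) = (24, ±315, 2)`, `(95, ±2170, 2)` and `(117, ±2940, 2)`. -/
theorem sum_five_consecutive_cubes_perfect_power (ℓ : ℕ) (hℓ : ℓ.Prime)
    (x y : ℤ) (hx : 1 ≤ x) :
    (x + 1) ^ 3 + (x + 2) ^ 3 + (x + 3) ^ 3 + (x + 4) ^ 3 + (x + 5) ^ 3 = y ^ ℓ ↔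
      (x = 24 ∧ y = 315 ∧ ℓ = 2) ∨ (x = 24 ∧ y = -315 ∧ ℓ = 2) ∨
        (x = 95 ∧ y = 2170 ∧ ℓ = 2) ∨ (x = 95 ∧ y = -2170 ∧ ℓ = 2) ∨
          (x = 117 ∧ y = 2940 ∧ ℓ = 2) ∨ (x = 117 ∧ y = -2940 ∧ ℓ = 2) := by
  constructor
  · intro h
    obtain ⟨z, hz⟩ : ∃ z : ℕ, x + 3 = z := ⟨(x + 3).toNat, by omega⟩
    obtain rfl : x = z - 3 := by linarith
    have hsum : 5 * (z : ℤ) * ((z : ℤ) ^ 2 + 6) = y ^ ℓ := by rw [← h]; ring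
    have hnat : 5 * z * (z ^ 2 + 6) = y.natAbs ^ ℓ := by
      rw [← Int.natAbs_pow, ← hsum]
      norm_cast
    have hz4 : 4 ≤ z := by omega
    by_cases hl2 : ℓ = 2
    · subst hl2
      rcases FiveCubes.eq_of_exponent_two hz4 hnat with rfl | rfl | rfl
      · have := sq_eq_sq_iff_eq_or_eq_neg.mp (show y ^ 2 = 315 ^ 2 by rw [← hsum]; norm_num)
        omega
      · have := sq_eq_sq_iff_eq_or_eq_neg.mp (show y ^ 2 = 2170 ^ 2 by rw [← hsum]; norm_num)
        omega
      · have := sq_eq_sq_iff_eq_or_eq_neg.mp (show y ^ 2 = 2940 ^ 2 by rw [← hsum]; norm_num)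
        omega
    · exact (FiveCubes.false_of_odd_prime_exponent hℓ hl2 hz4 hnat).elim
  · rintro (⟨rfl, rfl, rfl⟩ | ⟨rfl, rfl, rfl⟩ | ⟨rfl, rfl, rfl⟩ | ⟨rfl, rfl, rfl⟩ |
      ⟨rfl, rfl, rfl⟩ | ⟨rfl, rfl, rfl⟩) <;> norm_num
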